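/- arXiv:2402.13451 — 2 statements merged into one kernel-verified Lean document; each statement's English description precedes it below -/
import Mathlib

section
/- Let m, n be positive integers with m/n ∈ [1/2, 2] and max{m,n} ≥ 4, and with |m − n| ≠ 2 unless {m,n} = {2,4}. Then the Folklore set FS_{m,n} with respect to the maximum norms is non-empty; in fact dim_H FS_{m,n} ≥ mn − 2·max{m,n}, and the matrices can be chosen of full ℝ-rank min{m,n}. If additionally m ≠ n, then for any norms ‖·‖₁ on ℝⁿ and ‖·‖₂ on ℝᵐ the set FS_{m,n}(‖·‖₁,‖·‖₂) is non-empty and the Dirichlet spectrum {Θ(Ω) : Ω ∈ ℝ^{m×n}} accumulates at 0, in particular it is not finite. -/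
open Filter MeasureTheory
open scoped ENNReal

/-- `N` is a norm on `ℝ^k` (viewed as `Fin k → ℝ`). -/
def IsNorm {k : ℕ} (N : (Fin k → ℝ) → ℝ) : Prop :=
  (∀ x, N x = 0 ↔ x = 0) ∧ (∀ (c : ℝ) (x : Fin k → ℝ), N (c • x) = |c| * N x) ∧
    ∀ x y, N (x + y) ≤ N x + N y

/-- The best approximation function `ψ_Ω(‖·‖₁,‖·‖₂,t)` of an `m × n` matrix `Ω`. -/
noncomputable def psiGen (m n : ℕ) (N1 : (Fin n → ℝ) → ℝ) (N2 : (Fin m → ℝ) → ℝ)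
    (Ω : Fin m → Fin n → ℝ) (t : ℝ) : ℝ :=
  sInf { r : ℝ | ∃ (bh : Fin n → ℤ) (bt : Fin m → ℤ),
    1 ≤ N1 (fun i => (bh i : ℝ)) ∧ N1 (fun i => (bh i : ℝ)) ≤ t ∧
    r = N2 (fun j => (∑ i, Ω j i * (bh i : ℝ)) + (bt j : ℝ)) }

/-- `Θ(Ω) = limsup_{t→∞} t^{n/m} ψ_Ω(t)`. -/
noncomputable def ThetaGen (m n : ℕ) (N1 : (Fin n → ℝ) → ℝ) (N2 : (Fin m → ℝ) → ℝ)
    (Ω : Fin m → Fin n → ℝ) : ℝ :=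
  limsup (fun t : ℝ => t ^ ((n : ℝ) / (m : ℝ)) * psiGen m n N1 N2 Ω t) atTop

/-- `Θ̃(Ω) = liminf_{t→∞} t^{n/m} ψ_Ω(t)`. -/
noncomputable def ThetaTildeGen (m n : ℕ) (N1 : (Fin n → ℝ) → ℝ) (N2 : (Fin m → ℝ) → ℝ)
    (Ω : Fin m → Fin n → ℝ) : ℝ :=
  liminf (fun t : ℝ => t ^ ((n : ℝ) / (m : ℝ)) * psiGen m n N1 N2 Ω t) atTop

/-- `D = D^{m×n}(‖·‖₁,‖·‖₂) = sup_Ω Θ(Ω)`. -/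
noncomputable def DirichletSup (m n : ℕ) (N1 : (Fin n → ℝ) → ℝ)
    (N2 : (Fin m → ℝ) → ℝ) : ℝ :=
  ⨆ Ω : Fin m → Fin n → ℝ, ThetaGen m n N1 N2 Ω

/-- `FS_{m,n}(‖·‖₁,‖·‖₂) = Di_{m,n}(‖·‖₁,‖·‖₂) \ (Bad_{m,n} ∪ Sing_{m,n})`. -/
def FSset (m n : ℕ) (N1 : (Fin n → ℝ) → ℝ) (N2 : (Fin m → ℝ) → ℝ) :
    Set (Fin m → Fin n → ℝ) :=
  {Ω | ThetaGen m n N1 N2 Ω < DirichletSup m n N1 N2} \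
    ({Ω | 0 < ThetaTildeGen m n N1 N2 Ω} ∪ {Ω | ThetaGen m n N1 N2 Ω = 0})

/-- The maximum norm on `ℝ^k`. -/
noncomputable def supNorm {k : ℕ} (x : Fin k → ℝ) : ℝ := ⨆ i, |x i|

/-- `FS_{m,n}` with respect to maximum norms, where `D = 1`. -/
def FSmax (m n : ℕ) : Set (Fin m → Fin n → ℝ) :=
  {Ω | ThetaGen m n supNorm supNorm Ω < 1} \
    ({Ω | 0 < ThetaTildeGen m n supNorm supNorm Ω} ∪
      {Ω | ThetaGen m n supNorm supNorm Ω = 0})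

theorem IsNorm.nonneg {k : ℕ} {N : (Fin k → ℝ) → ℝ} (h : IsNorm N) (x : Fin k → ℝ) : 0 ≤ N x := by
  have h0 : N 0 = 0 := (h.1 0).2 rfl
  have h1 := h.2.2 x ((-1 : ℝ) • x)
  have h2 := h.2.1 (-1) x
  rw [h2] at h1
  simp [h0] at h1
  linarith

theorem IsNorm.abs_sub_le {k : ℕ} {N : (Fin k → ℝ) → ℝ} (h : IsNorm N) (x y : Fin k → ℝ) :
    |N x - N y| ≤ N (x - y) := by
  have h1 := h.2.2 (x - y) y
  have h2 := h.2.2 (y - x) x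
  have h3 := h.2.1 (-1) (x - y)
  simp at h1 h2 h3
  rw [h3] at h2
  rw [abs_le]; constructor <;> linarith

theorem IsNorm.exists_upper {k : ℕ} {N : (Fin k → ℝ) → ℝ} (h : IsNorm N) :
    ∃ C : ℝ, 0 < C ∧ ∀ x, N x ≤ C * ‖x‖ := by
  refine ⟨∑ i, N (Pi.single i 1) + 1, ?_, fun x => ?_⟩
  · have : 0 ≤ ∑ i, N (Pi.single i (1 : ℝ)) := Finset.sum_nonneg fun i _ => h.nonneg _
    linarith
  · have hsum : ∀ s : Finset (Fin k), N (∑ i ∈ s, x i • Pi.single i (1 : ℝ)) ≤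
        ∑ i ∈ s, ‖x‖ * N (Pi.single i 1) := by
      intro s
      induction s using Finset.induction_on with
      | empty => simp [(h.1 0).2 rfl]
      | insert a s ha ih =>
        rw [Finset.sum_insert ha, Finset.sum_insert ha]
        refine (h.2.2 _ _).trans (add_le_add ?_ ih)
        rw [h.2.1]
        exact mul_le_mul_of_nonneg_right (norm_le_pi_norm x a) (h.nonneg _)
    have hx : ∑ i, x i • Pi.single i (1 : ℝ) = x := by
      ext j
      simp [Finset.sum_apply, Pi.single_apply]
    have := hsum Finset.univ
    rw [hx, ← Finset.mul_sum] at this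
    nlinarith [norm_nonneg x]

theorem IsNorm.continuous {k : ℕ} {N : (Fin k → ℝ) → ℝ} (h : IsNorm N) : Continuous N := by
  obtain ⟨C, hC, hN⟩ := h.exists_upper
  refine LipschitzWith.continuous (K := ⟨C, hC.le⟩) (LipschitzWith.of_dist_le_mul fun x y => ?_)
  rw [Real.dist_eq, dist_eq_norm]
  exact (h.abs_sub_le x y).trans (hN _)

theorem IsNorm.exists_lower {k : ℕ} {N : (Fin k → ℝ) → ℝ} (h : IsNorm N) :
    ∃ c : ℝ, 0 < c ∧ ∀ x, c * ‖x‖ ≤ N x := by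
  rcases isEmpty_or_nonempty (Fin k) with he | he
  · refine ⟨1, one_pos, fun x => ?_⟩
    rw [Subsingleton.elim x 0]
    simp [(h.1 0).2 rfl]
  · obtain ⟨x0, hx0, hmin⟩ := (isCompact_sphere (0 : Fin k → ℝ) 1).exists_isMinOn
      (NormedSpace.sphere_nonempty.2 zero_le_one) h.continuous.continuousOn
    have hx0' : x0 ≠ 0 := by
      rintro rfl
      simp at hx0
    refine ⟨N x0, lt_of_le_of_ne (h.nonneg _) (fun e => hx0' ((h.1 x0).1 e.symm)), fun x => ?_⟩
    by_cases hx : x = 0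
    · simp [hx, (h.1 0).2 rfl]
    · have hp : 0 < ‖x‖ := norm_pos_iff.2 hx
      have h1 : N x0 ≤ N (‖x‖⁻¹ • x) := hmin (by simp [norm_smul, hp.ne'])
      rw [h.2.1, abs_of_pos (inv_pos.2 hp)] at h1
      calc N x0 * ‖x‖ ≤ ‖x‖⁻¹ * N x * ‖x‖ := mul_le_mul_of_nonneg_right h1 hp.le
        _ = N x := by field_simp

theorem supNorm_eq_norm {k : ℕ} (x : Fin k → ℝ) : supNorm x = ‖x‖ := by
  refine le_antisymm (Real.iSup_le (fun i => norm_le_pi_norm x i) (norm_nonneg _)) ?_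
  refine (pi_norm_le_iff_of_nonneg (Real.iSup_nonneg fun i => abs_nonneg _)).2 fun i => ?_
  exact le_ciSup (f := fun i => |x i|) (Set.finite_range _).bddAbove i

theorem isNorm_supNorm (k : ℕ) : IsNorm (supNorm (k := k)) := by
  refine ⟨fun x => ?_, fun c x => ?_, fun x y => ?_⟩
  · rw [supNorm_eq_norm, norm_eq_zero]
  · rw [supNorm_eq_norm, supNorm_eq_norm, norm_smul, Real.norm_eq_abs]
  · simp only [supNorm_eq_norm]
    exact norm_add_le x y

/-- The values over which `psiGen` takes the infimum. -/
def approxErrors (m n : ℕ) (N1 : (Fin n → ℝ) → ℝ) (N2 : (Fin m → ℝ) → ℝ)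
    (Ω : Fin m → Fin n → ℝ) (t : ℝ) : Set ℝ :=
  { r : ℝ | ∃ (bh : Fin n → ℤ) (bt : Fin m → ℤ),
    1 ≤ N1 (fun i => (bh i : ℝ)) ∧ N1 (fun i => (bh i : ℝ)) ≤ t ∧
    r = N2 (fun j => (∑ i, Ω j i * (bh i : ℝ)) + (bt j : ℝ)) }

/-- The normalized best approximation function `t ^ (n / m) * ψ_Ω(t)`. -/
noncomputable def scaledPsi (m n : ℕ) (N1 : (Fin n → ℝ) → ℝ) (N2 : (Fin m → ℝ) → ℝ)
    (Ω : Fin m → Fin n → ℝ) (t : ℝ) : ℝ :=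
  t ^ ((n : ℝ) / (m : ℝ)) * psiGen m n N1 N2 Ω t

section Basic

variable {m n : ℕ} {N1 : (Fin n → ℝ) → ℝ} {N2 : (Fin m → ℝ) → ℝ}

theorem approxErrors_nonneg (h2 : IsNorm N2) (Ω : Fin m → Fin n → ℝ) (t : ℝ) :
    ∀ r ∈ approxErrors m n N1 N2 Ω t, 0 ≤ r := by
  rintro r ⟨bh, bt, -, -, rfl⟩
  exact h2.nonneg _

theorem approxErrors_bddBelow (h2 : IsNorm N2) (Ω : Fin m → Fin n → ℝ) (t : ℝ) :
    BddBelow (approxErrors m n N1 N2 Ω t) :=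
  ⟨0, fun r hr => approxErrors_nonneg h2 Ω t r hr⟩

theorem psiGen_nonneg (h2 : IsNorm N2) (Ω : Fin m → Fin n → ℝ) (t : ℝ) :
    0 ≤ psiGen m n N1 N2 Ω t :=
  Real.sInf_nonneg (approxErrors_nonneg h2 Ω t)

theorem scaledPsi_nonneg (h2 : IsNorm N2) (Ω : Fin m → Fin n → ℝ) {t : ℝ} (ht : 0 ≤ t) :
    0 ≤ scaledPsi m n N1 N2 Ω t :=
  mul_nonneg (Real.rpow_nonneg ht _) (psiGen_nonneg h2 Ω t)

theorem psiGen_le (h2 : IsNorm N2) (Ω : Fin m → Fin n → ℝ) {t : ℝ} (bh : Fin n → ℤ)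
    (bt : Fin m → ℤ) (hb : 1 ≤ N1 (fun i => (bh i : ℝ))) (ht : N1 (fun i => (bh i : ℝ)) ≤ t) :
    psiGen m n N1 N2 Ω t ≤ N2 (fun j => (∑ i, Ω j i * (bh i : ℝ)) + (bt j : ℝ)) :=
  csInf_le (approxErrors_bddBelow h2 Ω t) ⟨bh, bt, hb, ht, rfl⟩

theorem psiGen_le_add (h1 : IsNorm N1) (h2 : IsNorm N2) :
    ∃ C : ℝ, 0 ≤ C ∧ ∀ (Ω Ω' : Fin m → Fin n → ℝ) (t : ℝ), 0 ≤ t →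
      psiGen m n N1 N2 Ω t ≤ psiGen m n N1 N2 Ω' t + C * t * dist Ω Ω' := by
  obtain ⟨c, hc, hcN⟩ := h1.exists_lower
  obtain ⟨C, hC, hCN⟩ := h2.exists_upper
  refine ⟨C * (n / c), by positivity, fun Ω Ω' t ht0 => ?_⟩
  by_cases hne : (approxErrors m n N1 N2 Ω' t).Nonempty
  · rw [← sub_le_iff_le_add]
    refine le_csInf hne ?_
    rintro r ⟨bh, bt, hb, ht, rfl⟩
    rw [sub_le_iff_le_add]
    refine (psiGen_le h2 Ω bh bt hb ht).trans ?_
    have h3 := h2.abs_sub_le (fun j => (∑ i, Ω j i * (bh i : ℝ)) + (bt j : ℝ))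
      (fun j => (∑ i, Ω' j i * (bh i : ℝ)) + (bt j : ℝ))
    have h4 := (le_abs_self _).trans h3
    have h5 := hCN ((fun j => (∑ i, Ω j i * (bh i : ℝ)) + (bt j : ℝ)) -
      (fun j => (∑ i, Ω' j i * (bh i : ℝ)) + (bt j : ℝ)))
    have hbn : ‖fun i => (bh i : ℝ)‖ ≤ t / c := by
      rw [le_div_iff₀ hc, mul_comm]
      exact (hcN _).trans ht
    have h6 : ‖((fun j => (∑ i, Ω j i * (bh i : ℝ)) + (bt j : ℝ)) -
      (fun j => (∑ i, Ω' j i * (bh i : ℝ)) + (bt j : ℝ)))‖ ≤ n * (dist Ω Ω' * (t / c)) := by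
      have h0 : 0 ≤ t / c := (norm_nonneg _).trans hbn
      refine (pi_norm_le_iff_of_nonneg (by positivity)).2 fun j => ?_
      have : ((fun j => (∑ i, Ω j i * (bh i : ℝ)) + (bt j : ℝ)) -
        (fun j => (∑ i, Ω' j i * (bh i : ℝ)) + (bt j : ℝ))) j
          = ∑ i, (Ω j i - Ω' j i) * (bh i : ℝ) := by
        simp [sub_mul, Finset.sum_sub_distrib]
      rw [this]
      refine (norm_sum_le _ _).trans ?_
      refine (Finset.sum_le_card_nsmul _ _ (dist Ω Ω' * (t / c)) fun i _ => ?_).trans (by simp)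
      rw [norm_mul]
      refine mul_le_mul ?_ ?_ (norm_nonneg _) dist_nonneg
      · exact (dist_le_pi_dist (Ω j) (Ω' j) i).trans (dist_le_pi_dist Ω Ω' j)
      · exact (norm_le_pi_norm (fun i => (bh i : ℝ)) i).trans hbn
    have h7 : C * (n * (dist Ω Ω' * (t / c))) = C * (n / c) * t * dist Ω Ω' := by ring
    have h8 := mul_le_mul_of_nonneg_left h6 hC.le
    linarith
  · have hemp : ∀ bh : Fin n → ℤ, 1 ≤ N1 (fun i => (bh i : ℝ)) → N1 (fun i => (bh i : ℝ)) ≤ t →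
        False := fun bh hb ht => hne ⟨_, bh, 0, hb, ht, rfl⟩
    have e : ∀ Ω, psiGen m n N1 N2 Ω t = 0 := by
      intro Ω
      have : approxErrors m n N1 N2 Ω t = ∅ := by
        ext r
        simp only [Set.mem_empty_iff_false, iff_false]
        rintro ⟨bh, bt, hb, ht, -⟩
        exact hemp bh hb ht
      change sInf (approxErrors m n N1 N2 Ω t) = 0
      rw [this, Real.sInf_empty]
    rw [e, e]
    positivity

theorem scaledPsi_lipschitz (h1 : IsNorm N1) (h2 : IsNorm N2) (T : ℝ) :
    ∃ K : ℝ, 0 < K ∧ ∀ (Ω Ω' : Fin m → Fin n → ℝ) (t : ℝ), 0 ≤ t → t ≤ T →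
      scaledPsi m n N1 N2 Ω t ≤ scaledPsi m n N1 N2 Ω' t + K * dist Ω Ω' := by
  obtain ⟨C, hC, h⟩ := psiGen_le_add h1 h2
  refine ⟨|T| ^ ((n : ℝ) / m) * (C * |T|) + 1, by positivity, fun Ω Ω' t ht0 htT => ?_⟩
  have ha : t ≤ |T| := htT.trans (le_abs_self T)
  calc scaledPsi m n N1 N2 Ω t
      ≤ t ^ ((n : ℝ) / m) * (psiGen m n N1 N2 Ω' t + C * t * dist Ω Ω') :=
        mul_le_mul_of_nonneg_left (h Ω Ω' t ht0) (Real.rpow_nonneg ht0 _)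
    _ = scaledPsi m n N1 N2 Ω' t + t ^ ((n : ℝ) / m) * (C * t) * dist Ω Ω' := by
        rw [scaledPsi]; ring
    _ ≤ scaledPsi m n N1 N2 Ω' t + |T| ^ ((n : ℝ) / m) * (C * |T|) * dist Ω Ω' := by
        gcongr
    _ ≤ _ := by linarith [@dist_nonneg _ _ Ω Ω']

theorem scaledPsi_eq_zero (h2 : IsNorm N2) {Ω : Fin m → Fin n → ℝ} {t : ℝ} (bh : Fin n → ℤ)
    (bt : Fin m → ℤ) (hb : 1 ≤ N1 (fun i => (bh i : ℝ))) (ht : N1 (fun i => (bh i : ℝ)) ≤ t)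
    (h : ∀ j, (∑ i, Ω j i * (bh i : ℝ)) + (bt j : ℝ) = 0) : scaledPsi m n N1 N2 Ω t = 0 := by
  have h3 := psiGen_le h2 Ω bh bt hb ht
  simp only [h] at h3
  have h4 : N2 (fun _ => 0) = 0 := (h2.1 0).2 rfl
  rw [scaledPsi, le_antisymm (h3.trans_eq h4) (psiGen_nonneg h2 Ω t), mul_zero]

end Basic


/-- A point `x` with `f x` oscillating between `0` and values close to `[a, g]`, obtained as the
limit of points for which `f` eventually vanishes. -/
theorem exists_oscillating {E : Type*} [MetricSpace E] [CompleteSpace E] (f : E → ℝ → ℝ)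
    (hf : ∀ T : ℝ, ∃ K : ℝ, 0 < K ∧ ∀ (x y : E) (t : ℝ), 0 ≤ t → t ≤ T →
      f x t ≤ f y t + K * dist x y)
    (R : E → ℝ → Prop) (hR : ∀ x T, R x T → ∀ t ≥ T, f x t = 0)
    (hmono : ∀ x T T', R x T → T ≤ T' → R x T') {S : Set E} (hS : IsClosed S)
    (hRS : ∀ x T, R x T → x ∈ S) {a g : ℝ}
    (step : ∀ x T, R x T → ∀ δ > 0, ∃ y T', R y T' ∧ dist x y < δ ∧ T ≤ T' ∧
      (∃ t, T ≤ t ∧ t ≤ T' ∧ a ≤ f y t) ∧ ∀ t ≥ T, f y t ≤ g)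
    {x₀ : E} {T₀ : ℝ} (h0 : R x₀ T₀) {δ₀ : ℝ} (hδ₀ : 0 < δ₀) :
    ∃ x ∈ S, dist x₀ x ≤ δ₀ ∧ ∀ η > 0, (∀ᶠ t in atTop, f x t ≤ g + η) ∧
      (∃ᶠ t in atTop, a - η ≤ f x t) ∧ ∃ᶠ t in atTop, f x t ≤ η := by
  let D := {s : E × ℝ × ℝ // R s.1 s.2.1 ∧ 0 ≤ s.2.1 ∧ 0 < s.2.2}
  have next : ∀ s : D, ∃ s' : D, dist s.1.1 s'.1.1 ≤ s.1.2.2 / 2 ∧ s'.1.2.2 ≤ s.1.2.2 / 2 ∧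
      s.1.2.1 + 1 ≤ s'.1.2.1 ∧ (∃ t, s.1.2.1 ≤ t ∧ t ≤ s'.1.2.1 ∧ a ≤ f s'.1.1 t) ∧
      (∀ t ≥ s.1.2.1, f s'.1.1 t ≤ g) ∧
      ∀ y, dist s'.1.1 y ≤ s'.1.2.2 → ∀ t, 0 ≤ t → t ≤ s'.1.2.1 →
        f y t ≤ f s'.1.1 t + s.1.2.2 ∧ f s'.1.1 t ≤ f y t + s.1.2.2 := by
    rintro ⟨⟨x, T, δ⟩, hx, hT, hδ⟩
    obtain ⟨y, T', hy, hd, hTT, ⟨t, ht1, ht2, ht3⟩, hle⟩ := step x T hx (δ / 2) (half_pos hδ)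
    obtain ⟨K, hK, hKf⟩ := hf (T' + 1)
    have hδ' : 0 < min (δ / 2) (δ / K) := lt_min (half_pos hδ) (div_pos hδ hK)
    refine ⟨⟨⟨y, T' + 1, min (δ / 2) (δ / K)⟩, hmono _ _ _ hy (by linarith),
      (by dsimp at hT ⊢; linarith), hδ'⟩, hd.le, min_le_left _ _, by dsimp; linarith,
      ⟨t, ht1, by dsimp; linarith, ht3⟩, hle, fun z hz t ht0 ht => ?_⟩
    have hKd : K * dist y z ≤ δ := by
      have := hz.trans (min_le_right _ _)
      rwa [le_div_iff₀ hK, mul_comm] at this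
    constructor
    · have := hKf z y t ht0 ht
      rw [dist_comm] at this
      dsimp; linarith
    · have := hKf y z t ht0 ht
      dsimp; linarith
  choose nx hd hδ hT hlow hup hclose using next
  let s₀ : D := ⟨⟨x₀, max T₀ 0, δ₀⟩, hmono _ _ _ h0 (le_max_left _ _), le_max_right _ _, hδ₀⟩
  let s : ℕ → D := fun k => nx^[k] s₀
  have hs : ∀ k, s (k + 1) = nx (s k) := fun k => Function.iterate_succ_apply' nx k s₀
  let x : ℕ → E := fun k => (s k).1.1
  let T : ℕ → ℝ := fun k => (s k).1.2.1
  let δ : ℕ → ℝ := fun k => (s k).1.2.2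
  have hTk : ∀ k, T k + 1 ≤ T (k + 1) := fun k => by simp only [T, hs]; exact hT _
  have hδk : ∀ k, δ (k + 1) ≤ δ k / 2 := fun k => by simp only [δ, hs]; exact hδ _
  have hxk : ∀ k, dist (x k) (x (k + 1)) ≤ δ k / 2 := fun k => by simp only [x, δ, hs]; exact hd _
  have hδpos : ∀ k, 0 < δ k := fun k => (s k).2.2.2
  have hTpos : ∀ k, 0 ≤ T k := fun k => (s k).2.2.1
  have hδgeo : ∀ k l, δ (k + l) ≤ δ k / 2 ^ l := by
    intro k l
    induction l with
    | zero => simp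
    | succ l ih =>
      have := hδk (k + l)
      rw [← add_assoc, pow_succ, ← div_div]
      linarith
  have hδlim : Tendsto δ atTop (nhds 0) := by
    have h : Tendsto (fun k : ℕ => δ 0 * (1 / 2 : ℝ) ^ k) atTop (nhds 0) := by
      simpa using (tendsto_pow_atTop_nhds_zero_of_lt_one (by norm_num : (0 : ℝ) ≤ 1 / 2)
        (by norm_num)).const_mul (δ 0)
    refine squeeze_zero (fun k => (hδpos k).le) (fun k => ?_) h
    have := hδgeo 0 k
    rw [zero_add] at this
    refine this.trans_eq ?_
    rw [one_div, inv_pow, div_eq_mul_inv]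
  have hgeo : ∀ k l, dist (x (k + l)) (x (k + l + 1)) ≤ δ k / 2 / 2 ^ l := by
    intro k l
    refine (hxk _).trans ?_
    rw [div_right_comm]
    have := hδgeo k l
    linarith
  have hcau : CauchySeq x := cauchySeq_of_le_geometric_two (C := δ 0) fun l => by
    simpa using hgeo 0 l
  obtain ⟨y, hy⟩ := cauchySeq_tendsto_of_complete hcau
  have hxy : ∀ k, dist (x k) y ≤ δ k := fun k => by
    have h := dist_le_of_le_geometric_two_of_tendsto₀ (f := fun l => x (k + l)) (a := y) (C := δ k)
      (fun l => hgeo k l) (by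
        have := (tendsto_add_atTop_iff_nat (f := x) k).2 hy
        simpa [add_comm] using this)
    simpa using h
  have hTlim : Tendsto T atTop atTop := by
    have : ∀ k : ℕ, (k : ℝ) ≤ T k := by
      intro k
      induction k with
      | zero => simpa using hTpos 0
      | succ k ih => push_cast; linarith [hTk k]
    exact tendsto_atTop_mono this tendsto_natCast_atTop_atTop
  have hcl : ∀ k t, 0 ≤ t → t ≤ T (k + 1) →
      f y t ≤ f (x (k + 1)) t + δ k ∧ f (x (k + 1)) t ≤ f y t + δ k := by
    intro k
    have := hclose (s k) y
    rw [← hs] at this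
    exact this (hxy (k + 1))
  refine ⟨y, hS.mem_of_tendsto hy (Eventually.of_forall fun k => hRS _ _ (s k).2.1), hxy 0,
    fun η hη => ⟨?_, ?_, ?_⟩⟩
  · obtain ⟨k₀, hk₀⟩ := eventually_atTop.1 (hδlim.eventually (ge_mem_nhds hη))
    filter_upwards [eventually_ge_atTop (T k₀)] with t ht
    have hex : ∃ l, t < T (k₀ + l) := by
      obtain ⟨l, hl⟩ := (hTlim.eventually_gt_atTop t).exists_forall_of_atTop
      exact ⟨l, hl _ (by omega)⟩
    classical
    obtain ⟨l, hl, hmin⟩ : ∃ l, t < T (k₀ + (l + 1)) ∧ T (k₀ + l) ≤ t := by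
      have h1 := Nat.find_spec hex
      have h2 : Nat.find hex ≠ 0 := fun h => by
        rw [h] at h1
        exact absurd ht (not_le.2 h1)
      obtain ⟨l, hl⟩ := Nat.exists_eq_succ_of_ne_zero h2
      refine ⟨l, ?_, not_lt.1 (Nat.find_min hex (by omega))⟩
      rw [hl] at h1
      exact h1
    have h1 := (hcl (k₀ + l) t ((hTpos _).trans hmin) hl.le).1
    have h2 := hup (s (k₀ + l)) t hmin
    rw [← hs] at h2
    have h3 := hk₀ (k₀ + l) (by omega)
    change f (x (k₀ + l + 1)) t ≤ g at h2
    linarith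
  · refine frequently_atTop.2 fun b => ?_
    obtain ⟨k, hk1, hk2⟩ := ((hTlim.eventually_ge_atTop b).and
      (hδlim.eventually (ge_mem_nhds hη))).exists
    obtain ⟨t, ht1, ht2, ht3⟩ := hlow (s k)
    rw [← hs] at ht2 ht3
    refine ⟨t, hk1.trans ht1, ?_⟩
    have := (hcl k t ((hTpos k).trans ht1) ht2).2
    change a ≤ f (x (k + 1)) t at ht3
    linarith
  · refine frequently_atTop.2 fun b => ?_
    obtain ⟨k, hk1, hk2⟩ := ((hTlim.eventually_ge_atTop b).and
      (hδlim.eventually (ge_mem_nhds hη))).exists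
    refine ⟨T (k + 1), hk1.trans (by linarith [hTk k]), ?_⟩
    have h1 := (hcl k (T (k + 1)) (hTpos _) le_rfl).1
    have h2 : f (x (k + 1)) (T (k + 1)) = 0 := hR _ _ (s (k + 1)).2.1 _ le_rfl
    linarith


theorem volume_near_int_le {b : ℤ} (hb : b ≠ 0) (c u : ℝ) {δ r : ℝ} (hδ : 0 ≤ δ) (hr : 0 ≤ r)
    (hr2 : r ≤ 1 / 2) :
    volume {y : ℝ | (u ≤ y ∧ y ≤ u + δ) ∧ ∃ k : ℤ, |y * b + c + k| ≤ r} ≤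
      ENNReal.ofReal (2 * r * (δ + 2 / |(b : ℝ)|)) := by
  have hb' : 0 < |(b : ℝ)| := abs_pos.2 (Int.cast_ne_zero.2 hb)
  set mid : ℝ := (u + δ / 2) * b + c with hmid
  set w : ℝ := δ / 2 * |(b : ℝ)| + r with hw
  have hsub : {y : ℝ | (u ≤ y ∧ y ≤ u + δ) ∧ ∃ k : ℤ, |y * b + c + k| ≤ r} ⊆
      ⋃ k ∈ Finset.Icc ⌈-mid - w⌉ ⌊-mid + w⌋,
        Metric.closedBall (-(c + k) / b : ℝ) (r / |(b : ℝ)|) := by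
    rintro y ⟨⟨h1, h2⟩, k, hk⟩
    have hy : |(y - (u + δ / 2)) * b| ≤ δ / 2 * |(b : ℝ)| := by
      rw [abs_mul]
      exact mul_le_mul_of_nonneg_right (abs_le.2 ⟨by linarith, by linarith⟩) hb'.le
    have hk' : |mid + k| ≤ w := by
      have e : mid + k = (y * b + c + k) - (y - (u + δ / 2)) * b := by rw [hmid]; ring
      rw [e]
      exact (abs_sub _ _).trans (by linarith)
    rw [abs_le] at hk'
    simp only [Set.mem_iUnion, Finset.mem_Icc, Metric.mem_closedBall, exists_prop]
    refine ⟨k, ⟨Int.ceil_le.2 (by linarith [hk'.1]), Int.le_floor.2 (by linarith [hk'.2])⟩, ?_⟩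
    rw [Real.dist_eq, le_div_iff₀ hb', ← abs_mul]
    have hbne : (b : ℝ) ≠ 0 := Int.cast_ne_zero.2 hb
    have e : (y - -(c + k) / b) * b = y * b + c + k := by field_simp; ring
    rwa [e]
  refine (measure_mono hsub).trans ((measure_biUnion_finset_le _ _).trans ?_)
  simp only [Real.volume_closedBall, Finset.sum_const, Int.card_Icc, nsmul_eq_mul]
  have hw0 : 0 ≤ w := by positivity
  have hcard : (((⌊-mid + w⌋ + 1 - ⌈-mid - w⌉).toNat : ℕ) : ℝ) ≤ δ * |(b : ℝ)| + 2 := by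
    have h1 := Int.floor_le (-mid + w)
    have h2 := Int.le_ceil (-mid - w)
    have h3 : (((⌊-mid + w⌋ + 1 - ⌈-mid - w⌉).toNat : ℤ) : ℝ) ≤ δ * |(b : ℝ)| + 2 := by
      rw [Int.toNat_eq_max]
      push_cast
      refine max_le ?_ (by positivity)
      rw [hw] at h1 h2
      linarith
    exact_mod_cast h3
  rw [← ENNReal.ofReal_natCast, ← ENNReal.ofReal_mul (by positivity)]
  refine ENNReal.ofReal_le_ofReal ?_
  calc _ ≤ (δ * |(b : ℝ)| + 2) * (2 * (r / |(b : ℝ)|)) :=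
        mul_le_mul_of_nonneg_right hcard (by positivity)
    _ = _ := by field_simp

theorem volume_pi_near_int_le {ι : Type*} [Fintype ι] {b : ℤ} (hb : b ≠ 0) (c u : ι → ℝ)
    {δ r : ℝ} (hδ : 0 ≤ δ) (hr : 0 ≤ r) (hr2 : r ≤ 1 / 2) :
    volume {y : ι → ℝ | ∀ j, (u j ≤ y j ∧ y j ≤ u j + δ) ∧ ∃ k : ℤ, |y j * b + c j + k| ≤ r} ≤
      ENNReal.ofReal ((2 * r * (δ + 2 / |(b : ℝ)|)) ^ Fintype.card ι) := by
  have e : {y : ι → ℝ | ∀ j, (u j ≤ y j ∧ y j ≤ u j + δ) ∧ ∃ k : ℤ, |y j * b + c j + k| ≤ r} =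
      Set.univ.pi fun j => {y : ℝ | (u j ≤ y ∧ y ≤ u j + δ) ∧ ∃ k : ℤ, |y * b + c j + k| ≤ r} := by
    ext y
    simp [Set.mem_pi]
  rw [e, volume_pi_pi, ENNReal.ofReal_pow (by positivity)]
  refine (Finset.prod_le_pow_card _ _ _ fun j _ => volume_near_int_le hb (c j) (u j) hδ hr hr2).trans
    (le_of_eq ?_)
  rfl

/-- The error allowed at height `T` for generic matrices. -/
noncomputable def genericRadius (m n T : ℕ) : ℝ :=
  1 / (8 * 3 ^ n) * (T : ℝ) ^ (-((n : ℝ) / m))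

theorem genericRadius_nonneg (m n T : ℕ) : 0 ≤ genericRadius m n T := by
  unfold genericRadius; positivity

theorem genericRadius_le (m n : ℕ) {T : ℕ} (hT : 0 < T) : genericRadius m n T ≤ 1 / 2 := by
  have h1 : (1 : ℝ) ≤ 3 ^ n := one_le_pow₀ (by norm_num)
  have h2 : (T : ℝ) ^ (-((n : ℝ) / m)) ≤ 1 :=
    Real.rpow_le_one_of_one_le_of_nonpos (by exact_mod_cast hT)
      (neg_nonpos.2 (by positivity))
  have h3 : 1 / (8 * 3 ^ n : ℝ) ≤ 1 / 2 := one_div_le_one_div_of_le (by norm_num) (by linarith)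
  unfold genericRadius
  calc _ ≤ 1 / 2 * (1 : ℝ) := mul_le_mul h3 h2 (by positivity) (by norm_num)
    _ = _ := by norm_num

theorem two_mul_genericRadius_pow_le {m n T : ℕ} (hm : 0 < m) :
    (2 * genericRadius m n T) ^ m ≤ 1 / (4 * 3 ^ n * (T : ℝ) ^ n) := by
  have hm' : (m : ℝ) ≠ 0 := by positivity
  have h1 : ((T : ℝ) ^ (-((n : ℝ) / m))) ^ m = 1 / (T : ℝ) ^ n := by
    rw [← Real.rpow_natCast, ← Real.rpow_mul (by positivity), neg_mul, div_mul_cancel₀ _ hm',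
      Real.rpow_neg (by positivity), Real.rpow_natCast, one_div]
  have h2 : 2 * genericRadius m n T = 1 / (4 * 3 ^ n) * (T : ℝ) ^ (-((n : ℝ) / m)) := by
    unfold genericRadius
    field_simp
    ring
  have h4 : (1 : ℝ) ≤ 3 ^ n := one_le_pow₀ (by norm_num)
  have h3 : (1 / (4 * 3 ^ n) : ℝ) ^ m ≤ 1 / (4 * 3 ^ n) := by
    refine pow_le_of_le_one (by positivity) ?_ hm.ne'
    rw [div_le_one (by positivity)]
    linarith
  rw [h2, mul_pow, h1]
  calc _ ≤ 1 / (4 * 3 ^ n) * (1 / (T : ℝ) ^ n) := mul_le_mul_of_nonneg_right h3 (by positivity)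
    _ = _ := by rw [one_div_mul_one_div]

theorem eventually_sum_Icc_le (m : ℕ) {δ : ℝ} (hδ : 0 < δ) :
    ∀ᶠ T : ℕ in atTop, ∑ x ∈ Finset.Icc (-(T : ℤ)) T, (δ + 2 / |(x : ℝ)|) ^ m ≤
      8 * T * δ ^ m := by
  have hlim : Tendsto (fun i : ℕ => (δ + 2 / (i : ℝ)) ^ m) atTop (nhds (δ ^ m)) := by
    have : Tendsto (fun i : ℕ => δ + 2 / (i : ℝ)) atTop (nhds (δ + 0)) :=
      tendsto_const_nhds.add (tendsto_const_div_atTop_nhds_zero_nat 2)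
    simpa using this.pow m
  have hev : ∀ᶠ N : ℕ in atTop, (N : ℝ)⁻¹ * ∑ i ∈ Finset.range N, (δ + 2 / (i : ℝ)) ^ m ≤
      2 * δ ^ m :=
    hlim.cesaro.eventually (ge_mem_nhds (by linarith [pow_pos hδ m]))
  filter_upwards [(tendsto_add_atTop_nat 1).eventually hev, eventually_ge_atTop 1] with T hT hT1
  have hT2 : ∑ i ∈ Finset.range (T + 1), (δ + 2 / (i : ℝ)) ^ m ≤ 4 * T * δ ^ m := by
    rw [inv_mul_le_iff₀ (by positivity)] at hT
    refine hT.trans ?_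
    have : (1 : ℝ) ≤ T := by exact_mod_cast hT1
    push_cast
    nlinarith [pow_pos hδ m]
  have hsub : Finset.Icc (-(T : ℤ)) T ⊆
      (Finset.range (T + 1)).image (fun i : ℕ => (i : ℤ)) ∪
        (Finset.range (T + 1)).image (fun i : ℕ => -(i : ℤ)) := by
    intro x hx
    rw [Finset.mem_Icc] at hx
    simp only [Finset.mem_union, Finset.mem_image, Finset.mem_range]
    rcases le_total 0 x with h | h
    · exact Or.inl ⟨x.toNat, by omega, by omega⟩
    · exact Or.inr ⟨(-x).toNat, by omega, by omega⟩
  have hnn : ∀ x : ℤ, 0 ≤ (δ + 2 / |(x : ℝ)|) ^ m := fun x => by positivity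
  calc _ ≤ _ := Finset.sum_le_sum_of_subset_of_nonneg hsub fun x _ _ => hnn x
    _ ≤ ∑ x ∈ (Finset.range (T + 1)).image (fun i : ℕ => (i : ℤ)), (δ + 2 / |(x : ℝ)|) ^ m +
        ∑ x ∈ (Finset.range (T + 1)).image (fun i : ℕ => -(i : ℤ)), (δ + 2 / |(x : ℝ)|) ^ m := by
      rw [← Finset.sum_union_inter]
      exact le_add_of_nonneg_right (Finset.sum_nonneg fun x _ => hnn x)
    _ ≤ 4 * T * δ ^ m + 4 * T * δ ^ m := by
      refine add_le_add ?_ ?_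
      · rw [Finset.sum_image (by intro a _ b _ h; simpa using h)]
        simpa using hT2
      · rw [Finset.sum_image (by intro a _ b _ h; simpa using h)]
        simpa using hT2
    _ = _ := by ring

/-- The entries of a column may be perturbed so that no integer vector of height at most `T` with
nonzero coefficient at that column is a good approximation. -/
theorem eventually_exists_column {m n : ℕ} (hm : 0 < m) (p : Fin n) {δ : ℝ} (hδ : 0 < δ) :
    ∀ᶠ T : ℕ in atTop, ∀ Ω : Fin m → Fin n → ℝ, ∃ y : Fin m → ℝ,
      (∀ j, Ω j p ≤ y j ∧ y j ≤ Ω j p + δ) ∧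
      ∀ b : Fin n → ℤ, b p ≠ 0 → (∀ i, |b i| ≤ T) → ∀ κ : Fin m → ℤ,
        ∃ j, genericRadius m n T < |∑ i, Function.update (Ω j) p (y j) i * b i + κ j| := by
  filter_upwards [eventually_sum_Icc_le m hδ, eventually_ge_atTop 1] with T hsum hT Ω
  by_contra! hcon
  set r := genericRadius m n T with hr
  have hr0 : 0 ≤ r := genericRadius_nonneg m n T
  have hr2 : r ≤ 1 / 2 := genericRadius_le m n hT
  let c : (Fin n → ℤ) → Fin m → ℝ := fun b j => ∑ i ∈ Finset.univ.erase p, Ω j i * b i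
  have hdec : ∀ (b : Fin n → ℤ) (y : Fin m → ℝ) (j : Fin m),
      ∑ i, Function.update (Ω j) p (y j) i * b i = y j * b p + c b j := by
    intro b y j
    rw [← Finset.add_sum_erase _ _ (Finset.mem_univ p), Function.update_self]
    congr 1
    refine Finset.sum_congr rfl fun i hi => ?_
    rw [Function.update_of_ne (Finset.ne_of_mem_erase hi)]
  let B : Finset (Fin n → ℤ) :=
    (Fintype.piFinset fun _ => Finset.Icc (-(T : ℤ)) T).filter fun b => b p ≠ 0
  have hcover : (Set.Icc (fun j => Ω j p) (fun j => Ω j p + δ)) ⊆ ⋃ b ∈ B,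
      {y : Fin m → ℝ | ∀ j, (Ω j p ≤ y j ∧ y j ≤ Ω j p + δ) ∧
        ∃ k : ℤ, |y j * b p + c b j + k| ≤ r} := by
    intro y hy
    have hy' : ∀ j, Ω j p ≤ y j ∧ y j ≤ Ω j p + δ := fun j => ⟨hy.1 j, hy.2 j⟩
    obtain ⟨b, hbp, hbT, κ, hκ⟩ := hcon y hy'
    simp only [Set.mem_iUnion, exists_prop]
    refine ⟨b, ?_, fun j => ⟨hy' j, κ j, ?_⟩⟩
    · simp only [B, Finset.mem_filter, Fintype.mem_piFinset, Finset.mem_Icc]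
      exact ⟨fun i => abs_le.1 (hbT i), hbp⟩
    · rw [← hdec]
      exact hκ j
  have hvol := (measure_mono hcover).trans (measure_biUnion_finset_le (μ := volume) _ _)
  have hbound : ∑ b ∈ B, volume {y : Fin m → ℝ | ∀ j, (Ω j p ≤ y j ∧ y j ≤ Ω j p + δ) ∧
        ∃ k : ℤ, |y j * b p + c b j + k| ≤ r} ≤ ENNReal.ofReal (3 / 4 * δ ^ m) := by
    calc _ ≤ ∑ b ∈ B, ENNReal.ofReal ((2 * r * (δ + 2 / |(b p : ℝ)|)) ^ m) := by
          refine Finset.sum_le_sum fun b hb => ?_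
          have := volume_pi_near_int_le (Finset.mem_filter.1 hb).2 (c b) (fun j => Ω j p)
            hδ.le hr0 hr2
          rwa [Fintype.card_fin] at this
      _ = ENNReal.ofReal (∑ b ∈ B, (2 * r * (δ + 2 / |(b p : ℝ)|)) ^ m) :=
          (ENNReal.ofReal_sum_of_nonneg fun b _ => by positivity).symm
      _ ≤ _ := by
          refine ENNReal.ofReal_le_ofReal ?_
          have hn : 0 < n := p.pos
          have hT' : (1 : ℝ) ≤ T := by exact_mod_cast hT
          calc _ ≤ ∑ b ∈ Fintype.piFinset fun _ : Fin n => Finset.Icc (-(T : ℤ)) T,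
                (2 * r * (δ + 2 / |(b p : ℝ)|)) ^ m :=
                Finset.sum_le_sum_of_subset_of_nonneg (Finset.filter_subset _ _)
                  fun b _ _ => by positivity
            _ = (2 * T + 1 : ℝ) ^ (n - 1) * ((2 * r) ^ m *
                ∑ x ∈ Finset.Icc (-(T : ℤ)) T, (δ + 2 / |(x : ℝ)|) ^ m) := by
              rw [Fintype.sum_piFinset_apply
                (fun x : ℤ => (2 * r * (δ + 2 / |(x : ℝ)|)) ^ m) _ p]
              have hc : ((T : ℤ) + 1 - -(T : ℤ)).toNat = 2 * T + 1 := by omega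
              simp only [mul_pow, ← Finset.mul_sum, Int.card_Icc, Fintype.card_fin, nsmul_eq_mul,
                hc]
              push_cast
              rfl
            _ ≤ (3 * T : ℝ) ^ (n - 1) * (1 / (4 * 3 ^ n * (T : ℝ) ^ n) * (8 * T * δ ^ m)) := by
              gcongr
              · linarith
              · exact two_mul_genericRadius_pow_le hm
            _ = 2 / 3 * δ ^ m := by
              obtain ⟨l, rfl⟩ : ∃ l, n = l + 1 := ⟨n - 1, by omega⟩
              rw [Nat.add_sub_cancel, mul_pow, pow_succ, pow_succ]
              field_simp
              ring
            _ ≤ _ := by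
              have := pow_pos hδ m
              linarith
  have hcube : volume (Set.Icc (fun j => Ω j p) (fun j => Ω j p + δ)) = ENNReal.ofReal (δ ^ m) := by
    rw [Real.volume_Icc_pi]
    simp [ENNReal.ofReal_pow hδ.le]
  rw [hcube] at hvol
  have h := (ENNReal.ofReal_le_ofReal_iff (by positivity)).1 (hvol.trans hbound)
  linarith [pow_pos hδ m]


theorem volume_matrix_near_int_le {S : Type*} [Fintype S] [DecidableEq S] {m : ℕ} {b : S → ℤ}
    (hb : b ≠ 0) (u : Fin m × S → ℝ) {δ r : ℝ} (hδ : 0 ≤ δ) (hδ1 : δ ≤ 1) (hr : 0 ≤ r)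
    (hr2 : r ≤ 1 / 2) :
    volume {A : Fin m × S → ℝ | (∀ x, u x ≤ A x ∧ A x ≤ u x + δ) ∧
      ∀ j, ∃ k : ℤ, |∑ i, A (j, i) * b i + k| ≤ r} ≤ ENNReal.ofReal ((6 * r) ^ m) := by
  obtain ⟨i₀, hi₀⟩ := Function.ne_iff.1 hb
  set W := {A : Fin m × S → ℝ | (∀ x, u x ≤ A x ∧ A x ≤ u x + δ) ∧
      ∀ j, ∃ k : ℤ, |∑ i, A (j, i) * b i + k| ≤ r} with hW
  have hWm : MeasurableSet W := by
    refine MeasurableSet.inter ?_ ?_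
    · exact measurableSet_setOfPred.2 (by fun_prop)
    · refine measurableSet_setOfPred.2 (Measurable.forall fun j => Measurable.exists fun k => ?_)
      refine measurableSet_setOfPred.1 (measurableSet_le (by fun_prop) measurable_const)
  let P : Fin m × S → Prop := fun x => x.2 = i₀
  let e := MeasurableEquiv.piEquivPiSubtypeProd (fun _ : Fin m × S => ℝ) P
  have he : MeasurePreserving e volume volume :=
    volume_preserving_piEquivPiSubtypeProd (fun _ : Fin m × S => ℝ) P
  rw [← (he.symm e).measure_preimage_equiv W, Measure.volume_eq_prod,
    Measure.prod_apply_symm (e.symm.measurable hWm)]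
  let Z : Set ({x : Fin m × S // ¬ P x} → ℝ) := Set.Icc (fun x => u x) (fun x => u x + δ)
  have hcard : Fintype.card {x : Fin m × S // P x} = m := by
    rw [Fintype.card_congr (β := Fin m) ⟨fun x => x.1.1, fun j => ⟨(j, i₀), rfl⟩, fun x => ?_,
      fun j => rfl⟩, Fintype.card_fin]
    obtain ⟨⟨j, i⟩, h⟩ := x
    simp only [P] at h
    subst h
    rfl
  have hslice : ∀ z : {x : Fin m × S // ¬ P x} → ℝ,
      volume ((fun y => (y, z)) ⁻¹' (e.symm ⁻¹' W)) ≤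
        Z.indicator (fun _ => ENNReal.ofReal ((6 * r) ^ m)) z := by
    intro z
    have hP : ∀ (y : {x : Fin m × S // P x} → ℝ) (x : {x : Fin m × S // P x}),
        e.symm (y, z) x = y x := fun y x => dif_pos x.2
    have hN : ∀ (y : {x : Fin m × S // P x} → ℝ) (x : {x : Fin m × S // ¬ P x}),
        e.symm (y, z) x = z x := fun y x => dif_neg x.2
    by_cases hz : z ∈ Z
    · rw [Set.indicator_of_mem hz]
      let c : {x : Fin m × S // P x} → ℝ := fun x =>
        ∑ i ∈ Finset.univ.erase i₀, e.symm (0, z) (x.1.1, i) * b i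
      refine (measure_mono ?_).trans ((volume_pi_near_int_le hi₀ c (fun x => u x) hδ hr hr2).trans
        (ENNReal.ofReal_le_ofReal ?_))
      · rintro y ⟨h1, h2⟩ x
        have h3 := h1 x
        rw [hP] at h3
        obtain ⟨k, hk⟩ := h2 x.1.1
        refine ⟨h3, k, ?_⟩
        convert hk using 3
        rw [← Finset.add_sum_erase _ _ (Finset.mem_univ i₀)]
        congr 1
        · have : ((x : Fin m × S).1, i₀) = (x : Fin m × S) := Prod.ext rfl x.2.symm
          rw [this, hP]
        · refine Finset.sum_congr rfl fun i hi => ?_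
          have hx : ¬ P ((x : Fin m × S).1, i) := Finset.ne_of_mem_erase hi
          have h4 := hN 0 ⟨_, hx⟩
          have h5 := hN y ⟨_, hx⟩
          simp only at h4 h5
          rw [h4, h5]
      · rw [hcard]
        refine pow_le_pow_left₀ (by positivity) ?_ m
        have h6 : (1 : ℝ) ≤ |(b i₀ : ℝ)| := by
          exact_mod_cast Int.one_le_abs hi₀
        have h7 : 2 / |(b i₀ : ℝ)| ≤ 2 := div_le_self (by norm_num) h6
        nlinarith
    · rw [Set.indicator_of_notMem hz]
      have : (fun y => (y, z)) ⁻¹' (e.symm ⁻¹' W) = ∅ := by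
        ext y
        simp only [Set.mem_preimage, Set.mem_empty_iff_false, iff_false]
        rintro ⟨h1, -⟩
        refine hz ⟨fun x => ?_, fun x => ?_⟩
        · have := (h1 x).1
          rwa [hN] at this
        · have := (h1 x).2
          rwa [hN] at this
      rw [this, measure_empty]
  refine (lintegral_mono hslice).trans ?_
  rw [lintegral_indicator_const measurableSet_Icc, Real.volume_Icc_pi]
  refine mul_le_of_le_one_right' (Finset.prod_le_one' fun x _ => ?_)
  simpa using hδ1

/-- Borel–Cantelli: almost every matrix with at least two columns fewer than `n` eventually has no
good approximations at the scale of matrices with `n` columns. -/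
theorem volume_frequently_near_int {S : Type*} [Fintype S] [DecidableEq S] {m n : ℕ} (hm : 0 < m)
    (hn : Fintype.card S + 2 ≤ n) (u : Fin m × S → ℝ) {δ : ℝ} (hδ : 0 ≤ δ) (hδ1 : δ ≤ 1) :
    volume {A : Fin m × S → ℝ | ∃ᶠ T : ℕ in atTop, (∀ x, u x ≤ A x ∧ A x ≤ u x + δ) ∧
      ∃ b : S → ℤ, b ≠ 0 ∧ (∀ i, |b i| ≤ T) ∧
        ∀ j, ∃ k : ℤ, |∑ i, A (j, i) * b i + k| ≤ genericRadius m n T} = 0 := by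
  refine measure_setOfPred_frequently_eq_zero (ne_top_of_le_ne_top (b := ∑' T : ℕ,
    ENNReal.ofReal (3 ^ m * (1 / (T : ℝ) ^ 2))) ?_ (ENNReal.tsum_le_tsum fun T => ?_))
  · exact ((Real.summable_one_div_nat_pow.2 one_lt_two).mul_left _).tsum_ofReal_ne_top
  rcases Nat.eq_zero_or_pos T with rfl | hT
  · refine (measure_mono_null ?_ measure_empty).trans_le zero_le
    rintro A ⟨-, b, hb, hb0, -⟩
    exact hb (funext fun i => by simpa using hb0 i)
  set r := genericRadius m n T with hr
  have hr0 : 0 ≤ r := genericRadius_nonneg m n T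
  have hr2 : r ≤ 1 / 2 := genericRadius_le m n hT
  let B : Finset (S → ℤ) := (Fintype.piFinset fun _ => Finset.Icc (-(T : ℤ)) T).filter (· ≠ 0)
  have hcover : {A : Fin m × S → ℝ | (∀ x, u x ≤ A x ∧ A x ≤ u x + δ) ∧
      ∃ b : S → ℤ, b ≠ 0 ∧ (∀ i, |b i| ≤ T) ∧ ∀ j, ∃ k : ℤ, |∑ i, A (j, i) * b i + k| ≤ r} ⊆
      ⋃ b ∈ B, {A : Fin m × S → ℝ | (∀ x, u x ≤ A x ∧ A x ≤ u x + δ) ∧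
        ∀ j, ∃ k : ℤ, |∑ i, A (j, i) * b i + k| ≤ r} := by
    rintro A ⟨h1, b, hb, hbT, h2⟩
    simp only [Set.mem_iUnion, exists_prop]
    refine ⟨b, ?_, h1, h2⟩
    simp only [B, Finset.mem_filter, Fintype.mem_piFinset, Finset.mem_Icc]
    exact ⟨fun i => abs_le.1 (hbT i), hb⟩
  refine (measure_mono hcover).trans ((measure_biUnion_finset_le _ _).trans ?_)
  refine (Finset.sum_le_card_nsmul B _ (ENNReal.ofReal ((6 * r) ^ m)) fun b hb =>
    volume_matrix_near_int_le (Finset.mem_filter.1 hb).2 u hδ hδ1 hr0 hr2).trans ?_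
  rw [nsmul_eq_mul, ← ENNReal.ofReal_natCast, ← ENNReal.ofReal_mul (by positivity)]
  refine ENNReal.ofReal_le_ofReal ?_
  have hT' : (1 : ℝ) ≤ T := by exact_mod_cast hT
  have hcard : (B.card : ℝ) ≤ (3 * T) ^ Fintype.card S := by
    have h1 : B.card ≤ (2 * T + 1) ^ Fintype.card S := by
      refine (Finset.card_filter_le _ _).trans ?_
      have hc : ((T : ℤ) + 1 - -(T : ℤ)).toNat = 2 * T + 1 := by omega
      simp only [Fintype.card_piFinset, Int.card_Icc, hc, Finset.prod_const, Finset.card_univ,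
        le_refl]
    calc (B.card : ℝ) ≤ (((2 * T + 1) ^ Fintype.card S : ℕ) : ℝ) := by exact_mod_cast h1
      _ ≤ _ := by
        push_cast
        gcongr
        linarith
  obtain ⟨l, rfl⟩ : ∃ l, n = Fintype.card S + 2 + l := ⟨_, (Nat.add_sub_cancel' hn).symm⟩
  have h6 : (6 * r) ^ m = 3 ^ m * (2 * r) ^ m := by
    rw [← mul_pow]; ring
  have h3 : (1 : ℝ) ≤ 3 ^ (2 + l) := one_le_pow₀ (by norm_num)
  have h4 : (1 : ℝ) ≤ (T : ℝ) ^ l := one_le_pow₀ hT'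
  rw [h6]
  calc _ ≤ (3 * T : ℝ) ^ Fintype.card S * (3 ^ m *
        (1 / (4 * 3 ^ (Fintype.card S + 2 + l) * (T : ℝ) ^ (Fintype.card S + 2 + l)))) := by
        gcongr
        exact two_mul_genericRadius_pow_le hm
    _ = 3 ^ m * (1 / (4 * 3 ^ (2 + l) * ((T : ℝ) ^ 2 * (T : ℝ) ^ l))) := by
        rw [mul_pow, pow_add, pow_add, pow_add, pow_add, pow_add]
        field_simp
    _ ≤ _ := by
        gcongr
        have : (T : ℝ) ^ 2 ≤ (T : ℝ) ^ 2 * (T : ℝ) ^ l := le_mul_of_one_le_right (by positivity) h4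
        nlinarith [pow_pos (lt_of_lt_of_le one_pos hT') 2]


/-- Integer vectors supported off the columns `p` and `q` are eventually not good approximations
for `Ω`, at the scale of generic matrices. -/
def GoodOff (m n : ℕ) (p q : Fin n) (Ω : Fin m → Fin n → ℝ) : Prop :=
  ∀ᶠ T : ℕ in atTop, ∀ b : Fin n → ℤ, b ≠ 0 → b p = 0 → b q = 0 → (∀ i, |b i| ≤ T) →
    ∀ κ : Fin m → ℤ, ∃ j, genericRadius m n T < |∑ i, Ω j i * b i + κ j|

theorem sum_mul_congr_off {n : ℕ} {p q : Fin n} {v w : Fin n → ℝ} {b : Fin n → ℤ}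
    (h : ∀ i, i ≠ p → i ≠ q → v i = w i) (hp : v p = w p ∨ b p = 0) (hq : v q = w q ∨ b q = 0) :
    ∑ i, v i * b i = ∑ i, w i * b i := by
  refine Finset.sum_congr rfl fun i _ => ?_
  by_cases hip : i = p
  · subst hip
    rcases hp with hp | hp <;> simp [hp]
  · by_cases hiq : i = q
    · subst hiq
      rcases hq with hq | hq <;> simp [hq]
    · rw [h i hip hiq]

theorem GoodOff.congr {m n : ℕ} {p q : Fin n} {Ω Ω' : Fin m → Fin n → ℝ} (h : GoodOff m n p q Ω)
    (hΩ : ∀ j i, i ≠ p → i ≠ q → Ω' j i = Ω j i) : GoodOff m n p q Ω' := by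
  filter_upwards [h] with T hT b hb hp hq hbT κ
  obtain ⟨j, hj⟩ := hT b hb hp hq hbT κ
  refine ⟨j, ?_⟩
  rwa [sum_mul_congr_off (hΩ j) (Or.inr hp) (Or.inr hq)]

section Construction

variable {m n : ℕ} {N1 : (Fin n → ℝ) → ℝ} {N2 : (Fin m → ℝ) → ℝ}

theorem IsNorm.single_pos (h1 : IsNorm N1) (c : Fin n) : 0 < N1 (Pi.single c 1) := by
  refine lt_of_le_of_ne (h1.nonneg _) fun e => ?_
  have := congrFun ((h1.1 _).1 e.symm) c
  simp at this

theorem IsNorm.intCast_single (h1 : IsNorm N1) (c : Fin n) (N : ℕ) :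
    N1 (fun i => ((Pi.single c (N : ℤ) : Fin n → ℤ) i : ℝ)) = N * N1 (Pi.single c 1) := by
  have : (fun i => ((Pi.single c (N : ℤ) : Fin n → ℤ) i : ℝ)) =
      (N : ℝ) • (Pi.single c 1 : Fin n → ℝ) := by
    ext i
    by_cases h : i = c
    · subst h; simp
    · simp [h]
  rw [this, h1.2.1, abs_of_nonneg (Nat.cast_nonneg N)]

theorem sum_mul_single (v : Fin n → ℝ) (c : Fin n) (N : ℕ) :
    ∑ i, v i * ((Pi.single c (N : ℤ) : Fin n → ℤ) i : ℝ) = v c * N := by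
  rw [Finset.sum_eq_single c]
  · simp
  · intro i _ hi
    simp [hi]
  · simp

theorem exists_scaledPsi_ge (hm : 0 < m) (h1 : IsNorm N1) (h2 : IsNorm N2) {p q : Fin n}
    (hpq : p ≠ q) : ∃ ε : ℝ, 0 < ε ∧ ∀ Ω : Fin m → Fin n → ℝ, GoodOff m n p q Ω →
      ∀ δ > 0, ∀ T₀ : ℝ, ∃ Ω' : Fin m → Fin n → ℝ,
        (∀ j i, i ≠ p → i ≠ q → Ω' j i = Ω j i) ∧ dist Ω Ω' ≤ δ ∧
          ∃ t ≥ T₀, ε ≤ scaledPsi m n N1 N2 Ω' t := by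
  obtain ⟨c₁, hc₁, hN1⟩ := h1.exists_lower
  obtain ⟨c₂, hc₂, hN2⟩ := h2.exists_lower
  refine ⟨c₁ ^ ((n : ℝ) / m) * c₂ * (1 / (8 * 3 ^ n)), by positivity, fun Ω hΩ δ hδ T₀ => ?_⟩
  obtain ⟨N, hN⟩ := exists_nat_ge (1 / N1 (Pi.single p 1))
  rw [div_le_iff₀ (h1.single_pos p)] at hN
  have htend : Tendsto (fun T : ℕ => c₁ * (T : ℝ)) atTop atTop :=
    tendsto_natCast_atTop_atTop.const_mul_atTop hc₁
  obtain ⟨T, hT0, hTN, hT1, hgood, hp, hq⟩ := ((htend.eventually_ge_atTop T₀).and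
    ((htend.eventually_ge_atTop (N * N1 (Pi.single p 1))).and ((eventually_ge_atTop 1).and
    (hΩ.and ((eventually_exists_column hm p hδ).and (eventually_exists_column hm q hδ)))))).exists
  obtain ⟨y, hy, hyq⟩ := hq Ω
  set Ω₁ : Fin m → Fin n → ℝ := fun j => Function.update (Ω j) q (y j) with hΩ₁
  obtain ⟨z, hz, hzp⟩ := hp Ω₁
  set Ω₂ : Fin m → Fin n → ℝ := fun j => Function.update (Ω₁ j) p (z j) with hΩ₂
  have hΩ₁p : ∀ j, Ω₁ j p = Ω j p := fun j => Function.update_of_ne hpq _ _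
  have hoff₁ : ∀ j i, i ≠ q → Ω₁ j i = Ω j i := fun j i hi => Function.update_of_ne hi _ _
  have hoff₂ : ∀ j i, i ≠ p → Ω₂ j i = Ω₁ j i := fun j i hi => Function.update_of_ne hi _ _
  have hmain : ∀ b : Fin n → ℤ, b ≠ 0 → (∀ i, |b i| ≤ T) → ∀ κ : Fin m → ℤ,
      ∃ j, genericRadius m n T < |∑ i, Ω₂ j i * b i + κ j| := by
    intro b hb hbT κ
    by_cases hbp : b p = 0
    · by_cases hbq : b q = 0
      · obtain ⟨j, hj⟩ := hgood b hb hbp hbq hbT κ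
        refine ⟨j, ?_⟩
        rwa [sum_mul_congr_off (fun i hip hiq => (hoff₂ j i hip).trans (hoff₁ j i hiq))
          (Or.inr hbp) (Or.inr hbq)]
      · obtain ⟨j, hj⟩ := hyq b hbq hbT κ
        refine ⟨j, ?_⟩
        rwa [sum_mul_congr_off (fun i hip _ => hoff₂ j i hip)
          (Or.inr hbp) (Or.inl (hoff₂ j q hpq.symm))]
    · exact hzp b hbp hbT κ
  refine ⟨Ω₂, fun j i hip hiq => (hoff₂ j i hip).trans (hoff₁ j i hiq), ?_, c₁ * T, hT0, ?_⟩
  · refine (dist_pi_le_iff hδ.le).2 fun j => (dist_pi_le_iff hδ.le).2 fun i => ?_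
    rw [Real.dist_eq]
    by_cases hip : i = p
    · subst hip
      have := hz j
      rw [hΩ₁p] at this
      rw [hΩ₂]
      simp only [Function.update_self]
      exact abs_le.2 ⟨by linarith, by linarith⟩
    · rw [hoff₂ j i hip]
      by_cases hiq : i = q
      · subst hiq
        have := hy j
        rw [hΩ₁]
        simp only [Function.update_self]
        exact abs_le.2 ⟨by linarith, by linarith⟩
      · rw [hoff₁ j i hiq, sub_self, abs_zero]
        exact hδ.le
  · have hT1' : (0 : ℝ) < T := by exact_mod_cast hT1
    have hpsi : c₂ * genericRadius m n T ≤ psiGen m n N1 N2 Ω₂ (c₁ * T) := by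
      refine le_csInf ⟨_, Pi.single p (N : ℤ), 0, ?_, ?_, rfl⟩ ?_
      · rwa [h1.intCast_single]
      · rwa [h1.intCast_single]
      · rintro r ⟨bh, bt, hb, hbt, rfl⟩
        have hb0 : bh ≠ 0 := by
          rintro rfl
          have : N1 (fun i => (((0 : Fin n → ℤ) i : ℤ) : ℝ)) = 0 := by
            rw [h1.1]
            ext i
            simp
          rw [this] at hb
          linarith
        obtain ⟨j, hj⟩ := hmain bh hb0 (fun i => by
          have h3 := (hN1 _).trans hbt
          have h4 := (norm_le_pi_norm (fun i => (bh i : ℝ)) i).trans (le_of_mul_le_mul_left h3 hc₁)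
          rw [Real.norm_eq_abs] at h4
          exact_mod_cast h4) bt
        refine le_trans (mul_le_mul_of_nonneg_left ?_ hc₂.le) (hN2 _)
        exact hj.le.trans
          (norm_le_pi_norm (fun j => (∑ i, Ω₂ j i * (bh i : ℝ)) + (bt j : ℝ)) j)
    refine le_trans (le_of_eq ?_) (mul_le_mul_of_nonneg_left hpsi (by positivity))
    rw [genericRadius, Real.mul_rpow hc₁.le hT1'.le, Real.rpow_neg hT1'.le]
    have : (T : ℝ) ^ ((n : ℝ) / m) ≠ 0 := by positivity
    field_simp

/-- The column `c` of `Ω` is rational, with a denominator `N` such that the vector with the single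
nonzero entry `N` at `c` has `N1`-norm in `[1, T]`. -/
def RationalColumn (N1 : (Fin n → ℝ) → ℝ) (Ω : Fin m → Fin n → ℝ) (c : Fin n) (T : ℝ) : Prop :=
  ∃ N : ℕ, 1 ≤ N * N1 (Pi.single c 1) ∧ N * N1 (Pi.single c 1) ≤ T ∧
    ∃ z : Fin m → ℤ, ∀ j, Ω j c * N = z j

theorem RationalColumn.mono {Ω : Fin m → Fin n → ℝ} {c : Fin n} {T T' : ℝ}
    (h : RationalColumn N1 Ω c T) (hT : T ≤ T') : RationalColumn N1 Ω c T' := by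
  obtain ⟨N, hN1, hNT, h⟩ := h
  exact ⟨N, hN1, hNT.trans hT, h⟩

theorem RationalColumn.one_le {Ω : Fin m → Fin n → ℝ} {c : Fin n} {T : ℝ}
    (h : RationalColumn N1 Ω c T) : 1 ≤ T := by
  obtain ⟨N, hN1, hNT, -⟩ := h
  exact hN1.trans hNT

theorem RationalColumn.congr {Ω Ω' : Fin m → Fin n → ℝ} {c : Fin n} {T : ℝ}
    (h : RationalColumn N1 Ω c T) (hΩ : ∀ j, Ω' j c = Ω j c) : RationalColumn N1 Ω' c T := by
  obtain ⟨N, hN1, hNT, z, hz⟩ := h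
  exact ⟨N, hN1, hNT, z, fun j => by rw [hΩ, hz]⟩

theorem RationalColumn.scaledPsi_eq_zero (h1 : IsNorm N1) (h2 : IsNorm N2)
    {Ω : Fin m → Fin n → ℝ} {c : Fin n} {T : ℝ} (h : RationalColumn N1 Ω c T) {t : ℝ}
    (ht : T ≤ t) : scaledPsi m n N1 N2 Ω t = 0 := by
  obtain ⟨N, hN1, hNT, z, hz⟩ := h
  refine _root_.scaledPsi_eq_zero h2 (Pi.single c (N : ℤ)) (fun j => -z j) ?_ ?_ fun j => ?_
  · rwa [h1.intCast_single]
  · rw [h1.intCast_single]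
    exact hNT.trans ht
  · rw [sum_mul_single, hz]
    push_cast
    ring

theorem exists_rationalColumn (h1 : IsNorm N1) (Ω : Fin m → Fin n → ℝ) (c : Fin n) {η : ℝ}
    (hη : 0 < η) : ∃ w : Fin m → ℝ, (∀ j, |Ω j c - w j| ≤ η) ∧
      ∃ T, RationalColumn N1 (fun j => Function.update (Ω j) c (w j)) c T := by
  obtain ⟨N, hN⟩ := exists_nat_ge (max (1 / η) (1 / N1 (Pi.single c 1)))
  have hNη := (le_max_left _ _).trans hN
  have hNc := (le_max_right _ _).trans hN
  have hN0 : (0 : ℝ) < N := lt_of_lt_of_le (by positivity) hNη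
  rw [div_le_iff₀ (h1.single_pos c)] at hNc
  rw [div_le_iff₀ hη] at hNη
  refine ⟨fun j => ⌊Ω j c * N⌋ / N, fun j => ?_, N * N1 (Pi.single c 1), N, hNc, le_rfl,
    fun j => ⌊Ω j c * N⌋, fun j => ?_⟩
  · have e : Ω j c - ⌊Ω j c * N⌋ / N = (Ω j c * N - ⌊Ω j c * N⌋) / N := by field_simp
    rw [e, abs_div, abs_of_pos hN0, div_le_iff₀ hN0]
    have h3 := Int.floor_le (Ω j c * N)
    have h4 := Int.lt_floor_add_one (Ω j c * N)
    rw [abs_of_nonneg (by linarith)]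
    linarith
  · simp only [Function.update_self]
    field_simp

theorem dist_update_le {Ω : Fin m → Fin n → ℝ} {c : Fin n} {w : Fin m → ℝ} {η : ℝ} (hη : 0 ≤ η)
    (hw : ∀ j, |Ω j c - w j| ≤ η) : dist Ω (fun j => Function.update (Ω j) c (w j)) ≤ η := by
  refine (dist_pi_le_iff hη).2 fun j => (dist_pi_le_iff hη).2 fun i => ?_
  by_cases h : i = c
  · subst h
    simpa [Real.dist_eq] using hw j
  · simpa [h] using hη

/-- Moving from a matrix with rational column `c` to a generic nearby matrix, with the column `d`
fixed at a rational value, meets a matrix where the supremum of `scaledPsi` equals `g`. -/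
theorem exists_step (h1 : IsNorm N1) (h2 : IsNorm N2) {c d : Fin n} (hcd : c ≠ d)
    {Ω Ω' : Fin m → Fin n → ℝ} {T t₁ g δ : ℝ} (hΩ : RationalColumn N1 Ω c T)
    (hoff : ∀ j i, i ≠ c → i ≠ d → Ω' j i = Ω j i) (hdist : dist Ω Ω' ≤ δ) (hδ : 0 < δ)
    (ht₁ : T ≤ t₁) (hg : 0 < g) (hgt : g < scaledPsi m n N1 N2 Ω' t₁) :
    ∃ (Ω₁ : Fin m → Fin n → ℝ) (T' : ℝ), (∀ j i, i ≠ c → i ≠ d → Ω₁ j i = Ω j i) ∧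
      RationalColumn N1 Ω₁ d T' ∧ dist Ω Ω₁ ≤ 2 * δ ∧ T ≤ T' ∧
      (∃ t, T ≤ t ∧ t ≤ T' ∧ g / 2 ≤ scaledPsi m n N1 N2 Ω₁ t) ∧
      ∀ t ≥ T, scaledPsi m n N1 N2 Ω₁ t ≤ g := by
  have hT1 := hΩ.one_le
  obtain ⟨K, hK, hKf⟩ := scaledPsi_lipschitz (m := m) (n := n) h1 h2 t₁
  set gap := scaledPsi m n N1 N2 Ω' t₁ - g with hgap
  have hgap0 : 0 < gap := sub_pos.2 hgt
  have hη : 0 < min δ (gap / K) := lt_min hδ (div_pos hgap0 hK)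
  obtain ⟨w, hw, Tw, hTw⟩ := exists_rationalColumn h1 Ω' d hη
  set P : Fin m → Fin n → ℝ := fun j => Function.update (Ω' j) d (w j) with hP
  have hdP : dist Ω' P ≤ min δ (gap / K) := dist_update_le hη.le hw
  have hPt : g ≤ scaledPsi m n N1 N2 P t₁ := by
    have h3 := hKf Ω' P t₁ (by linarith) le_rfl
    have h4 := hdP.trans (min_le_right _ _)
    rw [le_div_iff₀ hK] at h4
    linarith
  let γ : ℝ → Fin m → Fin n → ℝ := fun s j =>
    Function.update (P j) c ((1 - s) * Ω j c + s * Ω' j c)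
  have hγ : Continuous γ := by
    refine continuous_pi fun j => Continuous.update continuous_const c ?_
    fun_prop
  have hγd : ∀ s j, γ s j d = P j d := fun s j => Function.update_of_ne hcd.symm _ _
  have hγc : ∀ s j, γ s j c = (1 - s) * Ω j c + s * Ω' j c := fun s j => Function.update_self _ _ _
  have hγoff : ∀ s j i, i ≠ c → i ≠ d → γ s j i = Ω j i := fun s j i hic hid =>
    (Function.update_of_ne hic _ _).trans ((Function.update_of_ne hid _ _).trans (hoff j i hic hid))
  have hγ1 : γ 1 = P := by
    ext j i
    by_cases hi : i = c
    · subst hi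
      rw [hγc, hP]
      simp [hcd]
    · exact Function.update_of_ne hi _ _
  set T' := max t₁ Tw with hT'
  have hTT' : T ≤ T' := ht₁.trans (le_max_left _ _)
  have hrd : ∀ s, RationalColumn N1 (γ s) d T' := fun s =>
    (hTw.congr (hγd s)).mono (le_max_right _ _)
  have hr0 : RationalColumn N1 (γ 0) c T := hΩ.congr fun j => by rw [hγc]; ring
  obtain ⟨K', hK', hKf'⟩ := scaledPsi_lipschitz (m := m) (n := n) h1 h2 T'
  have hzero : ∀ t, T ≤ t → scaledPsi m n N1 N2 (γ 0) t = 0 := fun t ht =>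
    hr0.scaledPsi_eq_zero h1 h2 ht
  let G : (Fin m → Fin n → ℝ) → ℝ := fun A => ⨆ t : Set.Icc T T', scaledPsi m n N1 N2 A t
  have : Nonempty (Set.Icc T T') := ⟨⟨T, le_rfl, hTT'⟩⟩
  have hbdd : ∀ A, BddAbove (Set.range fun t : Set.Icc T T' => scaledPsi m n N1 N2 A t) := by
    rintro A
    refine ⟨K' * dist A (γ 0), ?_⟩
    rintro _ ⟨⟨t, ht, ht'⟩, rfl⟩
    have h3 := hKf' A (γ 0) t (by linarith) ht'
    rwa [hzero t ht, zero_add] at h3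
  have hG : Continuous G := by
    refine (LipschitzWith.of_le_add_mul ⟨K', hK'.le⟩ fun A B => ciSup_le fun t => ?_).continuous
    exact (hKf' A B t (by linarith [t.2.1]) t.2.2).trans
      (add_le_add (le_ciSup (hbdd B) t) le_rfl)
  have hG0 : G (γ 0) = 0 := by
    have : ∀ t : Set.Icc T T', scaledPsi m n N1 N2 (γ 0) t = 0 := fun t => hzero t t.2.1
    simp only [G, this, ciSup_const]
  have hG1 : g ≤ G (γ 1) := by
    rw [hγ1]
    exact hPt.trans (le_ciSup (hbdd P) ⟨t₁, ht₁, le_max_left _ _⟩)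
  obtain ⟨s, ⟨hs0, hs1⟩, hs⟩ := intermediate_value_Icc zero_le_one
    (hG.comp hγ).continuousOn (show g ∈ Set.Icc ((G ∘ γ) 0) ((G ∘ γ) 1) from
      ⟨by simp only [Function.comp, hG0]; exact hg.le, hG1⟩)
  refine ⟨γ s, T', hγoff s, hrd s, ?_, hTT', ?_, fun t ht => ?_⟩
  · have hent : ∀ j i, |Ω j i - Ω' j i| ≤ δ := fun j i =>
      ((dist_le_pi_dist (Ω j) (Ω' j) i).trans (dist_le_pi_dist Ω Ω' j)).trans hdist
    have h2δ : 0 ≤ 2 * δ := by linarith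
    refine (dist_pi_le_iff h2δ).2 fun j => (dist_pi_le_iff h2δ).2 fun i => ?_
    rw [Real.dist_eq]
    by_cases hic : i = c
    · subst hic
      have e : Ω j i - γ s j i = s * (Ω j i - Ω' j i) := by rw [hγc]; ring
      rw [e, abs_mul, abs_of_nonneg hs0]
      have := hent j i
      nlinarith [abs_nonneg (Ω j i - Ω' j i)]
    · by_cases hid : i = d
      · subst hid
        rw [hγd]
        have h3 := hent j i
        have h4 := ((dist_le_pi_dist (Ω' j) (P j) i).trans (dist_le_pi_dist Ω' P j)).trans
          (hdP.trans (min_le_left _ _))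
        rw [Real.dist_eq] at h4
        exact (abs_sub_le _ (Ω' j i) _).trans (by linarith)
      · rw [hγoff s j i hic hid, sub_self, abs_zero]
        exact h2δ
  · obtain ⟨t, ht⟩ := exists_lt_of_lt_ciSup (show g / 2 < G (γ s) from by
      change G (γ s) = g at hs
      rw [hs]
      linarith)
    exact ⟨t, t.2.1, t.2.2, ht.le⟩
  · rcases le_total t T' with htT | htT
    · refine (le_ciSup (hbdd (γ s)) ⟨t, ht, htT⟩).trans_eq hs
    · rw [(hrd s).scaledPsi_eq_zero h1 h2 htT]
      exact hg.le

theorem exists_thetaGen (hm : 0 < m) (h1 : IsNorm N1) (h2 : IsNorm N2) {p q : Fin n}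
    (hpq : p ≠ q) : ∃ ε : ℝ, 0 < ε ∧ ∀ g : ℝ, 0 < g → g < ε → ∀ Ω₀ : Fin m → Fin n → ℝ,
      GoodOff m n p q Ω₀ → ∀ δ > 0, ∃ Ω : Fin m → Fin n → ℝ,
        (∀ j i, i ≠ p → i ≠ q → Ω j i = Ω₀ j i) ∧ dist Ω₀ Ω ≤ δ ∧
          0 < ThetaGen m n N1 N2 Ω ∧ ThetaGen m n N1 N2 Ω ≤ g ∧
          ThetaTildeGen m n N1 N2 Ω ≤ 0 := by
  obtain ⟨ε, hε, hP4⟩ := exists_scaledPsi_ge hm h1 h2 hpq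
  refine ⟨ε, hε, fun g hg hgε Ω₀ hgood δ hδ => ?_⟩
  set S : Set (Fin m → Fin n → ℝ) := {Ω | ∀ j i, i ≠ p → i ≠ q → Ω j i = Ω₀ j i} with hS
  have hSc : IsClosed S := by
    have : S = ⋂ j, ⋂ i, ⋂ (_ : i ≠ p), ⋂ (_ : i ≠ q), {Ω | Ω j i = Ω₀ j i} := by
      ext Ω
      simp [hS]
    rw [this]
    refine isClosed_iInter fun j => isClosed_iInter fun i => isClosed_iInter fun _ =>
      isClosed_iInter fun _ => isClosed_eq (by fun_prop) continuous_const
  let R : (Fin m → Fin n → ℝ) → ℝ → Prop := fun Ω T =>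
    Ω ∈ S ∧ (RationalColumn N1 Ω p T ∨ RationalColumn N1 Ω q T)
  obtain ⟨w, hw, T₀, hT₀⟩ := exists_rationalColumn h1 Ω₀ p (half_pos hδ)
  set Ω₁ : Fin m → Fin n → ℝ := fun j => Function.update (Ω₀ j) p (w j) with hΩ₁
  have hR₁ : R Ω₁ T₀ := ⟨fun j i hip _ => Function.update_of_ne hip _ _, Or.inl hT₀⟩
  have hstep : ∀ Ω T, R Ω T → ∀ δ > 0, ∃ Ω' T', R Ω' T' ∧ dist Ω Ω' < δ ∧ T ≤ T' ∧
      (∃ t, T ≤ t ∧ t ≤ T' ∧ g / 2 ≤ scaledPsi m n N1 N2 Ω' t) ∧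
      ∀ t ≥ T, scaledPsi m n N1 N2 Ω' t ≤ g := by
    rintro Ω T ⟨hΩS, hΩ⟩ δ hδ
    obtain ⟨Ω', hoff, hd, t₁, ht₁, hge⟩ := hP4 Ω (hgood.congr hΩS) (δ / 4) (by linarith) T
    rcases hΩ with hΩ | hΩ
    · obtain ⟨A, T', hA, hr, hdA, hTT, hex, hall⟩ := exists_step h1 h2 hpq hΩ hoff hd
        (by linarith) ht₁ hg (hgε.trans_le hge)
      exact ⟨A, T', ⟨fun j i hip hiq => (hA j i hip hiq).trans (hΩS j i hip hiq), Or.inr hr⟩,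
        by linarith, hTT, hex, hall⟩
    · obtain ⟨A, T', hA, hr, hdA, hTT, hex, hall⟩ := exists_step h1 h2 hpq.symm hΩ
        (fun j i hiq hip => hoff j i hip hiq) hd (by linarith) ht₁ hg (hgε.trans_le hge)
      exact ⟨A, T', ⟨fun j i hip hiq => (hA j i hiq hip).trans (hΩS j i hip hiq), Or.inl hr⟩,
        by linarith, hTT, hex, hall⟩
  obtain ⟨Ω, hΩS, hdΩ, hΩ⟩ := exists_oscillating (scaledPsi m n N1 N2)
    (scaledPsi_lipschitz h1 h2) R
    (fun Ω T h t ht => h.2.elim (fun h => h.scaledPsi_eq_zero h1 h2 ht)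
      (fun h => h.scaledPsi_eq_zero h1 h2 ht))
    (fun Ω T T' h hT => ⟨h.1, h.2.imp (fun h => h.mono hT) (fun h => h.mono hT)⟩)
    hSc (fun Ω T h => h.1) hstep hR₁ (half_pos hδ)
  have hbelow : ∀ᶠ t : ℝ in atTop, 0 ≤ scaledPsi m n N1 N2 Ω t := by
    filter_upwards [eventually_ge_atTop 0] with t ht using scaledPsi_nonneg h2 Ω ht
  have habove : IsBoundedUnder (· ≤ ·) atTop (scaledPsi m n N1 N2 Ω) :=
    ⟨g + 1, eventually_map.2 (hΩ 1 one_pos).1⟩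
  have hbelow' : IsBoundedUnder (· ≥ ·) atTop (scaledPsi m n N1 N2 Ω) :=
    ⟨0, eventually_map.2 hbelow⟩
  refine ⟨Ω, hΩS, ?_, ?_, ?_, ?_⟩
  · have := dist_update_le (half_pos hδ).le hw
    exact (dist_triangle _ Ω₁ _).trans (by linarith)
  · have h3 : g / 4 ≤ ThetaGen m n N1 N2 Ω :=
      le_limsup_of_frequently_le ((hΩ (g / 4) (by linarith)).2.1.mono fun t ht => by
        change g / 4 ≤ scaledPsi m n N1 N2 Ω t
        linarith) habove
    linarith
  · refine le_of_forall_pos_le_add fun η hη => ?_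
    exact limsup_le_of_le hbelow'.isCoboundedUnder_le (hΩ η hη).1
  · refine le_of_forall_pos_le_add fun η hη => ?_
    rw [zero_add]
    exact liminf_le_of_frequently_le (hΩ η hη).2.2 hbelow'

end Construction


/-- Entries off the columns `p` and `q` that make every matrix containing them `GoodOff`. -/
def goodEntries (m n : ℕ) (p q : Fin n) : Set (Fin m × {i : Fin n // i ≠ p ∧ i ≠ q} → ℝ) :=
  {A | ∀ Ω : Fin m → Fin n → ℝ, (∀ j i, Ω j i.1 = A (j, i)) → GoodOff m n p q Ω}

theorem card_ne_and_ne {n : ℕ} {p q : Fin n} (hpq : p ≠ q) :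
    Fintype.card {i : Fin n // i ≠ p ∧ i ≠ q} = n - 2 := by
  have : (Finset.univ.filter fun i : Fin n => i ≠ p ∧ i ≠ q) = ({p, q} : Finset (Fin n))ᶜ := by
    ext i
    simp
  rw [Fintype.card_subtype, this, Finset.card_compl, Finset.card_pair hpq, Fintype.card_fin]

theorem volume_cube_diff_goodEntries {m n : ℕ} (hm : 0 < m) {p q : Fin n} (hpq : p ≠ q)
    (u : Fin m × {i : Fin n // i ≠ p ∧ i ≠ q} → ℝ) {δ : ℝ} (hδ : 0 ≤ δ) (hδ1 : δ ≤ 1) :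
    volume (Set.Icc u (fun x => u x + δ) \ goodEntries m n p q) = 0 := by
  have hn : Fintype.card {i : Fin n // i ≠ p ∧ i ≠ q} + 2 ≤ n := by
    have h : ({p, q} : Finset (Fin n)).card ≤ Fintype.card (Fin n) := Finset.card_le_univ _
    rw [Finset.card_pair hpq, Fintype.card_fin] at h
    rw [card_ne_and_ne hpq]
    omega
  refine measure_mono_null ?_ (volume_frequently_near_int hm hn u hδ hδ1)
  rintro A ⟨⟨hA1, hA2⟩, hA⟩
  by_contra hfreq
  refine hA fun Ω hΩ => ?_
  rw [Set.mem_ofPred_eq, not_frequently] at hfreq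
  filter_upwards [hfreq] with T hT b hb hbp hbq hbT κ
  by_contra! hcon
  refine hT ⟨fun x => ⟨hA1 x, hA2 x⟩, fun i => b i.1, fun hb0 => hb ?_, fun i => hbT i.1,
    fun j => ⟨κ j, ?_⟩⟩
  · ext i
    by_cases hip : i = p
    · rw [hip, hbp]; rfl
    by_cases hiq : i = q
    · rw [hiq, hbq]; rfl
    exact congrFun hb0 ⟨i, hip, hiq⟩
  · have hsum : ∑ i : {i : Fin n // i ≠ p ∧ i ≠ q}, A (j, i) * (b i.1 : ℝ)
        = ∑ i, Ω j i * (b i : ℝ) := by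
      simp only [← hΩ]
      rw [← Finset.sum_subtype (Finset.univ.filter fun i => i ≠ p ∧ i ≠ q) (by simp)
        (fun i => Ω j i * (b i : ℝ))]
      refine Finset.sum_filter_of_ne fun i _ hi => ⟨?_, ?_⟩ <;> rintro rfl
      · simp [hbp] at hi
      · simp [hbq] at hi
    rw [hsum]
    exact hcon j

theorem volume_goodEntries_inter_cube_ne_zero {m n : ℕ} (hm : 0 < m) {p q : Fin n} (hpq : p ≠ q)
    (u : Fin m × {i : Fin n // i ≠ p ∧ i ≠ q} → ℝ) {δ : ℝ} (hδ : 0 < δ) (hδ1 : δ ≤ 1) :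
    volume (goodEntries m n p q ∩ Set.Icc u (fun x => u x + δ)) ≠ 0 := by
  intro h
  have h1 := measure_union_null h (volume_cube_diff_goodEntries hm hpq u hδ.le hδ1)
  rw [Set.inter_comm, Set.inter_union_sdiff, Real.volume_Icc_pi, Finset.prod_eq_zero_iff] at h1
  obtain ⟨x, -, hx⟩ := h1
  simp at hx
  linarith

theorem exists_goodOff_near {m n : ℕ} (hm : 0 < m) {p q : Fin n} (hpq : p ≠ q)
    (Ω₀ : Fin m → Fin n → ℝ) {δ : ℝ} (hδ : 0 < δ) :
    ∃ Ω, GoodOff m n p q Ω ∧ dist Ω₀ Ω ≤ δ := by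
  obtain ⟨A, hA, hA1, hA2⟩ := nonempty_of_measure_ne_zero
    (volume_goodEntries_inter_cube_ne_zero hm hpq (fun x => Ω₀ x.1 x.2.1)
      (lt_min hδ one_pos) (min_le_right δ 1))
  refine ⟨fun j i => if h : i ≠ p ∧ i ≠ q then A (j, ⟨i, h⟩) else Ω₀ j i,
    hA _ fun j i => by simp [i.2], ?_⟩
  refine (dist_pi_le_iff hδ.le).2 fun j => (dist_pi_le_iff hδ.le).2 fun i => ?_
  by_cases h : i ≠ p ∧ i ≠ q
  · have h1 := hA1 (j, ⟨i, h⟩)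
    have h2 := hA2 (j, ⟨i, h⟩)
    have h3 := min_le_left δ 1
    simp only [dif_pos h, Real.dist_eq, abs_le] at h1 h2 ⊢
    constructor <;> linarith
  · simp only [dif_neg h, dist_self, hδ.le]

theorem le_dimH_of_goodOff {m n : ℕ} (hm : 0 < m) {p q : Fin n} (hpq : p ≠ q)
    {X : Set (Fin m → Fin n → ℝ)} (hX : ∀ Ω₀, GoodOff m n p q Ω₀ →
      ∃ Ω ∈ X, ∀ j i, i ≠ p → i ≠ q → Ω j i = Ω₀ j i) :
    ((m * (n - 2) : ℕ) : ℝ≥0∞) ≤ dimH X := by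
  set π : (Fin m → Fin n → ℝ) → Fin m × {i : Fin n // i ≠ p ∧ i ≠ q} → ℝ :=
    fun Ω x => Ω x.1 x.2.1 with hπ
  have hlip : LipschitzWith 1 π := by
    refine LipschitzWith.of_dist_le_mul fun Ω Ω' => ?_
    rw [NNReal.coe_one, one_mul]
    refine (dist_pi_le_iff dist_nonneg).2 fun x => ?_
    exact (dist_le_pi_dist (Ω x.1) (Ω' x.1) x.2.1).trans (dist_le_pi_dist Ω Ω' x.1)
  have hsub : goodEntries m n p q ⊆ π '' X := by
    intro A hA
    obtain ⟨Ω, hΩ, hΩA⟩ := hX (fun j i => if h : i ≠ p ∧ i ≠ q then A (j, ⟨i, h⟩) else 0)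
      (hA _ fun j i => by simp [i.2])
    refine ⟨Ω, hΩ, funext fun x => ?_⟩
    rw [hπ]
    simp only
    rw [hΩA x.1 x.2.1 x.2.2.1 x.2.2.2, dif_pos x.2.2]
  refine le_trans ?_ ((dimH_mono hsub).trans (hlip.dimH_image_le X))
  have hcard : Fintype.card (Fin m × {i : Fin n // i ≠ p ∧ i ≠ q}) = m * (n - 2) := by
    rw [Fintype.card_prod, card_ne_and_ne hpq, Fintype.card_fin]
  have hvol : volume (goodEntries m n p q) ≠ 0 := fun h =>
    volume_goodEntries_inter_cube_ne_zero hm hpq 0 one_pos le_rfl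
      (measure_mono_null Set.inter_subset_left h)
  rw [← hausdorffMeasure_pi_real, hcard] at hvol
  exact_mod_cast le_dimH_of_hausdorffMeasure_ne_zero (d := ((m * (n - 2) : ℕ) : NNReal))
    (by exact_mod_cast hvol)

/-- Matrices near the rectangular identity matrix have full rank. -/
theorem exists_full_rank_near (m n : ℕ) : ∃ Ω₀ : Fin m → Fin n → ℝ, ∃ δ > 0,
    ∀ Ω, dist Ω₀ Ω ≤ δ → (Matrix.of Ω).rank = min m n := by
  set Ω₀ : Fin m → Fin n → ℝ := fun j i => if j.1 = i.1 then 1 else 0 with hΩ₀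
  set F : (Fin m → Fin n → ℝ) → ℝ := fun Ω => ((Matrix.of Ω).submatrix
    (Fin.castLE (min_le_left m n)) (Fin.castLE (min_le_right m n))).det with hF
  have hcont : Continuous F := by
    refine Continuous.matrix_det ?_
    refine continuous_pi fun i => continuous_pi fun j => ?_
    exact (continuous_apply_apply (Fin.castLE (min_le_left m n) i)
      (Fin.castLE (min_le_right m n) j) : Continuous fun Ω : Fin m → Fin n → ℝ => _)
  have h0 : F Ω₀ ≠ 0 := by
    have : (Matrix.of Ω₀).submatrix (Fin.castLE (min_le_left m n))
        (Fin.castLE (min_le_right m n)) = 1 := by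
      ext i j
      simp [hΩ₀, Matrix.one_apply, Fin.ext_iff]
    rw [hF]
    simp only [this, Matrix.det_one]
    exact one_ne_zero
  obtain ⟨δ, hδ, hball⟩ := Metric.eventually_nhds_iff.1 (hcont.continuousAt.eventually_ne h0)
  refine ⟨Ω₀, δ / 2, by positivity, fun Ω hΩ => le_antisymm
    (le_min (Matrix.rank_le_height _) (Matrix.rank_le_width _)) ?_⟩
  have h1 : F Ω ≠ 0 := hball (by rw [dist_comm]; linarith)
  have h2 := Matrix.rank_of_det_ne_zero h1
  rw [Fintype.card_fin] at h2
  exact h2.symm.trans_le (Matrix.rank_submatrix_le _ _ _)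

section Dirichlet

variable {m n : ℕ} {N1 : (Fin n → ℝ) → ℝ} {N2 : (Fin m → ℝ) → ℝ}

theorem exists_near_int_of_pow_lt (Ω : Fin m → Fin n → ℝ) {T M : ℕ} (hM : 0 < M)
    (h : M ^ m < (T + 1) ^ n) : ∃ b : Fin n → ℤ, b ≠ 0 ∧ (∀ i, |b i| ≤ T) ∧
      ∃ κ : Fin m → ℤ, ∀ j, |∑ i, Ω j i * b i + κ j| ≤ 1 / M := by
  have hM' : (0 : ℝ) < M := by exact_mod_cast hM
  set y : (Fin n → Fin (T + 1)) → Fin m → ℝ := fun b j => ∑ i, Ω j i * ((b i : ℕ) : ℝ) with hy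
  have hlt : ∀ x : ℝ, ⌊Int.fract x * M⌋₊ < M := fun x => by
    rw [Nat.floor_lt (by have := Int.fract_nonneg x; positivity)]
    have := Int.fract_lt_one x
    nlinarith
  obtain ⟨b, b', hne, heq⟩ := Fintype.exists_ne_map_eq_of_card_lt
    (fun b : Fin n → Fin (T + 1) => fun j : Fin m => (⟨_, hlt (y b j)⟩ : Fin M)) (by simpa using h)
  refine ⟨fun i => (b i : ℤ) - (b' i : ℤ), fun h0 => hne ?_, fun i => ?_,
    fun j => ⌊y b' j⌋ - ⌊y b j⌋, fun j => ?_⟩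
  · ext i
    have := congrFun h0 i
    simp only [Pi.zero_apply] at this
    omega
  · have h1 := (b i).2
    have h2 := (b' i).2
    simp only [abs_le]
    constructor <;> omega
  · have h1 := congrArg Fin.val (congrFun heq j)
    simp only at h1
    have hnn : ∀ x : ℝ, 0 ≤ Int.fract x * M := fun x => by
      have := Int.fract_nonneg x
      positivity
    have e1 := Nat.floor_le (hnn (y b j))
    have e2 := Nat.lt_floor_add_one (Int.fract (y b j) * M)
    have e3 := Nat.floor_le (hnn (y b' j))
    have e4 := Nat.lt_floor_add_one (Int.fract (y b' j) * M)
    rw [h1] at e1 e2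
    have hs : ∑ i, Ω j i * (((b i : ℤ) - (b' i : ℤ) : ℤ) : ℝ) + ((⌊y b' j⌋ - ⌊y b j⌋ : ℤ) : ℝ)
        = Int.fract (y b j) - Int.fract (y b' j) := by
      rw [Int.fract, Int.fract, hy]
      push_cast
      simp only [mul_sub, Finset.sum_sub_distrib]
      ring
    rw [hs, abs_le, neg_div', div_le_iff₀ hM', le_div_iff₀ hM', sub_mul]
    constructor <;> linarith

/-- Dirichlet's theorem for arbitrary norms. -/
theorem exists_scaledPsi_le (hm : 0 < m) (hn : 0 < n) (h1 : IsNorm N1) (h2 : IsNorm N2) :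
    ∃ C : ℝ, ∀ Ω : Fin m → Fin n → ℝ, ∀ᶠ t in atTop, scaledPsi m n N1 N2 Ω t ≤ C := by
  obtain ⟨c₁, hc₁, hlow⟩ := h1.exists_lower
  obtain ⟨C₁, hC₁, hup⟩ := h1.exists_upper
  obtain ⟨C₂, hC₂, hup2⟩ := h2.exists_upper
  obtain ⟨N, hN⟩ := exists_nat_ge (1 / c₁)
  rw [div_le_iff₀ hc₁] at hN
  have hN0 : 0 < (N : ℝ) := by
    by_contra! hc
    nlinarith
  set s : ℝ := (n : ℝ) / m with hs
  have hs0 : 0 ≤ s := by positivity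
  refine ⟨(2 * (N * C₁)) ^ s * 2 * (N * C₂), fun Ω => ?_⟩
  filter_upwards [eventually_ge_atTop (N * C₁)] with t ht
  have hNC : 0 < N * C₁ := by positivity
  have ht0 : 0 < t := hNC.trans_le ht
  set T := ⌊t / (N * C₁)⌋₊ with hT
  have hT1 : 1 ≤ T := Nat.le_floor (by rw [Nat.cast_one, le_div_iff₀ hNC, one_mul]; exact ht)
  have hT1' : (1 : ℝ) ≤ T := by exact_mod_cast hT1
  have hTt : T * (N * C₁) ≤ t := by
    rw [← le_div_iff₀ hNC]
    exact Nat.floor_le (by positivity)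
  have htT : t ≤ 2 * (N * C₁) * T := by
    have := (Nat.lt_floor_add_one (t / (N * C₁))).le
    rw [div_le_iff₀ hNC] at this
    nlinarith
  set M := ⌊(T : ℝ) ^ s⌋₊ with hM
  have hM1 : 1 ≤ M := Nat.le_floor (by rw [Nat.cast_one]; exact Real.one_le_rpow hT1' hs0)
  have hM1' : (1 : ℝ) ≤ M := by exact_mod_cast hM1
  have hMT : (M : ℝ) ≤ (T : ℝ) ^ s := Nat.floor_le (by positivity)
  have hTM : (T : ℝ) ^ s ≤ 2 * M := by
    have := (Nat.lt_floor_add_one ((T : ℝ) ^ s)).le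
    linarith
  have hpow : M ^ m < (T + 1) ^ n := by
    have e1 : (M : ℝ) ^ m ≤ (T : ℝ) ^ n := by
      refine (pow_le_pow_left₀ (by positivity) hMT m).trans_eq ?_
      rw [← Real.rpow_natCast, ← Real.rpow_mul (by positivity), hs, div_mul_cancel₀ _ (by positivity),
        Real.rpow_natCast]
    have e2 : M ^ m ≤ T ^ n := by exact_mod_cast e1
    exact e2.trans_lt (Nat.pow_lt_pow_left (Nat.lt_succ_self T) hn.ne')
  obtain ⟨b, hb, hbT, κ, hκ⟩ := exists_near_int_of_pow_lt Ω hM1 hpow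
  have hscale : (fun i => (((N : ℤ) * b i : ℤ) : ℝ)) = (N : ℝ) • fun i => (b i : ℝ) := by
    ext i
    simp
  have hN1 : N1 (fun i => (((N : ℤ) * b i : ℤ) : ℝ)) = N * N1 (fun i => (b i : ℝ)) := by
    rw [hscale, h1.2.1, abs_of_pos hN0]
  have hbn1 : 1 ≤ ‖fun i => (b i : ℝ)‖ := by
    obtain ⟨i, hi⟩ := Function.ne_iff.1 hb
    refine le_trans ?_ (norm_le_pi_norm (fun i => (b i : ℝ)) i)
    rw [Real.norm_eq_abs]
    exact_mod_cast Int.one_le_abs hi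
  have hbn2 : ‖fun i => (b i : ℝ)‖ ≤ T := by
    refine (pi_norm_le_iff_of_nonneg (by positivity)).2 fun i => ?_
    rw [Real.norm_eq_abs]
    exact_mod_cast hbT i
  have hle := psiGen_le (N1 := N1) h2 Ω (t := t) (fun i => N * b i) (fun j => N * κ j)
    (by
      rw [hN1]
      have := hlow (fun i => (b i : ℝ))
      nlinarith)
    (by
      rw [hN1]
      refine le_trans ?_ hTt
      calc N * N1 (fun i => (b i : ℝ)) ≤ N * (C₁ * T) := by
            gcongr
            exact (hup _).trans (by gcongr)
        _ = T * (N * C₁) := by ring)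
  have herr : psiGen m n N1 N2 Ω t ≤ C₂ * (N * (1 / M)) := by
    refine hle.trans ((hup2 _).trans ?_)
    gcongr
    refine (pi_norm_le_iff_of_nonneg (by positivity)).2 fun j => ?_
    have : ∑ i, Ω j i * (((N : ℤ) * b i : ℤ) : ℝ) + (((N : ℤ) * κ j : ℤ) : ℝ)
        = N * (∑ i, Ω j i * b i + κ j) := by
      push_cast
      rw [mul_add, Finset.mul_sum]
      congr 1
      exact Finset.sum_congr rfl fun i _ => by ring
    rw [this, Real.norm_eq_abs, abs_mul, abs_of_pos hN0]
    exact mul_le_mul_of_nonneg_left (hκ j) hN0.le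
  calc scaledPsi m n N1 N2 Ω t ≤ (2 * (N * C₁) * T) ^ s * (C₂ * (N * (1 / M))) := by
        refine mul_le_mul (Real.rpow_le_rpow ht0.le htT hs0) herr (psiGen_nonneg h2 Ω t)
          (by positivity)
    _ = (2 * (N * C₁)) ^ s * (T : ℝ) ^ s * (C₂ * (N * (1 / M))) := by
        rw [Real.mul_rpow (by positivity) (by positivity)]
    _ ≤ (2 * (N * C₁)) ^ s * (2 * M) * (C₂ * (N * (1 / M))) := by gcongr
    _ = (2 * (N * C₁)) ^ s * 2 * (N * C₂) := by field_simp

theorem bddAbove_range_thetaGen (hm : 0 < m) (hn : 0 < n) (h1 : IsNorm N1) (h2 : IsNorm N2) :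
    BddAbove (Set.range fun Ω : Fin m → Fin n → ℝ => ThetaGen m n N1 N2 Ω) := by
  obtain ⟨C, hC⟩ := exists_scaledPsi_le hm hn h1 h2
  refine ⟨C, ?_⟩
  rintro _ ⟨Ω, rfl⟩
  refine limsup_le_of_le ?_ (hC Ω)
  exact (isBoundedUnder_of_eventually_ge ((eventually_ge_atTop (0 : ℝ)).mono fun t ht =>
    scaledPsi_nonneg h2 Ω ht)).isCoboundedUnder_le

end Dirichlet

/-- for `m/n ∈ [1/2,2]`, `max{m,n} ≥ 4`, and `|m−n| ≠ 2` unless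
`{m,n} = {2,4}`: `FS_{m,n} ≠ ∅`, `dim_H FS_{m,n} ≥ mn − 2·max{m,n}` and matrices can
be chosen of full rank `min{m,n}`; moreover if `m ≠ n`, then for arbitrary norms the
set `FS_{m,n}(‖·‖₁,‖·‖₂)` is non-empty and the Dirichlet spectrum accumulates at `0`,
in particular it is not finite. -/
theorem FSmax_closeRatio (m n : ℕ) (hm : 0 < m) (hn : 0 < n)
    (hr1 : n ≤ 2 * m) (hr2 : m ≤ 2 * n) (hmax : 4 ≤ max m n)
    (hdiff : (m = n + 2 ∨ n = m + 2) → ((m = 2 ∧ n = 4) ∨ (m = 4 ∧ n = 2))) :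
    ((FSmax m n).Nonempty ∧
      ((m * n - 2 * max m n : ℕ) : ℝ≥0∞) ≤ dimH (FSmax m n) ∧
      ∃ Ω ∈ FSmax m n, (Matrix.of Ω).rank = min m n) ∧
    (m ≠ n →
      ∀ (N1 : (Fin n → ℝ) → ℝ) (N2 : (Fin m → ℝ) → ℝ),
        IsNorm N1 → IsNorm N2 →
        (FSset m n N1 N2).Nonempty ∧
        (∀ ε : ℝ, 0 < ε → ∃ Ω : Fin m → Fin n → ℝ,
          0 < ThetaGen m n N1 N2 Ω ∧ ThetaGen m n N1 N2 Ω < ε) ∧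
        {y : ℝ | ∃ Ω : Fin m → Fin n → ℝ, ThetaGen m n N1 N2 Ω = y}.Infinite) := by
  have hn2 : 2 ≤ n := by
    rcases le_max_iff.1 hmax with h | h <;> omega
  set p : Fin n := ⟨0, by omega⟩ with hp
  set q : Fin n := ⟨1, by omega⟩ with hq
  have hpq : p ≠ q := by simp [hp, hq]
  have hFS : ∀ Ω₀, GoodOff m n p q Ω₀ → ∀ δ > 0, ∃ Ω ∈ FSmax m n,
      (∀ j i, i ≠ p → i ≠ q → Ω j i = Ω₀ j i) ∧ dist Ω₀ Ω ≤ δ := by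
    obtain ⟨ε, hε, h⟩ := exists_thetaGen hm (isNorm_supNorm n) (isNorm_supNorm m) hpq
    intro Ω₀ hΩ₀ δ hδ
    have hmin : 0 < min ε 1 := lt_min hε one_pos
    obtain ⟨Ω, hoff, hdist, hpos, hle, htilde⟩ := h (min ε 1 / 2) (half_pos hmin)
      ((half_lt_self hmin).trans_le (min_le_left _ _)) Ω₀ hΩ₀ δ hδ
    refine ⟨Ω, ⟨hle.trans_lt ((half_lt_self hmin).trans_le (min_le_right _ _)), ?_⟩, hoff, hdist⟩
    rintro (h' | h')
    · exact absurd h' (not_lt.2 htilde)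
    · exact hpos.ne' h'
  obtain ⟨Ω₁, δ, hδ, hrank⟩ := exists_full_rank_near m n
  obtain ⟨Ω₂, hΩ₂, hd₂⟩ := exists_goodOff_near hm hpq Ω₁ (half_pos hδ)
  refine ⟨?_, fun _ N1 N2 h1 h2 => ?_⟩
  · obtain ⟨Ω, hΩ, -, hd⟩ := hFS Ω₂ hΩ₂ (δ / 2) (half_pos hδ)
    refine ⟨⟨Ω, hΩ⟩, le_trans ?_ (le_dimH_of_goodOff hm hpq (X := FSmax m n) fun Ω₀ hΩ₀ => ?_),
      Ω, hΩ, hrank Ω ?_⟩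
    · have h : m * n - 2 * max m n ≤ m * (n - 2) := by
        rw [Nat.mul_sub, mul_comm m 2]
        have := le_max_left m n
        omega
      exact_mod_cast h
    · obtain ⟨Ω', hΩ', hoff, -⟩ := hFS Ω₀ hΩ₀ 1 one_pos
      exact ⟨Ω', hΩ', hoff⟩
    · linarith [dist_triangle Ω₁ Ω₂ Ω]
  · obtain ⟨ε, hε, h⟩ := exists_thetaGen hm h1 h2 hpq
    have hsmall : ∀ η : ℝ, 0 < η → ∃ Ω : Fin m → Fin n → ℝ, 0 < ThetaGen m n N1 N2 Ω ∧
        ThetaGen m n N1 N2 Ω < η ∧ ThetaTildeGen m n N1 N2 Ω ≤ 0 := by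
      intro η hη
      have hmin : 0 < min ε η := lt_min hε hη
      obtain ⟨Ω, -, -, hpos, hle, htilde⟩ := h (min ε η / 2) (half_pos hmin)
        ((half_lt_self hmin).trans_le (min_le_left _ _)) Ω₂ hΩ₂ 1 one_pos
      exact ⟨Ω, hpos, hle.trans_lt ((half_lt_self hmin).trans_le (min_le_right _ _)), htilde⟩
    refine ⟨?_, fun η hη => ?_, fun hfin => ?_⟩
    · obtain ⟨Ω₃, hpos₃, -, -⟩ := hsmall 1 one_pos
      have hD : 0 < DirichletSup m n N1 N2 :=
        hpos₃.trans_le (le_ciSup (bddAbove_range_thetaGen hm hn h1 h2) Ω₃)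
      obtain ⟨Ω, hpos, hlt, htilde⟩ := hsmall _ hD
      refine ⟨Ω, hlt, ?_⟩
      rintro (h' | h')
      · exact absurd h' (not_lt.2 htilde)
      · exact hpos.ne' h'
    · obtain ⟨Ω, hpos, hlt, -⟩ := hsmall η hη
      exact ⟨Ω, hpos, hlt⟩
    · have hfin' := hfin.subset (Set.inter_subset_left (t := Set.Ioi (0 : ℝ)))
      obtain ⟨Ω₃, hpos₃, -, -⟩ := hsmall 1 one_pos
      obtain ⟨y, ⟨-, hy⟩, hmin⟩ := hfin'.exists_minimal ⟨_, ⟨Ω₃, rfl⟩, hpos₃⟩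
      obtain ⟨Ω, hpos, hlt, -⟩ := hsmall y hy
      exact absurd (hmin ⟨⟨Ω, rfl⟩, hpos⟩ hlt.le) (not_le.2 hlt)
end

section
/- Let n ≥ 4 be an integer, c ∈ (0, c_n) with c_n = ((n−3)/(8(n−2)^{3/2}))·√π·Γ(n−1/2)/Γ(n), and let ξ = (ξ₁,ξ₂) ∈ ℝ² be as constructed in Theorem 5.1 for this c (with ξ₁, ξ₂ sufficiently small positive). Let (b_v)_{v≥1} ⊂ ℤ³ be the sequence of best approximations of ξ, with heights M_v = max(|b_{1,v}|,|b_{2,v}|) and approximation values L_v = |b_{1,v}ξ₁ + b_{2,v}ξ₂ + b_{3,v}|. Then there is a set 𝒴 of positive (n−2)-dimensional Lebesgue measure in the Euclidean unit ball B_{n−2}(0,1) ⊆ ℝ^{n−2}, consisting of γ = (ζ₃,…,ζ_n), such that for infinitely many integers v ≥ 1, setting T_v = M_{v+1} − 1/2, every nonzero integer vector (x₁,…,x_n,y) ∈ ℤ^{n+1} with 0 < max_{1≤j≤n}|x_j| ≤ T_v satisfies |x₁ξ₁ + x₂ξ₂ + Σ_{i=3}^n x_i ζ_i − y| ≥ L_v;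 in particular the best approximation for ζ = (ξ, γ) at T_v is (b_{1,v}, b_{2,v}, 0, …, 0, b_{3,v}) and ψ_ζ(T_v) = ψ_ξ(T_v) = L_v. -/
open Filter MeasureTheory

/-- `ψ_ξ(t)` for `ξ = (ξ₁,ξ₂) ∈ ℝ²`: the minimum of `|b₁ξ₁ + b₂ξ₂ + b₃|` over integer
vectors `(b₁,b₂,b₃) ∈ ℤ³` with `1 ≤ max(|b₁|,|b₂|) ≤ t`. -/
noncomputable def psiTwo (ξ1 ξ2 : ℝ) (t : ℝ) : ℝ :=
  sInf { r : ℝ | ∃ b1 b2 b3 : ℤ,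
    (b1 ≠ 0 ∨ b2 ≠ 0) ∧ |(b1 : ℝ)| ≤ t ∧ |(b2 : ℝ)| ≤ t ∧
    r = |(b1 : ℝ) * ξ1 + (b2 : ℝ) * ξ2 + (b3 : ℝ)| }

/-- `ψ_ζ(t)` for `ζ ∈ ℝⁿ`: the minimum of `|b₁ζ₁+⋯+b_nζ_n+b_{n+1}|` over integer
vectors with `1 ≤ max_i |b_i| ≤ t`. -/
noncomputable def psiDual (n : ℕ) (ζ : Fin n → ℝ) (t : ℝ) : ℝ :=
  sInf { r : ℝ | ∃ (b : Fin n → ℤ) (b' : ℤ),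
    (∃ i, b i ≠ 0) ∧ (∀ i, |(b i : ℝ)| ≤ t) ∧
    r = |(∑ i, (b i : ℝ) * ζ i) + (b' : ℝ)| }

/-- The vector `ζ = (ξ₁, ξ₂, γ₃, …, γ_n) ∈ ℝⁿ`. -/
def extendVec (n : ℕ) (ξ1 ξ2 : ℝ) (γ : Fin (n - 2) → ℝ) : Fin n → ℝ :=
  fun i =>
    if h0 : (i : ℕ) = 0 then ξ1
    else if h1 : (i : ℕ) = 1 then ξ2
    else γ ⟨(i : ℕ) - 2, by have := i.isLt; omega⟩

/-- The leading `k × k` minor of an infinite integer matrix. -/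
def leadMinor (A : ℕ → ℕ → ℤ) (k : ℕ) : ℤ :=
  (Matrix.of fun i j : Fin k => A i j).det

/-- The minor on the first `k` rows and the columns `0, …, k - 2, k`. -/
def skipMinor (A : ℕ → ℕ → ℤ) (k : ℕ) : ℤ :=
  (Matrix.of fun i j : Fin k => A i (if (j : ℕ) + 1 = k then k else j)).det

theorem leadMinor_congr {A A' : ℕ → ℕ → ℤ} {k : ℕ} (h : ∀ i < k, ∀ j < k, A' i j = A i j) :
    leadMinor A' k = leadMinor A k := by
  unfold leadMinor
  congr 1
  ext i j
  exact h i i.2 j j.2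

theorem skipMinor_congr {A A' : ℕ → ℕ → ℤ} {k : ℕ} (h : ∀ i < k, ∀ j ≤ k, A' i j = A i j) :
    skipMinor A' k = skipMinor A k := by
  unfold skipMinor
  congr 1
  ext i j
  refine h i i.2 _ ?_
  have := j.2
  split_ifs <;> omega

/-- The determinant is affine in each entry of the last row. -/
theorem det_eq_add_of_eq_off_last_row {k : ℕ} {B B' : Matrix (Fin (k + 1)) (Fin (k + 1)) ℤ}
    (j : Fin (k + 1)) (h : ∀ i l, (i ≠ Fin.last k ∨ l ≠ j) → B' i l = B i l) :
    B'.det = B.det + (B' (Fin.last k) j - B (Fin.last k) j) *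
      ((-1) ^ (k + (j : ℕ)) * (B.submatrix Fin.castSucc j.succAbove).det) := by
  have key : ∀ l : Fin (k + 1), B'.submatrix (Fin.last k).succAbove l.succAbove =
      B.submatrix Fin.castSucc l.succAbove := by
    intro l
    ext a b
    simp only [Matrix.submatrix_apply, Fin.succAbove_last]
    exact h _ _ (Or.inl (Fin.castSucc_lt_last a).ne)
  rw [Matrix.det_succ_row B' (Fin.last k), Matrix.det_succ_row B (Fin.last k)]
  rw [← sub_eq_iff_eq_add', ← Finset.sum_sub_distrib]
  rw [Finset.sum_eq_single j]
  · rw [key]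
    simp only [Fin.succAbove_last, Fin.val_last]
    ring
  · intro l _ hl
    rw [key, h _ _ (Or.inr hl)]
    simp only [Fin.succAbove_last, sub_self]
  · simp

theorem leadMinor_succ_eq_add {A A' : ℕ → ℕ → ℤ} {k : ℕ}
    (h : ∀ i j, (i ≠ k ∨ j ≠ k) → A' i j = A i j) :
    leadMinor A' (k + 1) = leadMinor A (k + 1) + (A' k k - A k k) * leadMinor A k := by
  unfold leadMinor
  rw [det_eq_add_of_eq_off_last_row (Fin.last k) (B := Matrix.of fun i j : Fin (k + 1) => A i j)]
  · simp only [Fin.val_last, Even.neg_pow (Even.add_self k), one_pow, one_mul, Matrix.of_apply]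
    congr 2
    congr 1
    ext i j
    simp
  · intro i l hil
    refine h _ _ ?_
    simpa [Fin.ext_iff] using hil

theorem skipMinor_succ_eq_add {A A' : ℕ → ℕ → ℤ} {k : ℕ}
    (h : ∀ i j, (i ≠ k ∨ j ≠ k + 1) → A' i j = A i j) :
    skipMinor A' (k + 1) =
      skipMinor A (k + 1) + (A' k (k + 1) - A k (k + 1)) * leadMinor A k := by
  unfold skipMinor leadMinor
  rw [det_eq_add_of_eq_off_last_row (Fin.last k)
    (B := Matrix.of fun i j : Fin (k + 1) => A i (if (j : ℕ) + 1 = k + 1 then k + 1 else j))]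
  · simp only [Fin.val_last, Even.neg_pow (Even.add_self k), one_pow, one_mul, Matrix.of_apply,
      if_true]
    congr 2
    congr 1
    ext i j
    have := j.2
    simp only [Matrix.submatrix_apply, Matrix.of_apply, Fin.succAbove_last, Fin.val_castSucc]
    rw [if_neg (by omega)]
  · intro i l hil
    refine h _ _ ?_
    have := l.2
    simp only [ne_eq, Fin.ext_iff, Fin.val_last] at hil ⊢
    split_ifs <;> omega

theorem leadMinor_succ_succ_eq_sub {A A' : ℕ → ℕ → ℤ} {k : ℕ}
    (h : ∀ i j, (i ≠ k + 1 ∨ j ≠ k) → A' i j = A i j) :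
    leadMinor A' (k + 2) =
      leadMinor A (k + 2) - (A' (k + 1) k - A (k + 1) k) * skipMinor A (k + 1) := by
  unfold skipMinor leadMinor
  rw [det_eq_add_of_eq_off_last_row (⟨k, by omega⟩ : Fin (k + 2))
    (B := Matrix.of fun i j : Fin (k + 2) => A i j)]
  · have hs : (-1 : ℤ) ^ (k + 1 + k) = -1 := Odd.neg_one_pow ⟨k, by omega⟩
    simp only [hs, Matrix.of_apply, Fin.val_last, neg_mul, one_mul, mul_neg, ← sub_eq_add_neg]
    congr 2
    congr 1
    ext i j
    have := j.2
    simp only [Matrix.submatrix_apply, Matrix.of_apply, Fin.val_castSucc, Fin.succAbove,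
      Fin.lt_def]
    congr 1
    split_ifs <;> simp <;> omega
  · intro i l hil
    refine h _ _ ?_
    simpa [Fin.ext_iff] using hil

theorem card_filter_range_dvd_le {ℓ : ℕ} (hℓ : ℓ.Prime) {a : ℤ} (ha : ¬ (ℓ : ℤ) ∣ a) (b : ℤ)
    (M : ℕ) : ((Finset.range M).filter fun s : ℕ => (ℓ : ℤ) ∣ b + s * a).card ≤ M / ℓ + 1 := by
  rcases ((Finset.range M).filter fun s : ℕ => (ℓ : ℤ) ∣ b + s * a).eq_empty_or_nonempty with h | ⟨r, hr⟩
  · simp [h]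
  · have hr' := (Finset.mem_filter.1 hr).2
    have hcount := Nat.count_modEq_card M hℓ.pos r
    rw [Nat.count_eq_card_filter_range] at hcount
    calc _ ≤ ((Finset.range M).filter fun s => s ≡ r [MOD ℓ]).card := by
          refine Finset.card_le_card fun s hs => ?_
          rw [Finset.mem_filter] at hs ⊢
          refine ⟨hs.1, ?_⟩
          have h1 : (ℓ : ℤ) ∣ ((r : ℤ) - s) * a := by
            have := dvd_sub hr' hs.2
            ring_nf at this ⊢
            exact this
          exact (Nat.modEq_iff_dvd).2
            (((Nat.prime_iff_prime_int.1 hℓ).dvd_or_dvd h1).resolve_right ha)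
      _ ≤ M / ℓ + 1 := by rw [hcount]; split_ifs <;> omega

/-- The integer points of a box with side lengths `M`. -/
abbrev boxPoints {ι : Type*} [Fintype ι] [DecidableEq ι] (M : ι → ℕ) : Finset (ι → ℕ) :=
  Fintype.piFinset fun p => Finset.range (M p)

section Counting

variable {ι : Type*} [Fintype ι] [DecidableEq ι]

theorem sum_boxPoints_update (M : ι → ℕ) (p : ι) (F : (ι → ℕ) → ℝ) :
    ∑ t ∈ boxPoints M, ∑ s ∈ Finset.range (M p), F (Function.update t p s) =
      M p * ∑ t ∈ boxPoints M, F t := by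
  rw [← Finset.sum_product' (boxPoints M) (Finset.range (M p))
    fun t s => F (Function.update t p s)]
  have : (M p : ℝ) * ∑ t ∈ boxPoints M, F t =
      ∑ x ∈ boxPoints M ×ˢ Finset.range (M p), F x.1 := by
    rw [Finset.sum_product]
    simp [Finset.mul_sum]
  rw [this]
  have hmem : ∀ x ∈ boxPoints M ×ˢ Finset.range (M p),
      (Function.update x.1 p x.2, x.1 p) ∈ boxPoints M ×ˢ Finset.range (M p) := by
    rintro ⟨t, s⟩ h
    simp only [Finset.mem_product, Fintype.mem_piFinset] at h ⊢
    refine ⟨fun q => ?_, h.1 p⟩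
    by_cases hq : q = p
    · subst hq; simpa using h.2
    · simpa [hq] using h.1 q
  refine Finset.sum_nbij' (fun x => (Function.update x.1 p x.2, x.1 p))
    (fun x => (Function.update x.1 p x.2, x.1 p)) hmem hmem ?_ ?_ ?_ <;> simp

open Classical in
/-- The number of points of a box satisfying `S`. -/
noncomputable def boxCount (M : ι → ℕ) (S : (ι → ℕ) → Prop) : ℝ :=
  ((boxPoints M).filter S).card

theorem boxCount_eq_sum (M : ι → ℕ) (S : (ι → ℕ) → Prop) [DecidablePred S] :
    boxCount M S = ∑ t ∈ boxPoints M, if S t then (1 : ℝ) else 0 := by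
  rw [boxCount, Finset.sum_boole]
  congr!

theorem boxCount_mono {M : ι → ℕ} {S S' : (ι → ℕ) → Prop}
    (h : ∀ t ∈ boxPoints M, S t → S' t) : boxCount M S ≤ boxCount M S' := by
  classical
  rw [boxCount_eq_sum, boxCount_eq_sum]
  refine Finset.sum_le_sum fun t ht => ?_
  have := h t ht
  split_ifs <;> simp_all

theorem boxCount_exists_le {κ : Type*} (M : ι → ℕ) (s : Finset κ) (S : κ → (ι → ℕ) → Prop) :
    boxCount M (fun t => ∃ k ∈ s, S k t) ≤ ∑ k ∈ s, boxCount M (S k) := by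
  classical
  simp only [boxCount_eq_sum]
  rw [Finset.sum_comm]
  refine Finset.sum_le_sum fun t _ => ?_
  split_ifs with h
  · obtain ⟨k, hk, hS⟩ := h
    calc (1 : ℝ) = if S k t then 1 else 0 := by rw [if_pos hS]
      _ ≤ _ := Finset.single_le_sum (f := fun k => if S k t then (1 : ℝ) else 0)
        (fun _ _ => by split_ifs <;> norm_num) hk
  · exact Finset.sum_nonneg fun _ _ => by split_ifs <;> norm_num

theorem boxCount_or_le (M : ι → ℕ) (S S' : (ι → ℕ) → Prop) :
    boxCount M (fun t => S t ∨ S' t) ≤ boxCount M S + boxCount M S' := by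
  classical
  simp only [boxCount_eq_sum]
  rw [← Finset.sum_add_distrib]
  refine Finset.sum_le_sum fun t _ => ?_
  split_ifs <;> simp_all

/-- If `G` is affine in the coordinate `p`, with slope prime to `ℓ` wherever `S` holds, then
divisibility of `G` by `ℓ` has conditional density at most `1 / ℓ + 1 / m` given `S`. -/
theorem boxCount_and_dvd_le (M : ι → ℕ) (p : ι) {m : ℕ} (hm : 0 < m) (hmM : m ≤ M p)
    {ℓ : ℕ} (hℓ : ℓ.Prime) (S : (ι → ℕ) → Prop) (G : (ι → ℕ) → ℤ)
    (hS : ∀ t s, S (Function.update t p s) ↔ S t)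
    (hG : ∀ t, S t → ∃ a b : ℤ, ¬ (ℓ : ℤ) ∣ a ∧ ∀ s : ℕ, G (Function.update t p s) = b + s * a) :
    boxCount M (fun t => S t ∧ (ℓ : ℤ) ∣ G t) ≤ (1 / ℓ + 1 / m) * boxCount M S := by
  classical
  have hMp : (0 : ℝ) < M p := by exact_mod_cast hm.trans_le hmM
  refine le_of_mul_le_mul_left ?_ hMp
  rw [boxCount_eq_sum, boxCount_eq_sum,
    ← sum_boxPoints_update M p fun t => if S t ∧ (ℓ : ℤ) ∣ G t then (1 : ℝ) else 0,
    ← mul_assoc, Finset.mul_sum]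
  refine Finset.sum_le_sum fun t _ => ?_
  by_cases h : S t
  · obtain ⟨a, b, ha, hab⟩ := hG t h
    simp only [hS, h, true_and, hab, if_true, mul_one]
    rw [Finset.sum_boole]
    calc (((Finset.range (M p)).filter fun s : ℕ => (ℓ : ℤ) ∣ b + s * a).card : ℝ)
        ≤ ((M p / ℓ + 1 : ℕ) : ℝ) := by exact_mod_cast card_filter_range_dvd_le hℓ ha b _
      _ ≤ (M p : ℝ) / ℓ + (M p : ℝ) / m := by
          push_cast
          refine add_le_add Nat.cast_div_le ?_
          rw [le_div_iff₀ (by exact_mod_cast hm), one_mul]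
          exact_mod_cast hmM
      _ = _ := by ring
  · simp [hS, h]

end Counting

/-- The integer matrix with `K` on the diagonal, perturbed by `P` times a box point. -/
def boxMatrix {d : ℕ} (K P : ℕ) (t : Fin d × Fin (d + 1) → ℕ) (i j : ℕ) : ℤ :=
  (if i = j then (K : ℤ) else 0) +
    P * (if h : i < d ∧ j < d + 1 then (t (⟨i, h.1⟩, ⟨j, h.2⟩) : ℤ) else 0)

section Sieve

variable {d : ℕ} {K P : ℕ}

theorem boxMatrix_update_of_ne (t : Fin d × Fin (d + 1) → ℕ) (p : Fin d × Fin (d + 1)) (s : ℕ)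
    {i j : ℕ} (h : i ≠ p.1 ∨ j ≠ p.2) :
    boxMatrix K P (Function.update t p s) i j = boxMatrix K P t i j := by
  unfold boxMatrix
  congr 2
  split_ifs with h'
  · rw [Function.update_of_ne]
    rintro rfl
    simp at h
  · rfl

theorem boxMatrix_update_self (t : Fin d × Fin (d + 1) → ℕ) (p : Fin d × Fin (d + 1)) (s : ℕ) :
    boxMatrix K P (Function.update t p s) p.1 p.2 =
      boxMatrix K P (Function.update t p 0) p.1 p.2 + s * P := by
  have h1 := p.1.2
  have h2 := p.2.2
  simp only [boxMatrix, dif_pos (And.intro h1 h2), Function.update_self]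
  push_cast
  ring

theorem leadMinor_update (t : Fin d × Fin (d + 1) → ℕ) (p : Fin d × Fin (d + 1)) (s : ℕ) {k : ℕ}
    (h : k ≤ p.1 ∨ k ≤ p.2) :
    leadMinor (boxMatrix K P (Function.update t p s)) k = leadMinor (boxMatrix K P t) k :=
  leadMinor_congr fun _ hi _ hj => boxMatrix_update_of_ne t p s (by omega)

theorem skipMinor_update (t : Fin d × Fin (d + 1) → ℕ) (p : Fin d × Fin (d + 1)) (s : ℕ) {k : ℕ}
    (h : k ≤ p.1) :
    skipMinor (boxMatrix K P (Function.update t p s)) k = skipMinor (boxMatrix K P t) k :=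
  skipMinor_congr fun _ hi _ hj => boxMatrix_update_of_ne t p s (by omega)

theorem leadMinor_update_diag (t : Fin d × Fin (d + 1) → ℕ) (p : Fin d × Fin (d + 1)) (s : ℕ)
    (h : (p.2 : ℕ) = p.1) :
    leadMinor (boxMatrix K P (Function.update t p s)) (p.1 + 1) =
      leadMinor (boxMatrix K P (Function.update t p 0)) (p.1 + 1) +
        s * (P * leadMinor (boxMatrix K P t) p.1) := by
  rw [leadMinor_succ_eq_add (A := boxMatrix K P (Function.update t p 0)), leadMinor_update t p 0 (k := p.1) (Or.inl le_rfl)]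
  · have := boxMatrix_update_self (K := K) (P := P) t p s
    rw [h] at this
    rw [this]
    ring
  · intro i j hij
    rw [boxMatrix_update_of_ne, boxMatrix_update_of_ne] <;> rwa [h]

theorem skipMinor_update_superdiag (t : Fin d × Fin (d + 1) → ℕ) (p : Fin d × Fin (d + 1))
    (s : ℕ) (h : (p.2 : ℕ) = p.1 + 1) :
    skipMinor (boxMatrix K P (Function.update t p s)) (p.1 + 1) =
      skipMinor (boxMatrix K P (Function.update t p 0)) (p.1 + 1) +
        s * (P * leadMinor (boxMatrix K P t) p.1) := by
  rw [skipMinor_succ_eq_add (A := boxMatrix K P (Function.update t p 0)), leadMinor_update t p 0 (k := p.1) (Or.inl le_rfl)]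
  · have := boxMatrix_update_self (K := K) (P := P) t p s
    rw [h] at this
    rw [this]
    ring
  · intro i j hij
    rw [boxMatrix_update_of_ne, boxMatrix_update_of_ne] <;> rwa [h]

theorem leadMinor_update_subdiag (t : Fin d × Fin (d + 1) → ℕ) (p : Fin d × Fin (d + 1))
    (s : ℕ) (h : (p.1 : ℕ) = p.2 + 1) :
    leadMinor (boxMatrix K P (Function.update t p s)) (p.1 + 1) =
      leadMinor (boxMatrix K P (Function.update t p 0)) (p.1 + 1) +
        s * (-(P * skipMinor (boxMatrix K P t) p.1)) := by
  have hself := boxMatrix_update_self (K := K) (P := P) t p s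
  rw [← skipMinor_update t p 0 le_rfl]
  rw [h] at hself ⊢
  rw [leadMinor_succ_succ_eq_sub (A := boxMatrix K P (Function.update t p 0))]
  · rw [hself]
    ring
  · intro i j hij
    rw [boxMatrix_update_of_ne, boxMatrix_update_of_ne] <;> rwa [h]

variable {M : Fin d × Fin (d + 1) → ℕ} {m : ℕ}

theorem boxCount_dvd_leadMinor_le (hm : 0 < m) (hmM : ∀ p, m ≤ M p) {ℓ : ℕ} (hℓ : ℓ.Prime)
    (hℓP : ¬ ℓ ∣ P) {k : ℕ} (hk : k ≤ d) :
    boxCount M (fun t => (ℓ : ℤ) ∣ leadMinor (boxMatrix K P t) k) ≤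
      k * (1 / ℓ + 1 / m) * boxCount M (fun _ => True) := by
  have hpr := Nat.prime_iff_prime_int.1 hℓ
  induction k with
  | zero =>
    have : ∀ t : Fin d × Fin (d + 1) → ℕ, ¬ (ℓ : ℤ) ∣ leadMinor (boxMatrix K P t) 0 := fun t => by
      simpa [leadMinor] using hpr.not_dvd_one
    simp [boxCount, this]
  | succ k ih =>
    have h1 : boxCount M (fun t => ¬ (ℓ : ℤ) ∣ leadMinor (boxMatrix K P t) k ∧
          (ℓ : ℤ) ∣ leadMinor (boxMatrix K P t) (k + 1)) ≤
        (1 / ℓ + 1 / m) * boxCount M (fun _ => True) := by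
      refine (boxCount_and_dvd_le M (⟨k, by omega⟩, ⟨k, by omega⟩) hm (hmM _) hℓ
        (fun t => ¬ (ℓ : ℤ) ∣ leadMinor (boxMatrix K P t) k)
        (fun t => leadMinor (boxMatrix K P t) (k + 1)) ?_ ?_).trans ?_
      · intro t s
        rw [leadMinor_update]
        exact Or.inl le_rfl
      · intro t ht
        refine ⟨_, _, ?_, fun s => leadMinor_update_diag t _ s rfl⟩
        intro h
        rcases hpr.dvd_or_dvd h with h | h
        · exact hℓP (by exact_mod_cast h)
        · exact ht h
      · refine mul_le_mul_of_nonneg_left (boxCount_mono fun _ _ _ => trivial) (by positivity)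
    have h2 := (boxCount_mono (M := M) (S := fun t => (ℓ : ℤ) ∣ leadMinor (boxMatrix K P t) (k + 1))
      (S' := fun t => (ℓ : ℤ) ∣ leadMinor (boxMatrix K P t) k ∨
        (¬ (ℓ : ℤ) ∣ leadMinor (boxMatrix K P t) k ∧
          (ℓ : ℤ) ∣ leadMinor (boxMatrix K P t) (k + 1))) (fun t _ h => by tauto)).trans
      (boxCount_or_le _ _ _)
    have := ih (by omega)
    push_cast
    linarith

theorem two_mul_log_ge_card_primes_dvd {D : ℤ} (hD : D ≠ 0) {B : ℕ} (hDB : D.natAbs ≤ B)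
    (s : Finset ℕ) (hs : ∀ ℓ ∈ s, ℓ.Prime) :
    ((s.filter fun ℓ : ℕ => (ℓ : ℤ) ∣ D).card : ℝ) ≤ 2 * Real.log B := by
  set u := s.filter fun ℓ : ℕ => (ℓ : ℤ) ∣ D
  have hu : u ⊆ D.natAbs.primeFactors := by
    intro ℓ hℓ
    rw [Finset.mem_filter] at hℓ
    exact Nat.mem_primeFactors.2 ⟨hs ℓ hℓ.1, Int.natCast_dvd.1 hℓ.2, by simpa using hD⟩
  have h1 : 2 ^ u.card ≤ B := calc
    2 ^ u.card ≤ 2 ^ D.natAbs.primeFactors.card :=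
      Nat.pow_le_pow_right (by norm_num) (Finset.card_le_card hu)
    _ ≤ ∏ p ∈ D.natAbs.primeFactors, p :=
      Finset.pow_card_le_prod _ (fun p => p) 2 fun p hp => (Nat.prime_of_mem_primeFactors hp).two_le
    _ ≤ D.natAbs := Nat.le_of_dvd (by simpa [Int.natAbs_pos] using hD) (Nat.prod_primeFactors_dvd _)
    _ ≤ B := hDB
  have h2 : (u.card : ℝ) * Real.log 2 ≤ Real.log B := by
    rw [← Real.log_pow]
    exact Real.log_le_log (by positivity) (by exact_mod_cast h1)
  have h3 := Real.log_two_gt_d9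
  nlinarith [(Nat.cast_nonneg u.card : (0 : ℝ) ≤ u.card)]

theorem sum_prime_weights_le {R B : ℕ} (hR : 0 < R) (m : ℕ) :
    ∑ ℓ ∈ (Finset.Ioc R B).filter Nat.Prime, (1 / (ℓ : ℝ)) * (1 / ℓ + 1 / m) ≤
      1 / R + (1 + Real.log B) / m := by
  have hsq : ∑ ℓ ∈ Finset.Ioc R B, ((ℓ : ℝ) ^ 2)⁻¹ ≤ 1 / R := by
    rcases le_or_gt R B with h | h
    · have := sum_Ioc_inv_sq_le_sub (α := ℝ) hR.ne' h
      have h0 : (0 : ℝ) ≤ (B : ℝ)⁻¹ := by positivity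
      rw [one_div]
      linarith
    · rw [Finset.Ioc_eq_empty (by omega)]
      simp
  have hlin : ∑ ℓ ∈ Finset.Ioc R B, ((ℓ : ℝ))⁻¹ ≤ 1 + Real.log B := by
    refine le_trans ?_ (harmonic_le_one_add_log B)
    rw [harmonic_eq_sum_Icc]
    push_cast
    refine Finset.sum_le_sum_of_subset_of_nonneg ?_ fun _ _ _ => by positivity
    intro x
    simp only [Finset.mem_Ioc, Finset.mem_Icc]
    omega
  calc ∑ ℓ ∈ (Finset.Ioc R B).filter Nat.Prime, (1 / (ℓ : ℝ)) * (1 / ℓ + 1 / m)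
      ≤ ∑ ℓ ∈ Finset.Ioc R B, (1 / (ℓ : ℝ)) * (1 / ℓ + 1 / m) :=
        Finset.sum_le_sum_of_subset_of_nonneg (Finset.filter_subset _ _)
          fun _ _ _ => by positivity
    _ = ∑ ℓ ∈ Finset.Ioc R B, ((ℓ : ℝ) ^ 2)⁻¹ + (∑ ℓ ∈ Finset.Ioc R B, ((ℓ : ℝ))⁻¹) / m := by
        rw [Finset.sum_div, ← Finset.sum_add_distrib]
        refine Finset.sum_congr rfl fun ℓ _ => ?_
        simp only [one_div]
        ring
    _ ≤ _ := by gcongr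

theorem sum_primes_boxCount_dvd_leadMinor_le (hm : 0 < m) (hmM : ∀ p, m ≤ M p) {R B : ℕ}
    (hR : 0 < R) (hRP : ∀ ℓ : ℕ, ℓ.Prime → R < ℓ → ¬ ℓ ∣ P) {k : ℕ} (hk : k ≤ d)
    (hne : ∀ t ∈ boxPoints M, leadMinor (boxMatrix K P t) k ≠ 0)
    (hB : ∀ t ∈ boxPoints M, (leadMinor (boxMatrix K P t) k).natAbs ≤ B) :
    ∑ ℓ ∈ (Finset.Ioc R B).filter Nat.Prime, (1 / (ℓ : ℝ) + 1 / m) *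
        boxCount M (fun t => (ℓ : ℤ) ∣ leadMinor (boxMatrix K P t) k) ≤
      (d * (1 / R + (1 + Real.log B) / m) + 2 * Real.log B / m) *
        boxCount M (fun _ => True) := by
  set T := boxCount M (fun _ => True) with hT
  have hT0 : 0 ≤ T := Nat.cast_nonneg _
  have h1 : ∑ ℓ ∈ (Finset.Ioc R B).filter Nat.Prime, (1 / (ℓ : ℝ)) *
      boxCount M (fun t => (ℓ : ℤ) ∣ leadMinor (boxMatrix K P t) k) ≤
      d * (1 / R + (1 + Real.log B) / m) * T := by
    calc _ ≤ ∑ ℓ ∈ (Finset.Ioc R B).filter Nat.Prime,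
            d * T * ((1 / (ℓ : ℝ)) * (1 / ℓ + 1 / m)) := by
          refine Finset.sum_le_sum fun ℓ hℓ => ?_
          rw [Finset.mem_filter, Finset.mem_Ioc] at hℓ
          calc _ ≤ (1 / (ℓ : ℝ)) * (k * (1 / ℓ + 1 / m) * T) :=
                mul_le_mul_of_nonneg_left
                  (boxCount_dvd_leadMinor_le hm hmM hℓ.2 (hRP ℓ hℓ.2 hℓ.1.1) hk) (by positivity)
            _ ≤ (1 / (ℓ : ℝ)) * (d * (1 / ℓ + 1 / m) * T) := by gcongr
            _ = _ := by ring
      _ = d * T * ∑ ℓ ∈ (Finset.Ioc R B).filter Nat.Prime,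
            ((1 / (ℓ : ℝ)) * (1 / ℓ + 1 / m)) := by rw [Finset.mul_sum]
      _ ≤ d * T * (1 / R + (1 + Real.log B) / m) :=
          mul_le_mul_of_nonneg_left (sum_prime_weights_le hR m) (by positivity)
      _ = _ := by ring
  have h2 : ∑ ℓ ∈ (Finset.Ioc R B).filter Nat.Prime,
      boxCount M (fun t => (ℓ : ℤ) ∣ leadMinor (boxMatrix K P t) k) ≤ 2 * Real.log B * T := by
    simp only [hT, boxCount_eq_sum]
    rw [Finset.sum_comm, Finset.mul_sum]
    refine Finset.sum_le_sum fun t ht => ?_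
    rw [Finset.sum_boole, if_pos trivial, mul_one]
    refine two_mul_log_ge_card_primes_dvd (hne t ht) (hB t ht) _ fun ℓ hℓ => ?_
    exact (Finset.mem_filter.1 hℓ).2
  calc _ = ∑ ℓ ∈ (Finset.Ioc R B).filter Nat.Prime, (1 / (ℓ : ℝ)) *
      boxCount M (fun t => (ℓ : ℤ) ∣ leadMinor (boxMatrix K P t) k) +
      (1 / m) * ∑ ℓ ∈ (Finset.Ioc R B).filter Nat.Prime,
      boxCount M (fun t => (ℓ : ℤ) ∣ leadMinor (boxMatrix K P t) k) := by
        rw [Finset.mul_sum, ← Finset.sum_add_distrib]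
        exact Finset.sum_congr rfl fun _ _ => by ring
    _ ≤ d * (1 / R + (1 + Real.log B) / m) * T + (1 / m) * (2 * Real.log B * T) := by gcongr
    _ = _ := by ring

theorem boxCount_superdiag_le (hm : 0 < m) (hmM : ∀ p, m ≤ M p) {ℓ : ℕ} (hℓ : ℓ.Prime)
    (hℓP : ¬ ℓ ∣ P) {k : ℕ} (hk : k < d) :
    boxCount M (fun t => ((ℓ : ℤ) ∣ leadMinor (boxMatrix K P t) (k + 1) ∧
        ¬ (ℓ : ℤ) ∣ leadMinor (boxMatrix K P t) k) ∧
        (ℓ : ℤ) ∣ skipMinor (boxMatrix K P t) (k + 1)) ≤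
      (1 / ℓ + 1 / m) *
        boxCount M (fun t => (ℓ : ℤ) ∣ leadMinor (boxMatrix K P t) (k + 1)) := by
  refine (boxCount_and_dvd_le M (⟨k, hk⟩, ⟨k + 1, by omega⟩) hm (hmM _) hℓ _
    (fun t => skipMinor (boxMatrix K P t) (k + 1)) ?_ ?_).trans ?_
  · intro t s
    rw [leadMinor_update t _ s (Or.inr le_rfl), leadMinor_update t _ s (Or.inl le_rfl)]
  · intro t ht
    refine ⟨_, _, ?_, fun s => skipMinor_update_superdiag t _ s rfl⟩
    intro h
    rcases (Nat.prime_iff_prime_int.1 hℓ).dvd_or_dvd h with h | h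
    · exact hℓP (by exact_mod_cast h)
    · exact ht.2 h
  · exact mul_le_mul_of_nonneg_left (boxCount_mono fun _ _ h => h.1) (by positivity)

theorem boxCount_subdiag_le (hm : 0 < m) (hmM : ∀ p, m ≤ M p) {ℓ : ℕ} (hℓ : ℓ.Prime)
    (hℓP : ¬ ℓ ∣ P) {k : ℕ} (hk : k + 1 < d) :
    boxCount M (fun t => ((ℓ : ℤ) ∣ leadMinor (boxMatrix K P t) (k + 1) ∧
        ¬ (ℓ : ℤ) ∣ skipMinor (boxMatrix K P t) (k + 1)) ∧
        (ℓ : ℤ) ∣ leadMinor (boxMatrix K P t) (k + 2)) ≤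
      (1 / ℓ + 1 / m) *
        boxCount M (fun t => (ℓ : ℤ) ∣ leadMinor (boxMatrix K P t) (k + 1)) := by
  refine (boxCount_and_dvd_le M (⟨k + 1, hk⟩, ⟨k, by omega⟩) hm (hmM _) hℓ _
    (fun t => leadMinor (boxMatrix K P t) (k + 2)) ?_ ?_).trans ?_
  · intro t s
    rw [leadMinor_update t _ s (Or.inl le_rfl), skipMinor_update t _ s le_rfl]
  · intro t ht
    refine ⟨_, _, ?_, fun s => leadMinor_update_subdiag t _ s rfl⟩
    rw [dvd_neg]
    intro h
    rcases (Nat.prime_iff_prime_int.1 hℓ).dvd_or_dvd h with h | h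
    · exact hℓP (by exact_mod_cast h)
    · exact ht.2 h
  · exact mul_le_mul_of_nonneg_left (boxCount_mono fun _ _ h => h.1) (by positivity)

theorem leadMinor_modEq_one (hK : (P : ℤ) ∣ (K : ℤ) - 1) (t : Fin d × Fin (d + 1) → ℕ) (k : ℕ) :
    (P : ℤ) ∣ leadMinor (boxMatrix K P t) k - 1 := by
  have hK' : ((K : ℤ) : ZMod P) = 1 := by
    have := (ZMod.intCast_zmod_eq_zero_iff_dvd _ P).2 hK
    push_cast at this ⊢
    exact sub_eq_zero.1 this
  rw [← ZMod.intCast_zmod_eq_zero_iff_dvd]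
  push_cast
  rw [sub_eq_zero, leadMinor, ← eq_intCast (Int.castRingHom (ZMod P)), RingHom.map_det]
  convert Matrix.det_one (n := Fin k) (R := ZMod P)
  ext i j
  simp only [RingHom.mapMatrix_apply, Matrix.map_apply, Matrix.of_apply, boxMatrix,
    Int.coe_castRingHom, Matrix.one_apply, Fin.ext_iff]
  push_cast at hK' ⊢
  simp [hK']

/-- All but a small proportion of the box points give coprime minors. -/
theorem boxCount_not_isCoprime_le (hm : 0 < m) (hmM : ∀ p, m ≤ M p) {R B : ℕ}
    (hR : 0 < R) (hRP : ∀ ℓ : ℕ, ℓ.Prime → (R < ℓ ↔ ¬ ℓ ∣ P)) (hK : (P : ℤ) ∣ (K : ℤ) - 1)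
    (hne : ∀ t ∈ boxPoints M, ∀ k ≤ d, leadMinor (boxMatrix K P t) k ≠ 0)
    (hB : ∀ t ∈ boxPoints M, ∀ k ≤ d, (leadMinor (boxMatrix K P t) k).natAbs ≤ B) :
    boxCount M (fun t => ¬ IsCoprime (leadMinor (boxMatrix K P t) d)
        (skipMinor (boxMatrix K P t) d)) ≤
      2 * d * (d * (1 / R + (1 + Real.log B) / m) + 2 * Real.log B / m) *
        boxCount M (fun _ => True) := by
  set τ := (d * (1 / R + (1 + Real.log B) / m) + 2 * Real.log B / m) *
    boxCount M (fun _ => True)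
  set W : ℕ → ℕ → (Fin d × Fin (d + 1) → ℕ) → Prop := fun k ℓ t =>
    ((ℓ : ℤ) ∣ leadMinor (boxMatrix K P t) (k + 1) ∧
        ¬ (ℓ : ℤ) ∣ leadMinor (boxMatrix K P t) k) ∧
        (ℓ : ℤ) ∣ skipMinor (boxMatrix K P t) (k + 1)
  set U : ℕ → ℕ → (Fin d × Fin (d + 1) → ℕ) → Prop := fun k ℓ t =>
    ((ℓ : ℤ) ∣ leadMinor (boxMatrix K P t) (k + 1) ∧
        ¬ (ℓ : ℤ) ∣ skipMinor (boxMatrix K P t) (k + 1)) ∧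
        (ℓ : ℤ) ∣ leadMinor (boxMatrix K P t) (k + 2)
  set Q := (Finset.Ioc R B).filter Nat.Prime
  have hQ : ∀ ℓ ∈ Q, ℓ.Prime ∧ ¬ ℓ ∣ P := by
    intro ℓ hℓ
    rw [Finset.mem_filter, Finset.mem_Ioc] at hℓ
    exact ⟨hℓ.2, (hRP ℓ hℓ.2).1 hℓ.1.1⟩
  have hτ : ∀ k ≤ d, ∑ ℓ ∈ Q, (1 / (ℓ : ℝ) + 1 / m) *
        boxCount M (fun t => (ℓ : ℤ) ∣ leadMinor (boxMatrix K P t) k) ≤ τ := fun k hk =>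
    sum_primes_boxCount_dvd_leadMinor_le hm hmM hR (fun ℓ hℓ h => (hRP ℓ hℓ).1 h) hk
      (fun t ht => hne t ht k hk) (fun t ht => hB t ht k hk)
  have hW : ∀ k ∈ Finset.range d, boxCount M (fun t => ∃ ℓ ∈ Q, W k ℓ t) ≤ τ := by
    intro k hk
    rw [Finset.mem_range] at hk
    refine ((boxCount_exists_le M Q _).trans (Finset.sum_le_sum fun ℓ hℓ => ?_)).trans
      (hτ (k + 1) hk)
    exact boxCount_superdiag_le hm hmM (hQ ℓ hℓ).1 (hQ ℓ hℓ).2 hk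
  have hU : ∀ k ∈ Finset.range (d - 1), boxCount M (fun t => ∃ ℓ ∈ Q, U k ℓ t) ≤ τ := by
    intro k hk
    rw [Finset.mem_range] at hk
    refine ((boxCount_exists_le M Q _).trans (Finset.sum_le_sum fun ℓ hℓ => ?_)).trans
      (hτ (k + 1) (by omega))
    exact boxCount_subdiag_le hm hmM (hQ ℓ hℓ).1 (hQ ℓ hℓ).2 (by omega)
  have hτ0 : 0 ≤ τ := (Finset.sum_nonneg fun _ _ =>
    mul_nonneg (by positivity) (Nat.cast_nonneg _)).trans (hτ 0 (Nat.zero_le _))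
  have hmain : ∀ t ∈ boxPoints M, ¬ IsCoprime (leadMinor (boxMatrix K P t) d)
      (skipMinor (boxMatrix K P t) d) →
      (∃ k ∈ Finset.range d, ∃ ℓ ∈ Q, W k ℓ t) ∨
      (∃ k ∈ Finset.range (d - 1), ∃ ℓ ∈ Q, U k ℓ t) := by
    intro t ht hcop
    by_contra! hcon
    obtain ⟨hnW, hnU⟩ := hcon
    rw [Int.isCoprime_iff_gcd_eq_one] at hcop
    obtain ⟨ℓ, hℓ, hℓd⟩ := Nat.exists_prime_and_dvd hcop
    have hℓ' := Nat.prime_iff_prime_int.1 hℓ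
    have hd1 : (ℓ : ℤ) ∣ leadMinor (boxMatrix K P t) d :=
      (Int.natCast_dvd_natCast.2 hℓd).trans (Int.gcd_dvd_left _ _)
    have hd2 : (ℓ : ℤ) ∣ skipMinor (boxMatrix K P t) d :=
      (Int.natCast_dvd_natCast.2 hℓd).trans (Int.gcd_dvd_right _ _)
    have hℓP : ¬ ℓ ∣ P := by
      intro h
      have h1 := (Int.natCast_dvd_natCast.2 h).trans (leadMinor_modEq_one hK t d)
      have h2 := dvd_sub hd1 h1
      simp only [sub_sub_cancel] at h2
      exact hℓ'.not_dvd_one h2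
    have hℓQ : ℓ ∈ Q := by
      rw [Finset.mem_filter, Finset.mem_Ioc]
      refine ⟨⟨(hRP ℓ hℓ).2 hℓP, (Nat.le_of_dvd ?_ (Int.natCast_dvd.1 hd1)).trans
        (hB t ht d le_rfl)⟩, hℓ⟩
      exact Int.natAbs_pos.2 (hne t ht d le_rfl)
    have hdown : ∀ k ≤ d, ¬ ((ℓ : ℤ) ∣ leadMinor (boxMatrix K P t) k ∧
        (ℓ : ℤ) ∣ skipMinor (boxMatrix K P t) k) := by
      intro k
      induction k with
      | zero =>
        rintro _ ⟨h, _⟩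
        exact hℓ'.not_dvd_one (by simpa [leadMinor] using h)
      | succ k ih =>
        rintro hk ⟨h1, h2⟩
        have h3 : (ℓ : ℤ) ∣ leadMinor (boxMatrix K P t) k := by
          by_contra h3
          exact hnW k (Finset.mem_range.2 hk) ℓ hℓQ ⟨⟨h1, h3⟩, h2⟩
        rcases k with _ | k
        · exact hℓ'.not_dvd_one (by simpa [leadMinor] using h3)
        · refine ih (by omega) ⟨h3, ?_⟩
          by_contra h4
          exact hnU k (Finset.mem_range.2 (by omega)) ℓ hℓQ ⟨⟨h3, h4⟩, h1⟩
    exact hdown d le_rfl ⟨hd1, hd2⟩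
  calc _ ≤ _ := (boxCount_mono hmain).trans (boxCount_or_le _ _ _)
    _ ≤ ∑ k ∈ Finset.range d, τ + ∑ k ∈ Finset.range (d - 1), τ :=
      add_le_add ((boxCount_exists_le _ _ _).trans (Finset.sum_le_sum hW))
        ((boxCount_exists_le _ _ _).trans (Finset.sum_le_sum hU))
    _ ≤ 2 * d * τ := by
      simp only [Finset.sum_const, Finset.card_range, nsmul_eq_mul]
      have : ((d - 1 : ℕ) : ℝ) ≤ d := by exact_mod_cast Nat.sub_le _ _
      nlinarith
    _ = _ := by ring

end Sieve

section LinearAlgebra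

open Matrix

theorem abs_det_le_prod_sum {n : Type*} [Fintype n] [DecidableEq n] (A : Matrix n n ℝ) :
    |A.det| ≤ ∏ i, ∑ j, |A i j| := by
  rw [← Matrix.det_transpose, Matrix.det_apply, Finset.prod_univ_sum, Fintype.piFinset_univ]
  refine (Finset.abs_sum_le_sum_abs _ _).trans ?_
  calc ∑ σ : Equiv.Perm n, |Equiv.Perm.sign σ • ∏ i, Aᵀ (σ i) i|
      = ∑ f ∈ Finset.univ.map ⟨fun σ : Equiv.Perm n => (σ : n → n), DFunLike.coe_injective⟩,
          ∏ i, |A i (f i)| := by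
        rw [Finset.sum_map]
        refine Finset.sum_congr rfl fun σ _ => ?_
        rcases Int.units_eq_one_or (Equiv.Perm.sign σ) with h | h <;>
          simp [h, Finset.abs_prod]
    _ ≤ _ := Finset.sum_le_sum_of_subset_of_nonneg (Finset.subset_univ _)
        fun _ _ _ => Finset.prod_nonneg fun _ _ => abs_nonneg _

/-- A diagonally dominant matrix expands the sup norm. -/
theorem exists_mul_abs_le_abs_mulVec {d : ℕ} (hd : 0 < d) {A : Matrix (Fin d) (Fin d) ℝ} {κ τ : ℝ}
    (hdiag : ∀ i, κ ≤ A i i) (hoff : ∀ i j, i ≠ j → |A i j| ≤ τ) (hτ : 0 ≤ τ) (a : Fin d → ℝ) :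
    ∃ i, (∀ j, |a j| ≤ |a i|) ∧ (κ - d * τ) * |a i| ≤ |(A *ᵥ a) i| := by
  have : Nonempty (Fin d) := ⟨⟨0, hd⟩⟩
  obtain ⟨i, hi⟩ := Finite.exists_max fun j => |a j|
  refine ⟨i, hi, ?_⟩
  have h1 : (A *ᵥ a) i = A i i * a i + ∑ j ∈ Finset.univ.erase i, A i j * a j := by
    rw [Finset.add_sum_erase _ (fun j => A i j * a j) (Finset.mem_univ i)]
    rfl
  have h2 : |∑ j ∈ Finset.univ.erase i, A i j * a j| ≤ d * τ * |a i| := by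
    calc _ ≤ ∑ j ∈ Finset.univ.erase i, |A i j * a j| := Finset.abs_sum_le_sum_abs _ _
      _ ≤ ∑ j ∈ Finset.univ.erase i, τ * |a i| := by
          refine Finset.sum_le_sum fun j hj => ?_
          rw [abs_mul]
          exact mul_le_mul (hoff i j (Finset.ne_of_mem_erase hj).symm) (hi j) (abs_nonneg _) hτ
      _ ≤ ∑ j : Fin d, τ * |a i| := Finset.sum_le_sum_of_subset_of_nonneg
          (Finset.subset_univ _) fun _ _ _ => by positivity
      _ = _ := by simp [mul_assoc]
  have h3 : κ * |a i| ≤ |A i i * a i| := by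
    rw [abs_mul]
    exact mul_le_mul_of_nonneg_right ((hdiag i).trans (le_abs_self _)) (abs_nonneg _)
  rw [h1]
  have h4 := abs_sub_abs_le_abs_add (A i i * a i) (∑ j ∈ Finset.univ.erase i, A i j * a j)
  linarith

theorem det_ne_zero_of_dominant {d : ℕ} {A : Matrix (Fin d) (Fin d) ℝ} {κ τ : ℝ}
    (hdiag : ∀ i, κ ≤ A i i) (hoff : ∀ i j, i ≠ j → |A i j| ≤ τ) (hτ : 0 ≤ τ)
    (h : d * τ < κ) : A.det ≠ 0 := by
  rcases Nat.eq_zero_or_pos d with rfl | hd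
  · simp
  intro h0
  obtain ⟨v, hv, hAv⟩ := Matrix.exists_mulVec_eq_zero_iff.2 h0
  obtain ⟨i, hi, hle⟩ := exists_mul_abs_le_abs_mulVec hd hdiag hoff hτ v
  rw [hAv, Pi.zero_apply, abs_zero] at hle
  have h1 : |v i| ≤ 0 := by
    by_contra! h1
    nlinarith
  exact hv (funext fun j => abs_nonpos_iff.1 ((hi j).trans h1))

theorem exists_int_det_mul_eq {n : Type*} [Fintype n] [DecidableEq n] (A : Matrix n n ℤ)
    {a : n → ℝ} {z : n → ℤ} (h : A.map (Int.cast : ℤ → ℝ) *ᵥ a = fun i => (z i : ℝ)) (i : n) :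
    ∃ u : ℤ, (A.det : ℝ) * a i = u := by
  refine ⟨(A.adjugate *ᵥ z) i, ?_⟩
  have h1 := congrArg (fun v => ((A.map (Int.cast : ℤ → ℝ)).adjugate *ᵥ v) i) h
  simp only [Matrix.mulVec_mulVec, Matrix.adjugate_mul, Matrix.smul_mulVec, Matrix.one_mulVec,
    Pi.smul_apply, smul_eq_mul] at h1
  have h2 : (A.map (Int.cast : ℤ → ℝ)).det = (A.det : ℝ) := (Int.cast_det A).symm
  have h3 : (A.map (Int.cast : ℤ → ℝ)).adjugate = A.adjugate.map (Int.cast : ℤ → ℝ) :=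
    ((Int.castRingHom ℝ).map_adjugate A).symm
  rw [h2, h3] at h1
  rw [h1]
  simp [Matrix.mulVec, dotProduct]

/-- The cell of an integer matrix `(X | y)`. -/
def cell {d : ℕ} (h ε : ℝ) (X : Matrix (Fin d) (Fin d) ℤ) (y : Fin d → ℤ) : Set (Fin d → ℝ) :=
  {γ | ∀ i, |h * ∑ j, (X i j : ℝ) * γ j - y i| ≤ ε}

/-- If the rows of `(X | y)` span a primitive lattice, points of the cell of `(X | y)` have no
good integer relation of height less than `H`. -/
theorem le_abs_of_mem_cell {d : ℕ} (hd : 0 < d) {X : Matrix (Fin d) (Fin d) ℤ} {y : Fin d → ℤ}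
    {h ε H κ τ Δ k : ℝ} (hdiag : ∀ i, k ≤ X i i) (hoff : ∀ i j, i ≠ j → |(X i j : ℝ)| ≤ τ)
    (hτ : 0 ≤ τ) (hH : 0 < H) (hk : H ≤ k - d * τ) (hΔ : |(X.det : ℝ)| ≤ Δ)
    (hκ : Δ * (κ + d * ε) < 1) (c : Fin d) (hcop : IsCoprime X.det (X.updateCol c y).det)
    {γ : Fin d → ℝ} (hγ : γ ∈ cell h ε X y) {z : Fin d → ℤ} (hz : z ≠ 0)
    (hzH : ∀ j, |(z j : ℝ)| < H) (w : ℤ) :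
    κ ≤ |h * ∑ j, (z j : ℝ) * γ j - w| := by
  by_contra! hcon
  set A : Matrix (Fin d) (Fin d) ℝ := (Xᵀ).map Int.cast with hA
  have hAdiag : ∀ i, k ≤ A i i := fun i => hdiag i
  have hAoff : ∀ i j, i ≠ j → |A i j| ≤ τ := fun i j hij => hoff j i hij.symm
  have hdet : A.det ≠ 0 := det_ne_zero_of_dominant hAdiag hAoff hτ (by linarith)
  set a : Fin d → ℝ := A⁻¹ *ᵥ fun i => (z i : ℝ)
  have ha : A *ᵥ a = fun i => (z i : ℝ) := by
    rw [Matrix.mulVec_mulVec, Matrix.mul_nonsing_inv _ (isUnit_iff_ne_zero.2 hdet),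
      Matrix.one_mulVec]
  obtain ⟨i₀, hi₀, hle⟩ := exists_mul_abs_le_abs_mulVec hd hAdiag hAoff hτ a
  have ha1 : ∀ j, |a j| < 1 := by
    intro j
    refine (hi₀ j).trans_lt ?_
    rw [ha] at hle
    by_contra! h1
    nlinarith [hzH i₀]
  have hay : |∑ i, a i * y i - w| < κ + d * ε := by
    have e1 : h * ∑ j, (z j : ℝ) * γ j =
        ∑ i, a i * (h * ∑ j, (X i j : ℝ) * γ j) := by
      have : ∀ j, (z j : ℝ) = ∑ i, (X i j : ℝ) * a i := fun j => (congrFun ha j).symm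
      simp only [this, Finset.mul_sum, Finset.sum_mul]
      rw [Finset.sum_comm]
      exact Finset.sum_congr rfl fun _ _ => Finset.sum_congr rfl fun _ _ => by ring
    have e2 : |∑ i, a i * (h * ∑ j, (X i j : ℝ) * γ j - y i)| ≤ d * ε := by
      calc _ ≤ ∑ i, |a i * (h * ∑ j, (X i j : ℝ) * γ j - y i)| := Finset.abs_sum_le_sum_abs _ _
        _ ≤ ∑ i : Fin d, ε := by
          refine Finset.sum_le_sum fun i _ => ?_
          rw [abs_mul]
          have := mul_le_mul (ha1 i).le (hγ i) (abs_nonneg _) zero_le_one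
          linarith
        _ = _ := by simp
    have e3 : ∑ i, a i * y i - w = (h * ∑ j, (z j : ℝ) * γ j - w) -
        ∑ i, a i * (h * ∑ j, (X i j : ℝ) * γ j - y i) := by
      simp only [mul_sub, Finset.sum_sub_distrib, e1]
      ring
    rw [e3]
    exact (abs_sub _ _).trans_lt (by linarith)
  have hT : (Xᵀ).map (Int.cast : ℤ → ℝ) *ᵥ a = fun i => (z i : ℝ) := ha
  choose u hu using exists_int_det_mul_eq Xᵀ hT
  simp only [Matrix.det_transpose] at hu
  have hw : ∑ i, a i * y i = w := by
    have e1 : (X.det : ℝ) * (∑ i, a i * y i - w) = ((∑ i, u i * y i - X.det * w : ℤ) : ℝ) := by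
      simp only [Int.cast_sub, Int.cast_sum, Int.cast_mul, ← hu, mul_sub, Finset.mul_sum, mul_assoc]
    have e2 : |((∑ i, u i * y i - X.det * w : ℤ) : ℝ)| < 1 := by
      rw [← e1, abs_mul]
      refine lt_of_le_of_lt ?_ hκ
      exact mul_le_mul hΔ hay.le (abs_nonneg _) ((abs_nonneg _).trans hΔ)
    have e3 : ∑ i, u i * y i - X.det * w = 0 := by
      rw [← Int.abs_lt_one_iff]
      exact_mod_cast e2
    rw [e3, Int.cast_zero, mul_eq_zero] at e1
    have hX : (X.det : ℝ) ≠ 0 := by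
      rw [← Matrix.det_transpose, Int.cast_det]
      exact hdet
    linarith [e1.resolve_left hX]
  have hT' : ((X.updateCol c y)ᵀ).map (Int.cast : ℤ → ℝ) *ᵥ a =
      fun i => ((Function.update z c w i : ℤ) : ℝ) := by
    ext j
    rcases eq_or_ne j c with rfl | hj
    · simp only [Function.update_self, ← hw, Matrix.mulVec, dotProduct, Matrix.map_apply,
        Matrix.transpose_apply, Matrix.updateCol_self]
      exact Finset.sum_congr rfl fun _ _ => mul_comm _ _
    · rw [Function.update_of_ne hj, ← congrFun hT j]
      simp [Matrix.mulVec, dotProduct, Matrix.updateCol_ne hj]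
  choose u' hu' using exists_int_det_mul_eq _ hT'
  simp only [Matrix.det_transpose] at hu'
  obtain ⟨r, s, hrs⟩ := hcop
  have ha0 : a = 0 := by
    ext i
    have e1 : a i = ((r * u i + s * u' i : ℤ) : ℝ) := by
      push_cast
      rw [← hu, ← hu']
      have : (r : ℝ) * X.det + s * (X.updateCol c y).det = 1 := by exact_mod_cast hrs
      linear_combination (- a i) * this
    have e2 := ha1 i
    rw [e1] at e2 ⊢
    have e3 : r * u i + s * u' i = 0 := by
      rw [← Int.abs_lt_one_iff]
      exact_mod_cast e2
    rw [e3]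
    simp
  apply hz
  ext j
  have := congrFun ha j
  rw [ha0, Matrix.mulVec_zero] at this
  simpa using this.symm

theorem sum_sq_le_one_of_mem_cell {d : ℕ} (hd : 0 < d) {X : Matrix (Fin d) (Fin d) ℤ}
    {y : Fin d → ℤ} {h ε τ k : ℝ} (hdiag : ∀ i, k ≤ X i i)
    (hoff : ∀ i j, i ≠ j → |(X i j : ℝ)| ≤ τ) (hτ : 0 ≤ τ) (hε : 0 ≤ ε)
    (hy : ∀ i, |(y i : ℝ)| ≤ τ * h) (hh : 1 ≤ h) (hk : d * (τ + ε) ≤ k - d * τ)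
    (hk0 : 0 < k - d * τ) {γ : Fin d → ℝ} (hγ : γ ∈ cell h ε X y) : ∑ i, (γ i) ^ 2 ≤ 1 := by
  obtain ⟨i, hi, hle⟩ := exists_mul_abs_le_abs_mulVec (A := X.map Int.cast) hd hdiag hoff hτ γ
  have h1 : h * |(X.map Int.cast *ᵥ γ) i| ≤ h * (τ + ε) := by
    have e1 := hγ i
    have e2 : (X.map Int.cast *ᵥ γ) i = ∑ j, (X i j : ℝ) * γ j := rfl
    rw [← e2] at e1
    have e3 := abs_sub_abs_le_abs_sub (h * (X.map Int.cast *ᵥ γ) i) (y i)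
    rw [abs_mul, abs_of_nonneg (by linarith : 0 ≤ h)] at e3
    nlinarith [hy i]
  have h2 : |(X.map Int.cast *ᵥ γ) i| ≤ τ + ε := le_of_mul_le_mul_left h1 (by linarith)
  have hd' : (0 : ℝ) < d := by exact_mod_cast hd
  have h3 : d * |γ i| ≤ 1 := by
    by_contra! h3
    have : (k - d * τ) * 1 < (k - d * τ) * (d * |γ i|) := mul_lt_mul_of_pos_left h3 hk0
    nlinarith
  have hd1 : (1 : ℝ) ≤ d := by exact_mod_cast hd
  calc ∑ j, (γ j) ^ 2 ≤ ∑ j : Fin d, |γ i| ^ 2 := Finset.sum_le_sum fun j _ => by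
        rw [← sq_abs]
        exact pow_le_pow_left₀ (abs_nonneg _) (hi j) 2
    _ = d * |γ i| ^ 2 := by simp
    _ ≤ 1 := by nlinarith [abs_nonneg (γ i)]

theorem measurableSet_cell {d : ℕ} (h ε : ℝ) (X : Matrix (Fin d) (Fin d) ℤ) (y : Fin d → ℤ) :
    MeasurableSet (cell h ε X y) := by
  refine IsClosed.measurableSet ?_
  simp only [cell, Set.ofPred_forall]
  exact isClosed_iInter fun i => isClosed_le (by fun_prop) continuous_const

theorem volume_cell {d : ℕ} {h ε : ℝ} (hh : 0 < h) (hε : 0 ≤ ε) {X : Matrix (Fin d) (Fin d) ℤ}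
    (y : Fin d → ℤ) (hX : X.det ≠ 0) :
    volume (cell h ε X y) = ENNReal.ofReal ((2 * ε / h) ^ d / |(X.det : ℝ)|) := by
  set A : Matrix (Fin d) (Fin d) ℝ := X.map Int.cast
  have hA : A.det = X.det := (Int.cast_det X).symm
  have e1 : cell h ε X y = Matrix.toLin' A ⁻¹'
      Set.Icc (fun i => (y i - ε) / h) (fun i => (y i + ε) / h) := by
    ext γ
    simp only [cell, Set.mem_ofPred_eq, Set.mem_preimage, Set.mem_Icc, Pi.le_def, ← forall_and]
    refine forall_congr' fun i => ?_
    have e2 : Matrix.toLin' A γ i = ∑ j, (X i j : ℝ) * γ j := rfl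
    rw [e2, abs_le, div_le_iff₀ hh, le_div_iff₀ hh]
    constructor <;> rintro ⟨h1, h2⟩ <;> constructor <;> linarith
  have hA0 : A.det ≠ 0 := by rw [hA]; exact_mod_cast hX
  rw [e1, MeasureTheory.Measure.addHaar_preimage_linearMap _ (by rwa [LinearMap.det_toLin']),
    LinearMap.det_toLin', hA, Real.volume_Icc_pi]
  have e3 : ∀ i, ((y i : ℝ) + ε) / h - (y i - ε) / h = 2 * ε / h := fun i => by ring
  simp only [e3, Finset.prod_const, Finset.card_univ, Fintype.card_fin]
  rw [← ENNReal.ofReal_pow (by positivity), ← ENNReal.ofReal_mul (abs_nonneg _), abs_inv]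
  congr 1
  ring

end LinearAlgebra

section BoxCells

variable {d : ℕ} {K P : ℕ}

/-- The first `d` columns of `boxMatrix K P t`. -/
def boxSquare (K P : ℕ) (t : Fin d × Fin (d + 1) → ℕ) : Matrix (Fin d) (Fin d) ℤ :=
  Matrix.of fun i j => boxMatrix K P t i j

/-- The last column of `boxMatrix K P t`. -/
def boxCol (K P : ℕ) (t : Fin d × Fin (d + 1) → ℕ) : Fin d → ℤ :=
  fun i => boxMatrix K P t i d

/-- The side lengths of the box of parameters. -/
def boxSides (d m h : ℕ) (p : Fin d × Fin (d + 1)) : ℕ :=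
  if p.2 = Fin.last d then m * h else m

theorem boxSquare_apply (t : Fin d × Fin (d + 1) → ℕ) (i j : Fin d) :
    boxSquare K P t i j = (if i = j then (K : ℤ) else 0) + P * t (i, j.castSucc) := by
  have h : (i : ℕ) < d ∧ (j : ℕ) < d + 1 := ⟨i.2, by omega⟩
  simp only [boxSquare, Matrix.of_apply, boxMatrix, dif_pos h, Fin.ext_iff]
  rfl

theorem boxCol_apply (t : Fin d × Fin (d + 1) → ℕ) (i : Fin d) :
    boxCol K P t i = P * t (i, Fin.last d) := by
  have h : (i : ℕ) < d ∧ d < d + 1 := ⟨i.2, by omega⟩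
  simp only [boxCol, boxMatrix, dif_pos h, if_neg i.2.ne, zero_add]
  rfl

theorem skipMinor_boxMatrix (hd : 0 < d) (t : Fin d × Fin (d + 1) → ℕ) :
    skipMinor (boxMatrix K P t) d =
      ((boxSquare K P t).updateCol ⟨d - 1, by omega⟩ (boxCol K P t)).det := by
  unfold skipMinor
  congr 1
  ext i j
  rw [Matrix.updateCol_apply]
  by_cases hj : (j : ℕ) + 1 = d
  · have : j = ⟨d - 1, by omega⟩ := Fin.ext (by simp; omega)
    rw [if_pos this, Matrix.of_apply, if_pos hj]
    rfl
  · have : j ≠ ⟨d - 1, by omega⟩ := fun h => hj (by rw [h]; simp; omega)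
    rw [if_neg this, Matrix.of_apply, if_neg hj]
    rfl

variable {m h : ℕ} {τ : ℝ} {t : Fin d × Fin (d + 1) → ℕ}

theorem mul_le_of_mem_boxPoints (hτ : (P : ℝ) * m ≤ τ) (ht : t ∈ boxPoints (boxSides d m h))
    (i j : Fin d) : (P : ℝ) * t (i, j.castSucc) ≤ τ := by
  have h1 := Finset.mem_range.1 (Fintype.mem_piFinset.1 ht (i, j.castSucc))
  rw [boxSides, if_neg (Fin.castSucc_lt_last j).ne] at h1
  have h2 : (t (i, j.castSucc) : ℝ) ≤ m := by exact_mod_cast h1.le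
  exact (mul_le_mul_of_nonneg_left h2 (by positivity)).trans hτ

theorem abs_boxCol_le (hτ : (P : ℝ) * m ≤ τ) (ht : t ∈ boxPoints (boxSides d m h))
    (i : Fin d) : |(boxCol K P t i : ℝ)| ≤ τ * h := by
  have h1 := Finset.mem_range.1 (Fintype.mem_piFinset.1 ht (i, Fin.last d))
  rw [boxSides, if_pos rfl] at h1
  have h2 : (t (i, Fin.last d) : ℝ) ≤ m * h := by exact_mod_cast h1.le
  rw [boxCol_apply]
  push_cast
  rw [abs_of_nonneg (by positivity)]
  calc (P : ℝ) * t (i, Fin.last d) ≤ P * (m * h) := by gcongr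
    _ = P * m * h := by ring
    _ ≤ τ * h := by gcongr

theorem le_boxSquare_diag (t : Fin d × Fin (d + 1) → ℕ) (i : Fin d) :
    (K : ℝ) ≤ boxSquare K P t i i := by
  rw [boxSquare_apply, if_pos rfl]
  push_cast
  have : (0 : ℝ) ≤ (P : ℝ) * t (i, i.castSucc) := by positivity
  linarith

theorem abs_boxSquare_off_le (hτ : (P : ℝ) * m ≤ τ) (ht : t ∈ boxPoints (boxSides d m h))
    {i j : Fin d} (hij : i ≠ j) : |(boxSquare K P t i j : ℝ)| ≤ τ := by
  rw [boxSquare_apply, if_neg hij, zero_add]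
  push_cast
  rw [abs_of_nonneg (by positivity)]
  exact mul_le_of_mem_boxPoints hτ ht i j

theorem abs_boxSquare_sub_le (hτ : (P : ℝ) * m ≤ τ) (ht : t ∈ boxPoints (boxSides d m h))
    {t' : Fin d × Fin (d + 1) → ℕ} (ht' : t' ∈ boxPoints (boxSides d m h)) (i j : Fin d) :
    |(boxSquare K P t i j : ℝ) - boxSquare K P t' i j| ≤ τ := by
  rw [boxSquare_apply, boxSquare_apply]
  push_cast
  have h1 := mul_le_of_mem_boxPoints hτ ht i j
  have h2 := mul_le_of_mem_boxPoints hτ ht' i j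
  have h3 : (0 : ℝ) ≤ (P : ℝ) * t (i, j.castSucc) := by positivity
  have h4 : (0 : ℝ) ≤ (P : ℝ) * t' (i, j.castSucc) := by positivity
  rw [abs_le]
  constructor <;> linarith

theorem leadMinor_boxMatrix_ne_zero_and_le (hτ : (P : ℝ) * m ≤ τ) (hτ0 : 0 ≤ τ)
    (hK : d * τ < K) (ht : t ∈ boxPoints (boxSides d m h)) {k : ℕ} (hk : k ≤ d) :
    leadMinor (boxMatrix K P t) k ≠ 0 ∧
      |(leadMinor (boxMatrix K P t) k : ℝ)| ≤ ((K : ℝ) + d * τ) ^ k := by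
  set A : Matrix (Fin k) (Fin k) ℝ :=
    ((boxSquare K P t).submatrix (Fin.castLE hk) (Fin.castLE hk)).map Int.cast with hA
  have hdet : (leadMinor (boxMatrix K P t) k : ℝ) = A.det := Int.cast_det _
  have hkd : (k : ℝ) ≤ d := by exact_mod_cast hk
  have hoff : ∀ i j, i ≠ j → |A i j| ≤ τ := fun i j hij =>
    abs_boxSquare_off_le hτ ht fun h => hij (Fin.castLE_injective hk h)
  constructor
  · have : A.det ≠ 0 := det_ne_zero_of_dominant (κ := K) (fun i => le_boxSquare_diag t _) hoff hτ0
      (lt_of_le_of_lt (by gcongr) hK)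
    rw [← hdet] at this
    exact_mod_cast this
  · rw [hdet]
    refine (abs_det_le_prod_sum A).trans ?_
    have : ∀ i, ∑ j, |A i j| ≤ (K : ℝ) + d * τ := by
      intro i
      have h1 : ∀ j, |A i j| ≤ (if i = j then (K : ℝ) else 0) + τ := by
        intro j
        split_ifs with hij
        · subst hij
          have h2 := mul_le_of_mem_boxPoints hτ ht (Fin.castLE hk i) (Fin.castLE hk i)
          have h3 : A i i = K + P * t (Fin.castLE hk i, (Fin.castLE hk i).castSucc) := by
            simp [A, boxSquare_apply]
          rw [h3, abs_of_nonneg (by positivity)]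
          linarith
        · rw [zero_add]
          exact hoff i j hij
      refine (Finset.sum_le_sum fun j _ => h1 j).trans ?_
      rw [Finset.sum_add_distrib]
      simp only [Finset.sum_ite_eq, Finset.mem_univ, if_true, Finset.sum_const, Finset.card_univ,
        Fintype.card_fin, nsmul_eq_mul]
      gcongr
    calc ∏ i, ∑ j, |A i j| ≤ ∏ i : Fin k, ((K : ℝ) + d * τ) :=
          Finset.prod_le_prod (fun i _ => Finset.sum_nonneg fun _ _ => abs_nonneg _)
            fun i _ => this i
      _ = _ := by simp

theorem boxCount_true_boxSides (d m h : ℕ) :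
    boxCount (boxSides d m h) (fun _ => True) = (m : ℝ) ^ (d * d) * (m * h) ^ d := by
  simp only [boxCount, Finset.filter_true, boxPoints, Fintype.card_piFinset, Finset.card_range]
  rw [Fintype.prod_prod_type_right, Fin.prod_univ_castSucc]
  simp only [boxSides, if_true, (Fin.castSucc_lt_last _).ne, if_false, Finset.prod_const,
    Finset.card_univ, Fintype.card_fin, ← pow_mul]
  push_cast
  rfl

theorem disjoint_cell_of_ne (hd : 0 < d) (hP : 0 < P) (hτ : (P : ℝ) * m ≤ τ) (hτ0 : 0 ≤ τ)
    {ε H κ Δ : ℝ} (hH : 0 < H) (hK : H ≤ K - d * τ) (hτH : τ < H) (hεκ : 2 * ε < κ)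
    (hε1 : 2 * ε < 1) (hκ : Δ * (κ + d * ε) < 1) {t' : Fin d × Fin (d + 1) → ℕ}
    (ht : t ∈ boxPoints (boxSides d m h)) (ht' : t' ∈ boxPoints (boxSides d m h))
    (hΔ : |((boxSquare K P t).det : ℝ)| ≤ Δ)
    (hcop : IsCoprime (leadMinor (boxMatrix K P t) d) (skipMinor (boxMatrix K P t) d))
    (hne : t ≠ t') :
    Disjoint (cell h ε (boxSquare K P t) (boxCol K P t))
      (cell h ε (boxSquare K P t') (boxCol K P t')) := by
  rw [Set.disjoint_left]
  intro γ hγ hγ'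
  rw [skipMinor_boxMatrix hd] at hcop
  apply hne
  have hdiff : ∀ i, |h * ∑ j, ((boxSquare K P t i j - boxSquare K P t' i j : ℤ) : ℝ) * γ j -
      ((boxCol K P t i - boxCol K P t' i : ℤ) : ℝ)| ≤ 2 * ε := by
    intro i
    have e1 := abs_sub (h * ∑ j, (boxSquare K P t i j : ℝ) * γ j - boxCol K P t i)
      (h * ∑ j, (boxSquare K P t' i j : ℝ) * γ j - boxCol K P t' i)
    push_cast
    simp only [sub_mul, Finset.sum_sub_distrib, mul_sub]
    rw [sub_sub_sub_comm]
    linarith [hγ i, hγ' i]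
  have hrow : ∀ i, (fun j => boxSquare K P t i j - boxSquare K P t' i j) = 0 := by
    intro i
    by_contra hz
    have := le_abs_of_mem_cell hd (le_boxSquare_diag t)
      (fun _ _ hij => abs_boxSquare_off_le hτ ht hij) hτ0 hH hK hΔ hκ _ hcop hγ hz
      (fun j => by
        push_cast
        exact (abs_boxSquare_sub_le hτ ht ht' i j).trans_lt hτH)
      (boxCol K P t i - boxCol K P t' i)
    linarith [hdiff i]
  have hcol : ∀ i, boxCol K P t i = boxCol K P t' i := by
    intro i
    have e1 := hdiff i
    have e2 : ∀ j, boxSquare K P t i j - boxSquare K P t' i j = 0 := fun j => congrFun (hrow i) j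
    simp only [e2, Int.cast_zero, zero_mul, Finset.sum_const_zero, mul_zero, zero_sub,
      abs_neg] at e1
    rw [← sub_eq_zero, ← Int.abs_lt_one_iff]
    exact_mod_cast e1.trans_lt hε1
  have hP' : (P : ℤ) ≠ 0 := by exact_mod_cast hP.ne'
  ext ⟨i, j⟩
  refine Fin.lastCases ?_ (fun j => ?_) j
  · have := hcol i
    rw [boxCol_apply, boxCol_apply] at this
    exact_mod_cast mul_left_cancel₀ hP' this
  · have := sub_eq_zero.1 (congrFun (hrow i) j)
    rw [boxSquare_apply, boxSquare_apply] at this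
    exact_mod_cast mul_left_cancel₀ hP' (add_left_cancel this)

theorem exists_set_forall_le_abs {R : ℕ} (hd : 0 < d) (hP : 0 < P) (hm : 0 < m) (hh : 0 < h)
    (hτ : (P : ℝ) * m ≤ τ) {ε H κ Δ : ℝ} (hH : 0 < H) (hK : H ≤ K - d * τ) (hτH : τ < H)
    (hK1 : 1 ≤ K) (hΔ : ((K : ℝ) + d * τ) ^ d ≤ Δ) (hε : 0 ≤ ε) (hεκ : 2 * ε < κ)
    (hε1 : 2 * ε < 1) (hκ : Δ * (κ + d * ε) < 1) (hball : d * (τ + ε) ≤ K - d * τ)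
    (hR : 0 < R) (hRP : ∀ ℓ : ℕ, ℓ.Prime → (R < ℓ ↔ ¬ ℓ ∣ P)) (hKP : (P : ℤ) ∣ (K : ℤ) - 1)
    (hsieve : 2 * d * (d * (1 / R + (1 + Real.log ⌊Δ⌋₊) / m) + 2 * Real.log ⌊Δ⌋₊ / m) ≤ 1 / 2) :
    ∃ G : Set (Fin d → ℝ), MeasurableSet G ∧ G ⊆ {γ | ∑ i, (γ i) ^ 2 ≤ 1} ∧
      ENNReal.ofReal (1 / 2 * ((m : ℝ) ^ (d * d) * (m * h) ^ d) * ((2 * ε / h) ^ d / Δ)) ≤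
        volume G ∧
      ∀ γ ∈ G, ∀ z : Fin d → ℤ, z ≠ 0 → (∀ j, |(z j : ℝ)| < H) → ∀ w : ℤ,
        κ ≤ |h * ∑ j, (z j : ℝ) * γ j - w| := by
  classical
  have hτ0 : 0 ≤ τ := le_trans (by positivity) hτ
  have hKτ : d * τ < K := by linarith
  set T := boxPoints (boxSides d m h) with hT
  set C : (Fin d × Fin (d + 1) → ℕ) → Prop := fun t =>
    IsCoprime (leadMinor (boxMatrix K P t) d) (skipMinor (boxMatrix K P t) d) with hC
  have hminor := fun t ht k hk =>
    leadMinor_boxMatrix_ne_zero_and_le (K := K) (t := t) (k := k) (h := h) hτ hτ0 hKτ ht hk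
  have hpow : ∀ k ≤ d, ((K : ℝ) + d * τ) ^ k ≤ Δ := fun k hk =>
    (pow_le_pow_right₀ (by
      have : (1 : ℝ) ≤ K := by exact_mod_cast hK1
      nlinarith [mul_nonneg (Nat.cast_nonneg (α := ℝ) d) hτ0]) hk).trans hΔ
  have hbound : ∀ t ∈ T, ∀ k ≤ d, |(leadMinor (boxMatrix K P t) k : ℝ)| ≤ Δ :=
    fun t ht k hk => (hminor t ht k hk).2.trans (hpow k hk)
  have hΔ0 : 0 < Δ := by
    have := hpow 0 (Nat.zero_le _)
    rw [pow_zero] at this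
    linarith
  have hbad := boxCount_not_isCoprime_le (K := K) (P := P) (M := boxSides d m h) (B := ⌊Δ⌋₊) hm
    (fun p => by
      unfold boxSides
      split_ifs
      · exact Nat.le_mul_of_pos_right _ hh
      · exact le_rfl) hR hRP hKP (fun t ht k hk => (hminor t ht k hk).1)
    (fun t ht k hk => Nat.le_floor (by
      rw [Nat.cast_natAbs, Int.cast_abs]
      exact hbound t ht k hk))
  have hcount : 1 / 2 * ((m : ℝ) ^ (d * d) * (m * h) ^ d) ≤ (T.filter C).card := by
    rw [← boxCount_true_boxSides]
    have e1 : boxCount (boxSides d m h) (fun _ => True) ≤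
        boxCount (boxSides d m h) C + boxCount (boxSides d m h) (fun t => ¬ C t) :=
      (boxCount_mono fun t _ _ => em (C t)).trans (boxCount_or_le _ _ _)
    have e2 : boxCount (boxSides d m h) C = (T.filter C).card := by
      rw [boxCount_eq_sum, Finset.sum_boole]
    have e3 : 0 ≤ boxCount (boxSides d m h) (fun _ => True) := Nat.cast_nonneg _
    have e4 := hbad.trans (mul_le_mul_of_nonneg_right hsieve e3)
    rw [← e2]
    linarith
  have hX : ∀ t ∈ T, (boxSquare K P t).det ≠ 0 := fun t ht => (hminor t ht d le_rfl).1
  refine ⟨⋃ t ∈ T.filter C, cell h ε (boxSquare K P t) (boxCol K P t),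
    Finset.measurableSet_biUnion _ fun t _ => measurableSet_cell _ _ _ _, ?_, ?_, ?_⟩
  · refine Set.iUnion₂_subset fun t ht γ hγ => ?_
    have ht' := (Finset.mem_filter.1 ht).1
    exact sum_sq_le_one_of_mem_cell hd (le_boxSquare_diag t)
      (fun _ _ hij => abs_boxSquare_off_le hτ ht' hij) hτ0 hε (fun i => abs_boxCol_le hτ ht' i)
      (by exact_mod_cast hh) hball (by linarith) hγ
  · have hh' : (0 : ℝ) < h := by exact_mod_cast hh
    rw [measure_biUnion_finset]
    · calc ENNReal.ofReal (1 / 2 * ((m : ℝ) ^ (d * d) * (m * h) ^ d) * ((2 * ε / h) ^ d / Δ))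
          ≤ ENNReal.ofReal ((T.filter C).card * ((2 * ε / h) ^ d / Δ)) := by gcongr
        _ = ∑ t ∈ T.filter C, ENNReal.ofReal ((2 * ε / h) ^ d / Δ) := by
            rw [Finset.sum_const, nsmul_eq_mul, ENNReal.ofReal_mul (Nat.cast_nonneg _),
              ENNReal.ofReal_natCast]
        _ ≤ _ := by
            refine Finset.sum_le_sum fun t ht => ?_
            have ht' := (Finset.mem_filter.1 ht).1
            rw [volume_cell hh' hε _ (hX t ht')]
            have : (0 : ℝ) < |((boxSquare K P t).det : ℝ)| :=
              abs_pos.2 (by exact_mod_cast hX t ht')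
            exact ENNReal.ofReal_le_ofReal
              (div_le_div_of_nonneg_left (by positivity) this (hbound t ht' d le_rfl))
    · intro t ht t' ht' hne
      have ht1 := Finset.mem_filter.1 ht
      exact disjoint_cell_of_ne hd hP hτ hτ0 hH hK hτH hεκ hε1 hκ ht1.1
        (Finset.mem_filter.1 ht').1 (hbound t ht1.1 d le_rfl) ht1.2 hne
    · exact fun t _ => measurableSet_cell _ _ _ _
  · intro γ hγ z hz hzH w
    obtain ⟨t, ht, hγt⟩ := Set.mem_iUnion₂.1 hγ
    have ht1 := Finset.mem_filter.1 ht
    have hcop := ht1.2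
    rw [hC, skipMinor_boxMatrix hd] at hcop
    exact le_abs_of_mem_cell hd (le_boxSquare_diag t)
      (fun _ _ hij => abs_boxSquare_off_le hτ ht1.1 hij) hτ0 hH hK (hbound t ht1.1 d le_rfl) hκ _
      hcop hγt hz hzH w

end BoxCells

theorem one_add_pow_le {d : ℕ} (hd : 0 < d) : (1 + 4 * (1 / (100 * (d : ℝ)))) ^ d ≤ 25 / 24 := by
  have hd' : (0 : ℝ) < d := by exact_mod_cast hd
  have h1 : (1 + 4 * (1 / (100 * (d : ℝ)))) ^ d ≤ Real.exp (1 / 25) := by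
    calc _ ≤ Real.exp (4 * (1 / (100 * (d : ℝ)))) ^ d := by
          gcongr
          linarith [Real.add_one_le_exp (4 * (1 / (100 * (d : ℝ))))]
      _ = _ := by
          rw [← Real.exp_nat_mul]
          congr 1
          field_simp
          norm_num
  have h2 := Real.add_one_le_exp (-(1 / 25 : ℝ))
  have h3 : Real.exp (1 / 25) * Real.exp (-(1 / 25)) = 1 := by rw [← Real.exp_add]; simp
  nlinarith [Real.exp_pos (1 / 25)]

theorem eventually_mul_log_le {a b : ℝ} (hb : 0 < b) :
    ∀ᶠ H : ℕ in atTop, a * Real.log (2 * H) ≤ b * H := by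
  have h1 : Tendsto (fun H : ℕ => 2 * (H : ℝ)) atTop atTop :=
    tendsto_natCast_atTop_atTop.const_mul_atTop two_pos
  have h2 := (Real.isLittleO_log_id_atTop.comp_tendsto h1).def
    (c := b / (2 * (|a| + 1))) (by positivity)
  filter_upwards [h2] with H hH
  simp only [Function.comp_apply, Real.norm_eq_abs, id] at hH
  rw [abs_of_nonneg (by positivity : (0 : ℝ) ≤ 2 * H)] at hH
  calc a * Real.log (2 * H) ≤ |a| * |Real.log (2 * H)| := by
        rw [← abs_mul]
        exact le_abs_self _
    _ ≤ (|a| + 1) * (b / (2 * (|a| + 1)) * (2 * H)) := by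
        gcongr
        linarith
    _ = b * H := by field_simp

theorem sieve_error_le {d R l l' m : ℝ} (hd : 1 ≤ d) (hR : 8 * d ^ 2 = R) (hl : 1 ≤ l)
    (hl' : l' ≤ d * l) (hm : 0 < m) (h : 32 * d ^ 3 * l ≤ m) :
    2 * d * (d * (1 / R + (1 + l') / m) + 2 * l' / m) ≤ 1 / 2 := by
  have hd0 : 0 < d := by linarith
  have e1 : d * (1 + l') + 2 * l' ≤ 4 * d ^ 2 * l := by
    have h1 : 1 ≤ d * l := by nlinarith
    have e2 : d * (1 + l') ≤ d * (2 * (d * l)) := by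
      gcongr
      linarith
    have e3 : 1 * (d * l) ≤ d * (d * l) := mul_le_mul_of_nonneg_right hd (by linarith)
    linarith
  have e4 : (4 * d ^ 2 * l) / m ≤ 1 / (8 * d) := by
    rw [div_le_div_iff₀ hm (by positivity)]
    linarith
  have e5 : d * (1 / R) = 1 / (8 * d) := by
    rw [← hR]
    field_simp
  have e6 : d * (1 / R + (1 + l') / m) + 2 * l' / m =
      d * (1 / R) + (d * (1 + l') + 2 * l') / m := by ring
  rw [e6, e5]
  calc 2 * d * (1 / (8 * d) + (d * (1 + l') + 2 * l') / m)
      ≤ 2 * d * (1 / (8 * d) + 1 / (8 * d)) :=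
        mul_le_mul_of_nonneg_left
          (add_le_add_right ((div_le_div_of_nonneg_right e1 hm.le).trans e4) _) (by positivity)
    _ = 1 / 2 := by field_simp; norm_num

theorem mul_volume_identity {d : ℕ} {μ η H h : ℝ} (hH : 0 < H) (hh : 0 < h) :
    1 / 2 * ((μ * H) ^ (d * d) * (μ * H * h) ^ d) * ((η * (H ^ d)⁻¹ / h) ^ d / (2 * H) ^ d) =
      1 / 2 * (μ ^ (d * d) * μ ^ d * η ^ d / 2 ^ d) := by
  have h1 : (H ^ d)⁻¹ ^ d = (H ^ (d * d))⁻¹ := by rw [inv_pow, ← pow_mul]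
  rw [div_pow, mul_pow η, h1, mul_pow 2 H, mul_pow (μ * H) h, mul_pow μ H, mul_pow μ H]
  field_simp

set_option maxHeartbeats 1000000 in
/-- For every large height `H` and every `h ≥ 1` there is a set of uniformly positive measure of
points whose integer relations of height less than `H` are all badly approximable. -/
theorem exists_uniform_sets {d : ℕ} (hd : 0 < d) :
    ∃ δ₀ : ℝ, 0 < δ₀ ∧ ∃ H₀ : ℕ, ∀ H ≥ H₀, ∀ h : ℕ, 0 < h →
      ∃ G : Set (Fin d → ℝ), MeasurableSet G ∧ G ⊆ {γ | ∑ i, (γ i) ^ 2 ≤ 1} ∧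
        ENNReal.ofReal δ₀ ≤ volume G ∧
        ∀ γ ∈ G, ∀ z : Fin d → ℤ, z ≠ 0 → (∀ j, |(z j : ℝ)| < H) → ∀ w : ℤ,
          3 / 4 * ((H : ℝ) ^ d)⁻¹ ≤ |h * ∑ j, (z j : ℝ) * γ j - w| := by
  have hd1 : (1 : ℝ) ≤ d := by exact_mod_cast hd
  have hd0 : (0 : ℝ) < d := by linarith
  obtain ⟨s, hs⟩ : ∃ s : ℝ, s = 1 / (100 * (d : ℝ)) := ⟨_, rfl⟩
  have hs0 : 0 < s := by rw [hs]; positivity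
  have hs1 : s ≤ 1 / 100 := by
    rw [hs, div_le_div_iff₀ (by positivity) (by norm_num)]
    linarith
  have hpow : (1 + 4 * s) ^ d ≤ 25 / 24 := hs ▸ one_add_pow_le hd
  obtain ⟨R, hR⟩ : ∃ R : ℕ, R = 8 * d ^ 2 := ⟨_, rfl⟩
  obtain ⟨P, hP⟩ : ∃ P : ℕ, P = R.factorial := ⟨_, rfl⟩
  have hP0 : 0 < P := hP ▸ R.factorial_pos
  have hP0' : (0 : ℝ) < P := by exact_mod_cast hP0
  have hRP : ∀ ℓ : ℕ, ℓ.Prime → (R < ℓ ↔ ¬ ℓ ∣ P) := fun ℓ hℓ => by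
    rw [hP, hℓ.dvd_factorial, not_le]
  obtain ⟨μ, hμ⟩ : ∃ μ : ℝ, μ = s / d / (2 * P) := ⟨_, rfl⟩
  have hμ0 : 0 < μ := by rw [hμ]; positivity
  refine ⟨1 / 2 * (μ ^ (d * d) * μ ^ d * (1 / (10 * d)) ^ d / 2 ^ d), by positivity, ?_⟩
  have hlarge : ∀ b : ℝ, ∀ᶠ H : ℕ in atTop, b ≤ H := fun b =>
    tendsto_natCast_atTop_atTop.eventually_ge_atTop b
  obtain ⟨H₀, hH₀⟩ := eventually_atTop.1 ((hlarge 2).and ((hlarge ((P + 1) / (s / 2))).and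
    ((hlarge (1 / μ)).and (eventually_mul_log_le (a := 32 * (d : ℝ) ^ 3) hμ0))))
  refine ⟨H₀, fun H hH h hh => ?_⟩
  obtain ⟨hH2, hHP, hHμ, hHlog⟩ := hH₀ H hH
  rw [div_le_iff₀ (by positivity)] at hHP hHμ
  have hH0 : (0 : ℝ) < H := by linarith
  obtain ⟨K, hK⟩ : ∃ K : ℕ, K = P * (⌊(1 + 3 / 2 * s) * H / P⌋₊ + 1) + 1 := ⟨_, rfl⟩
  have hKl : (1 + 3 / 2 * s) * H ≤ K := by
    have := Nat.lt_floor_add_one ((1 + 3 / 2 * s) * H / P)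
    rw [div_lt_iff₀ hP0'] at this
    rw [hK]
    push_cast
    linarith
  have hKu : (K : ℝ) ≤ (1 + 2 * s) * H := by
    have := Nat.floor_le (by positivity : 0 ≤ (1 + 3 / 2 * s) * H / P)
    rw [le_div_iff₀ hP0'] at this
    rw [hK]
    push_cast
    linarith
  have hK1 : 1 ≤ K := by omega
  have hKH : (H : ℝ) ≤ K := by linarith [mul_pos hs0 hH0]
  obtain ⟨τ, hτ⟩ : ∃ τ : ℝ, τ = s / d * K := ⟨_, rfl⟩
  have hdτ : d * τ = s * K := by rw [hτ]; field_simp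
  have hτ0 : 0 ≤ τ := by rw [hτ]; positivity
  have hKτ : (K : ℝ) + d * τ ≤ (1 + 4 * s) * H := by
    have e1 : (1 + s) * K ≤ (1 + s) * ((1 + 2 * s) * H) := by gcongr
    have e2 : s * (s * H) ≤ 1 / 100 * (s * H) := by gcongr
    rw [hdτ]
    nlinarith [mul_pos hs0 hH0]
  have hHK : (H : ℝ) ≤ K - d * τ := by
    have e1 : (1 - s) * ((1 + 3 / 2 * s) * H) ≤ (1 - s) * K :=
      mul_le_mul_of_nonneg_left hKl (by linarith)
    have e2 : s * (s * H) ≤ 1 / 100 * (s * H) := by gcongr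
    rw [hdτ]
    nlinarith [mul_pos hs0 hH0]
  have hτs : τ ≤ s * K := by
    rw [← hdτ]
    exact le_mul_of_one_le_left hτ0 hd1
  have hτH : τ < H := by
    have e1 : s * K ≤ 1 / 100 * (2 * H) := by
      gcongr
      exact hKu.trans (by gcongr; linarith)
    linarith
  obtain ⟨m, hm⟩ : ∃ m : ℕ, m = ⌊τ / P⌋₊ := ⟨_, rfl⟩
  have hmu : (P : ℝ) * m ≤ τ := by
    have := Nat.floor_le (by rw [hτ]; positivity : 0 ≤ τ / P)
    rw [le_div_iff₀ hP0'] at this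
    rw [hm]
    linarith
  have hml : μ * H ≤ m := by
    have e1 := Nat.lt_floor_add_one (τ / P)
    have e2 : 2 * (μ * H) ≤ τ / P := by
      calc 2 * (μ * H) = s / d * H / P := by rw [hμ]; field_simp
        _ ≤ s / d * K / P := by gcongr
        _ = τ / P := by rw [hτ]
    rw [← hm] at e1
    linarith
  have hm0 : 0 < m := by
    have : (0 : ℝ) < m := lt_of_lt_of_le (by positivity) hml
    exact_mod_cast this
  have hHd : (1 : ℝ) ≤ (H : ℝ) ^ d := one_le_pow₀ (by linarith)
  have hHd' : ((H : ℝ) ^ d)⁻¹ ≤ 1 := inv_le_one_of_one_le₀ hHd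
  have hHd0 : 0 < ((H : ℝ) ^ d)⁻¹ := by positivity
  obtain ⟨ε, hε⟩ : ∃ ε : ℝ, ε = 1 / (20 * d) * ((H : ℝ) ^ d)⁻¹ := ⟨_, rfl⟩
  have hε0 : 0 ≤ ε := by rw [hε]; positivity
  have hdε : d * ε = 1 / 20 * ((H : ℝ) ^ d)⁻¹ := by rw [hε]; field_simp
  have hεd : ε ≤ d * ε := le_mul_of_one_le_left hε0 hd1
  obtain ⟨Δ, hΔ⟩ : ∃ Δ : ℝ, Δ = ((1 + 4 * s) * H) ^ d := ⟨_, rfl⟩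
  have hΔ1 : 1 ≤ Δ := by
    rw [hΔ]
    exact one_le_pow₀ (by nlinarith)
  have hΔ2 : Δ ≤ (2 * H) ^ d := by
    rw [hΔ]
    gcongr
    linarith
  have hlog : Real.log ⌊Δ⌋₊ ≤ d * Real.log (2 * H) := by
    rw [← Real.log_pow]
    refine Real.log_le_log ?_ ((Nat.floor_le (by linarith)).trans hΔ2)
    exact_mod_cast Nat.floor_pos.2 hΔ1
  have hl1 : 1 ≤ Real.log (2 * H) := by
    rw [Real.le_log_iff_exp_le (by positivity)]
    have := Real.exp_one_lt_d9
    linarith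
  have hR' : (8 : ℝ) * d ^ 2 = R := by
    rw [hR]
    push_cast
    rfl
  have hsieve := sieve_error_le hd1 hR' hl1 hlog (by exact_mod_cast hm0) (hHlog.trans hml)
  obtain ⟨G, hGm, hGb, hGv, hG⟩ := exists_set_forall_le_abs (K := K) (ε := ε) (H := H)
    (κ := 3 / 4 * ((H : ℝ) ^ d)⁻¹) (Δ := Δ) hd hP0 hm0 hh hmu hH0 hHK hτH
    hK1 (by
      rw [hΔ]
      exact pow_le_pow_left₀ (by positivity) hKτ d) hε0 (by linarith) (by linarith) (by
      rw [hdε, hΔ, mul_pow]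
      calc (1 + 4 * s) ^ d * (H : ℝ) ^ d *
            (3 / 4 * ((H : ℝ) ^ d)⁻¹ + 1 / 20 * ((H : ℝ) ^ d)⁻¹)
          = (1 + 4 * s) ^ d * (4 / 5) := by field_simp; norm_num
        _ < 1 := by linarith) (by
      rw [mul_add, hdε, hdτ]
      have : (1 : ℝ) ≤ K := by exact_mod_cast hK1
      nlinarith) (by rw [hR]; positivity) hRP
      (by
        rw [hK]
        push_cast
        rw [add_sub_cancel_right]
        exact dvd_mul_right _ _) hsieve
  refine ⟨G, hGm, hGb, le_trans (ENNReal.ofReal_le_ofReal ?_) hGv, hG⟩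
  have hh' : (0 : ℝ) < h := by exact_mod_cast hh
  have hε2 : 2 * ε = 1 / (10 * d) * ((H : ℝ) ^ d)⁻¹ := by
    rw [hε]
    field_simp
    norm_num
  rw [← mul_volume_identity (η := 1 / (10 * (d : ℝ))) hH0 hh', ← hε2]
  gcongr

theorem exists_limsup_set {α : Type*} [MeasurableSpace α] {μ : Measure α} {S : Set α}
    (hS : μ S ≠ ⊤) {δ : ENNReal} (hδ : 0 < δ) {G : ℕ → Set α} {v₀ : ℕ}
    (hm : ∀ v ≥ v₀, MeasurableSet (G v)) (hGS : ∀ v ≥ v₀, G v ⊆ S) (hG : ∀ v ≥ v₀, δ ≤ μ (G v)) :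
    ∃ Y ⊆ S, 0 < μ Y ∧ ∀ γ ∈ Y, {v | v₀ ≤ v ∧ γ ∈ G v}.Infinite := by
  set U : ℕ → Set α := fun k => ⋃ v ∈ {v | max k v₀ ≤ v}, G v with hU
  have hge : ∀ {k v : ℕ}, max k v₀ ≤ v → v₀ ≤ v := fun h => (le_max_right _ _).trans h
  have hUS : ∀ k, U k ⊆ S := fun k => Set.iUnion₂_subset fun v hv => hGS v (hge hv)
  have hanti : Antitone U := fun a b hab =>
    Set.biUnion_subset_biUnion_left fun v hv => (max_le_max_right v₀ hab).trans hv
  refine ⟨⋂ k, U k, (Set.iInter_subset _ 0).trans (hUS 0), ?_, fun γ hγ => ?_⟩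
  · have hlim := tendsto_measure_iInter_atTop (μ := μ) (s := U) (fun k =>
      (MeasurableSet.biUnion (Set.to_countable _) fun v hv => hm v (hge hv)).nullMeasurableSet)
      hanti ⟨0, measure_ne_top_of_subset (hUS 0) hS⟩
    refine hδ.trans_le (ge_of_tendsto' hlim fun k => ?_)
    exact (hG _ (le_max_right k v₀)).trans
      (measure_mono (Set.subset_biUnion_of_mem (u := G) (le_refl (max k v₀))))
  · rw [Set.infinite_iff_exists_gt]
    intro k
    obtain ⟨v, hv, hvG⟩ := Set.mem_iUnion₂.1 (Set.mem_iInter.1 hγ (k + 1))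
    exact ⟨v, ⟨hge hv, hvG⟩, (le_max_left (k + 1) v₀).trans hv⟩

theorem volume_unitBall_ne_top (d : ℕ) :
    volume {γ : Fin d → ℝ | ∑ i, (γ i) ^ 2 ≤ 1} ≠ ⊤ := by
  have hbox : volume (Set.Icc (fun _ : Fin d => (-1 : ℝ)) fun _ => 1) ≠ ⊤ :=
    isCompact_Icc.measure_lt_top.ne
  refine measure_ne_top_of_subset (fun γ hγ => ?_) hbox
  have h : ∀ i, |γ i| ≤ 1 := fun i => by
    rw [← sq_le_one_iff_abs_le_one]
    exact (Finset.single_le_sum (fun j _ => sq_nonneg (γ j)) (Finset.mem_univ i)).trans hγ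
  exact ⟨fun i => (abs_le.1 (h i)).1, fun i => (abs_le.1 (h i)).2⟩

theorem gamma_ratio_bound {n : ℕ} (hn : 4 ≤ n) :
    ((n : ℝ) - 3) / (8 * ((n : ℝ) - 2) ^ ((3 : ℝ) / 2)) * Real.sqrt Real.pi *
      (Real.Gamma ((n : ℝ) - 1 / 2) / Real.Gamma (n : ℝ)) ≤ 1 / 8 := by
  have hn' : (4 : ℝ) ≤ n := by exact_mod_cast hn
  have h1 : Real.Gamma ((n : ℝ) - 1 / 2) / Real.Gamma (n : ℝ) ≤ 1 := by
    rw [div_le_one (Real.Gamma_pos_of_pos (by linarith))]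
    refine Real.Gamma_strictMonoOn_Ici.monotoneOn ?_ ?_ (by linarith) <;>
      rw [Set.mem_Ici] <;> linarith
  obtain ⟨v, hv⟩ : ∃ v, v = Real.sqrt ((n : ℝ) - 2) := ⟨_, rfl⟩
  have hv2 : v ^ 2 = n - 2 := by rw [hv, Real.sq_sqrt (by linarith)]
  have hv0 : 0 < v := by rw [hv, Real.sqrt_pos]; linarith
  have h2 : ((n : ℝ) - 2) ^ ((3 : ℝ) / 2) = v ^ 3 := by
    rw [hv, Real.sqrt_eq_rpow, ← Real.rpow_natCast, ← Real.rpow_mul (by linarith)]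
    norm_num
  have h3 : Real.sqrt Real.pi ≤ 2 := by
    rw [Real.sqrt_le_left (by norm_num)]
    linarith [Real.pi_le_four]
  have h4 : (n : ℝ) - 3 = v ^ 2 - 1 := by rw [hv2]; ring
  have h5 : ((n : ℝ) - 3) * 2 ≤ v ^ 3 := by
    rw [h4]
    nlinarith [mul_nonneg hv0.le (sq_nonneg (v - 4 / 3)), sq_nonneg (v - 4 / 3)]
  have h6 : 0 ≤ ((n : ℝ) - 3) / (8 * v ^ 3) := div_nonneg (by linarith) (by positivity)
  rw [h2]
  calc _ ≤ ((n : ℝ) - 3) / (8 * v ^ 3) * 2 * 1 := by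
        refine mul_le_mul (mul_le_mul_of_nonneg_left h3 h6) h1 ?_ (by positivity)
        exact div_nonneg (Real.Gamma_nonneg_of_nonneg (by linarith))
          (Real.Gamma_nonneg_of_nonneg (by linarith))
    _ = (((n : ℝ) - 3) * 2) / (8 * v ^ 3) := by ring
    _ ≤ v ^ 3 / (8 * v ^ 3) := by gcongr
    _ = 1 / 8 := by field_simp

theorem eventually_lt_of_limsup_eq {f : ℝ → ℝ} {c C : ℝ} (hc : 0 < c) (hC : c < C)
    (h : limsup f atTop = c) : ∀ᶠ t in atTop, f t < C := by
  refine eventually_lt_of_limsup_lt (h.trans_lt hC) ?_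
  by_contra hb
  have : {a : ℝ | ∀ᶠ t in atTop, f t ≤ a} = ∅ := by
    rw [Set.eq_empty_iff_forall_notMem]
    intro a ha
    exact hb ⟨a, by simpa using ha⟩
  rw [limsup_eq, this, Real.sInf_empty] at h
  exact hc.ne h

theorem tendsto_atTop_of_strictMono_int {M : ℕ → ℤ} (hM : StrictMono M) :
    Tendsto M atTop atTop := by
  refine tendsto_atTop_mono (f := fun v : ℕ => M 0 + (v : ℤ)) (fun v => ?_)
    (tendsto_atTop_add_const_left _ _ tendsto_natCast_atTop_atTop)
  induction v with
  | zero => simp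
  | succ v ih =>
    have := hM v.lt_add_one
    push_cast
    omega

theorem pow_mul_le_of_eventually {n : ℕ} {f : ℝ → ℝ} {C : ℝ}
    (hf : ∀ᶠ t : ℝ in atTop, t ^ n * f t < C) {M : ℕ → ℤ} (hM : StrictMono M) {L : ℕ → ℝ}
    (hL : ∀ (v : ℕ) (t : ℝ), (M v : ℝ) ≤ t → t < (M (v + 1) : ℝ) → f t = L v) :
    ∀ᶠ v in atTop, (M (v + 1) : ℝ) ^ n * L v ≤ C := by
  obtain ⟨t₀, ht₀⟩ := eventually_atTop.1 hf
  have h1 : Tendsto (fun v => (M v : ℝ)) atTop atTop :=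
    tendsto_intCast_atTop_atTop.comp (tendsto_atTop_of_strictMono_int hM)
  filter_upwards [h1.eventually_ge_atTop t₀] with v hv
  have hlt : (M v : ℝ) < M (v + 1) := by exact_mod_cast hM (Nat.lt_succ_self v)
  have h2 : Tendsto (fun t : ℝ => t ^ n * L v) (nhdsWithin (M (v + 1) : ℝ) (Set.Iio (M (v + 1) : ℝ)))
      (nhds ((M (v + 1) : ℝ) ^ n * L v)) :=
    ((continuous_pow n).mul continuous_const).continuousWithinAt
  refine le_of_tendsto h2 ?_
  filter_upwards [Ioo_mem_nhdsLT hlt] with t ht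
  rw [← hL v t ht.1.le ht.2]
  exact (ht₀ t (hv.trans ht.1.le)).le

theorem sum_mul_extendVec {n : ℕ} (hn : 2 ≤ n) (x : Fin n → ℝ) (ξ1 ξ2 : ℝ)
    (γ : Fin (n - 2) → ℝ) :
    ∑ i, x i * extendVec n ξ1 ξ2 γ i = x ⟨0, by omega⟩ * ξ1 + x ⟨1, by omega⟩ * ξ2 +
      ∑ j : Fin (n - 2), x ⟨j + 2, by omega⟩ * γ j := by
  obtain ⟨d, rfl⟩ : ∃ d, n = d + 2 := ⟨n - 2, by omega⟩
  rw [Fin.sum_univ_succ, Fin.sum_univ_succ, ← add_assoc]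
  rfl

/-- Two consecutive good approximations cannot be proportional in their first two coordinates. -/
theorem cross_ne_zero {ξ1 ξ2 L L' : ℝ} {b1 b2 b3 b1' b2' b3' : ℤ}
    (hL : L = |(b1 : ℝ) * ξ1 + b2 * ξ2 + b3|) (hL' : L' = |(b1' : ℝ) * ξ1 + b2' * ξ2 + b3'|)
    (hLL : L' < L) {M H : ℤ} (hM : M = max |b1| |b2|) (hH : H = max |b1'| |b2'|) (hM1 : 1 ≤ M)
    (hMH : M < H) (hHL : 2 * H * L < 1) : b1 * b2' - b2 * b1' ≠ 0 := by
  intro h0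
  have hMr : (1 : ℝ) ≤ M := by exact_mod_cast hM1
  have hMHr : (M : ℝ) < H := by exact_mod_cast hMH
  have hL'0 : 0 ≤ L' := hL' ▸ abs_nonneg _
  set f := (b1 : ℝ) * ξ1 + b2 * ξ2 + b3 with hf
  set f' := (b1' : ℝ) * ξ1 + b2' * ξ2 + b3' with hf'
  have h0r : (b1 : ℝ) * b2' - b2 * b1' = 0 := by exact_mod_cast h0
  have key : ∀ β β' : ℤ, |β| ≤ M → |β'| ≤ H → (β' : ℝ) * f - β * f' = ((β' * b3 - β * b3' : ℤ) : ℝ) →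
      |(β' : ℝ)| * L = |(β : ℝ)| * L' := by
    intro β β' hβ hβ' he
    have hβr : |(β : ℝ)| ≤ M := by exact_mod_cast hβ
    have hβr' : |(β' : ℝ)| ≤ H := by exact_mod_cast hβ'
    have h1 : |((β' * b3 - β * b3' : ℤ) : ℝ)| < 1 := by
      rw [← he]
      refine (abs_sub _ _).trans_lt ?_
      rw [abs_mul, abs_mul, ← hL, ← hL']
      have e1 : |(β' : ℝ)| * L ≤ H * L := by gcongr; linarith
      have e2 : |(β : ℝ)| * L' ≤ H * L := by
        refine mul_le_mul (by linarith) hLL.le hL'0 (by linarith)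
      linarith
    have h2 : β' * b3 - β * b3' = 0 := by
      rw [← Int.abs_lt_one_iff]
      exact_mod_cast h1
    rw [h2, Int.cast_zero, sub_eq_zero] at he
    rw [hL, hL', ← abs_mul, ← abs_mul, he]
  have h1 := key b1 b1' (hM ▸ le_max_left _ _) (hH ▸ le_max_left _ _) (by
    push_cast
    rw [hf, hf']
    linear_combination (-ξ2) * h0r)
  have h2 := key b2 b2' (hM ▸ le_max_right _ _) (hH ▸ le_max_right _ _) (by
    push_cast
    rw [hf, hf']
    linear_combination ξ1 * h0r)
  have hb1 : |(b1 : ℝ)| ≤ M := by exact_mod_cast hM ▸ le_max_left |b1| |b2|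
  have hb2 : |(b2 : ℝ)| ≤ M := by exact_mod_cast hM ▸ le_max_right |b1| |b2|
  have hlt : (M : ℝ) * L' < H * L := by
    have : (M : ℝ) * L' ≤ H * L' := by gcongr
    have : (H : ℝ) * L' < H * L := mul_lt_mul_of_pos_left hLL (by linarith)
    linarith
  rcases max_choice |b1'| |b2'| with h | h
  · have : (H : ℝ) = |(b1' : ℝ)| := by exact_mod_cast hH.trans h
    rw [this, h1] at hlt
    linarith [mul_le_mul_of_nonneg_right hb1 hL'0]
  · have : (H : ℝ) = |(b2' : ℝ)| := by exact_mod_cast hH.trans h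
    rw [this, h2] at hlt
    linarith [mul_le_mul_of_nonneg_right hb2 hL'0]

/-- Eliminating `ξ₁, ξ₂` from a small value of `x₁ξ₁ + x₂ξ₂ + s - y`. -/
theorem exists_abs_cross_mul_sub_lt {ξ1 ξ2 L L' : ℝ} {b1 b2 b3 b1' b2' b3' : ℤ}
    (hL : L = |(b1 : ℝ) * ξ1 + b2 * ξ2 + b3|) (hL' : L' = |(b1' : ℝ) * ξ1 + b2' * ξ2 + b3'|)
    (hLL : L' < L) {M H : ℤ} (hM : M = max |b1| |b2|) (hH : H = max |b1'| |b2'|)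
    (hMH : M < H) (hh : b1 * b2' - b2 * b1' ≠ 0) {x1 x2 : ℤ} (hx1 : |(x1 : ℝ)| ≤ H)
    (hx2 : |(x2 : ℝ)| ≤ H) {s : ℝ} {y : ℤ} (hF : |x1 * ξ1 + x2 * ξ2 + s - y| < L) :
    ∃ w : ℤ, |((b1 * b2' - b2 * b1').natAbs : ℝ) * s - w| < 6 * (H : ℝ) ^ 2 * L := by
  have hb1 : |(b1 : ℝ)| ≤ M := by exact_mod_cast hM ▸ le_max_left |b1| |b2|
  have hb2 : |(b2 : ℝ)| ≤ M := by exact_mod_cast hM ▸ le_max_right |b1| |b2|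
  have hb1' : |(b1' : ℝ)| ≤ H := by exact_mod_cast hH ▸ le_max_left |b1'| |b2'|
  have hb2' : |(b2' : ℝ)| ≤ H := by exact_mod_cast hH ▸ le_max_right |b1'| |b2'|
  have hM0 : (0 : ℝ) ≤ M := (abs_nonneg _).trans hb1
  have hMHr : (M : ℝ) ≤ H := by exact_mod_cast hMH.le
  have hL'0 : 0 ≤ L' := hL' ▸ abs_nonneg _
  have bound : ∀ a b c e : ℝ, |a| ≤ H → |b| ≤ H → |c| ≤ H → |e| ≤ H →
      |a * b - c * e| ≤ 2 * (H : ℝ) ^ 2 := by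
    intro a b c e ha hb hc he
    refine (abs_sub _ _).trans ?_
    rw [abs_mul, abs_mul]
    have h1 := mul_le_mul ha hb (abs_nonneg _) ((abs_nonneg _).trans ha)
    have h2 := mul_le_mul hc he (abs_nonneg _) ((abs_nonneg _).trans hc)
    linarith
  have hg := bound b1 b2' b2 b1' (by linarith) hb2' (by linarith) hb1'
  have hp := bound x2 b1' x1 b2' hx2 hb1' hx1 hb2'
  have hr := bound x1 b2 x2 b1 hx1 (by linarith) hx2 (by linarith)
  set g : ℤ := b1 * b2' - b2 * b1' with hgdef
  have hgr : (g : ℝ) = b1 * b2' - b2 * b1' := by rw [hgdef]; push_cast; ring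
  have hmain : |(g : ℝ) * s - (g * y - (x2 * b1' - x1 * b2') * b3 - (x1 * b2 - x2 * b1) * b3' : ℤ)| <
      6 * (H : ℝ) ^ 2 * L := by
    have e1 : (g : ℝ) * s - (g * y - (x2 * b1' - x1 * b2') * b3 - (x1 * b2 - x2 * b1) * b3' : ℤ) =
        g * (x1 * ξ1 + x2 * ξ2 + s - y) +
        ((x2 : ℝ) * b1' - x1 * b2') * ((b1 : ℝ) * ξ1 + b2 * ξ2 + b3) +
        ((x1 : ℝ) * b2 - x2 * b1) * ((b1' : ℝ) * ξ1 + b2' * ξ2 + b3') := by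
      push_cast
      rw [hgr]
      ring
    rw [e1]
    refine (abs_add_three _ _ _).trans_lt ?_
    simp only [abs_mul]
    rw [← hL, ← hL']
    have hg0 : 0 < |(g : ℝ)| := abs_pos.2 (by exact_mod_cast hh)
    rw [← hgr] at hg
    have hL0 : 0 ≤ L := hL ▸ abs_nonneg _
    have t1 : |(g : ℝ)| * |x1 * ξ1 + x2 * ξ2 + s - y| < |(g : ℝ)| * L :=
      mul_lt_mul_of_pos_left hF hg0
    have t2 : |(g : ℝ)| * L ≤ 2 * (H : ℝ) ^ 2 * L := by gcongr
    have t3 : |(x2 : ℝ) * b1' - x1 * b2'| * L ≤ 2 * (H : ℝ) ^ 2 * L := by gcongr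
    have t4 : |(x1 : ℝ) * b2 - x2 * b1| * L' ≤ 2 * (H : ℝ) ^ 2 * L :=
      mul_le_mul hr hLL.le hL'0 (by positivity)
    linarith
  rcases Int.natAbs_eq g with h | h
  · refine ⟨g * y - (x2 * b1' - x1 * b2') * b3 - (x1 * b2 - x2 * b1) * b3', ?_⟩
    have : (g : ℝ) = (g.natAbs : ℝ) := by
      rw [← Int.cast_natCast, Int.cast_inj]
      exact h
    rwa [this] at hmain
  · refine ⟨-(g * y - (x2 * b1' - x1 * b2') * b3 - (x1 * b2 - x2 * b1) * b3'), ?_⟩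
    have : (g : ℝ) = -(g.natAbs : ℝ) := by
      rw [← Int.cast_natCast, ← Int.cast_neg, Int.cast_inj]
      exact h
    rw [← abs_neg]
    rw [this] at hmain
    convert hmain using 2
    push_cast
    ring

theorem psiTwo_le {ξ1 ξ2 t : ℝ} {b1 b2 : ℤ} (b3 : ℤ) (h : b1 ≠ 0 ∨ b2 ≠ 0)
    (h1 : |(b1 : ℝ)| ≤ t) (h2 : |(b2 : ℝ)| ≤ t) :
    psiTwo ξ1 ξ2 t ≤ |(b1 : ℝ) * ξ1 + b2 * ξ2 + b3| := by
  refine csInf_le ⟨0, ?_⟩ ⟨b1, b2, b3, h, h1, h2, rfl⟩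
  rintro r ⟨_, _, _, _, _, _, rfl⟩
  exact abs_nonneg _

theorem le_abs_sum_extendVec_sub {n : ℕ} (hn : 2 ≤ n) {ξ1 ξ2 L L' : ℝ}
    {b1 b2 b3 b1' b2' b3' : ℤ}
    (hL : L = |(b1 : ℝ) * ξ1 + b2 * ξ2 + b3|) (hL' : L' = |(b1' : ℝ) * ξ1 + b2' * ξ2 + b3'|)
    (hLL : L' < L) {M H : ℤ} (hM : M = max |b1| |b2|) (hH : H = max |b1'| |b2'|)
    (hM1 : 1 ≤ M) (hMH : M < H) (hh : b1 * b2' - b2 * b1' ≠ 0) (hHL : (H : ℝ) ^ n * L ≤ 1 / 8)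
    (hψ : psiTwo ξ1 ξ2 ((H : ℝ) - 1 / 2) = L) {γ : Fin (n - 2) → ℝ}
    (hγ : ∀ z : Fin (n - 2) → ℤ, z ≠ 0 → (∀ j, |(z j : ℝ)| < H) → ∀ w : ℤ,
      3 / 4 * ((H : ℝ) ^ (n - 2))⁻¹ ≤
        |((b1 * b2' - b2 * b1').natAbs : ℝ) * ∑ j, (z j : ℝ) * γ j - w|)
    {x : Fin n → ℤ} (hx : ∃ j, x j ≠ 0) (hxH : ∀ j, |(x j : ℝ)| ≤ (H : ℝ) - 1 / 2) (y : ℤ) :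
    L ≤ |(∑ i, (x i : ℝ) * extendVec n ξ1 ξ2 γ i) - (y : ℝ)| := by
  rw [sum_mul_extendVec hn]
  by_cases hz : (fun j : Fin (n - 2) => x ⟨j + 2, by omega⟩) = 0
  · have hz' : ∀ j : Fin (n - 2), x ⟨j + 2, by omega⟩ = 0 := fun j => congrFun hz j
    have hx01 : x ⟨0, by omega⟩ ≠ 0 ∨ x ⟨1, by omega⟩ ≠ 0 := by
      by_contra! h
      obtain ⟨⟨j, hj⟩, hxj⟩ := hx
      rcases j with _ | _ | j
      · exact hxj h.1
      · exact hxj h.2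
      · exact hxj (hz' ⟨j, by omega⟩)
    have := psiTwo_le (ξ1 := ξ1) (ξ2 := ξ2) (-y) hx01 (hxH _) (hxH _)
    rw [hψ] at this
    simpa [hz', sub_eq_add_neg] using this
  · by_contra! hcon
    have hH1 : (1 : ℝ) < H := by exact_mod_cast hM1.trans_lt hMH
    obtain ⟨w, hw⟩ := exists_abs_cross_mul_sub_lt hL hL' hLL hM hH hMH hh
      ((hxH _).trans (by linarith)) ((hxH _).trans (by linarith)) hcon
    have hlow := hγ _ hz (fun j => (hxH _).trans_lt (by linarith)) w
    have hpos : (0 : ℝ) < (H : ℝ) ^ (n - 2) := by positivity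
    have hle : 6 * (H : ℝ) ^ 2 * L ≤ 3 / 4 * ((H : ℝ) ^ (n - 2))⁻¹ := by
      rw [← div_eq_mul_inv, le_div_iff₀ hpos]
      have : (H : ℝ) ^ n = (H : ℝ) ^ 2 * (H : ℝ) ^ (n - 2) := by
        rw [← pow_add]
        congr 1
        omega
      rw [this] at hHL
      linarith
    linarith

theorem psiDual_extendVec_eq {n : ℕ} (hn : 2 ≤ n) {ξ1 ξ2 t L : ℝ} {b1 b2 b3 : ℤ}
    (hL : L = |(b1 : ℝ) * ξ1 + b2 * ξ2 + b3|) (hb : b1 ≠ 0 ∨ b2 ≠ 0) (h1 : |(b1 : ℝ)| ≤ t)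
    (h2 : |(b2 : ℝ)| ≤ t) {γ : Fin (n - 2) → ℝ}
    (h : ∀ (x : Fin n → ℤ) (y : ℤ), (∃ j, x j ≠ 0) → (∀ j, |(x j : ℝ)| ≤ t) →
      L ≤ |(∑ i, (x i : ℝ) * extendVec n ξ1 ξ2 γ i) - (y : ℝ)|) :
    psiDual n (extendVec n ξ1 ξ2 γ) t = L := by
  refine IsLeast.csInf_eq ⟨?_, ?_⟩
  · refine ⟨fun i => if (i : ℕ) = 0 then b1 else if (i : ℕ) = 1 then b2 else 0, b3, ?_, ?_, ?_⟩
    · rcases hb with hb | hb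
      · exact ⟨⟨0, by omega⟩, by simpa using hb⟩
      · exact ⟨⟨1, by omega⟩, by simpa using hb⟩
    · intro i
      dsimp only
      split_ifs
      · exact h1
      · exact h2
      · simpa using (abs_nonneg _).trans h1
    · rw [sum_mul_extendVec hn, hL]
      simp
  · rintro r ⟨x, y, hx, hxt, rfl⟩
    simpa using h x (-y) hx hxt

/-- for `n ≥ 4`, `c ∈ (0,c_n)` and `ξ` as in Theorem 5.1 (with small
positive coordinates), given the sequence of best approximations `b_v ∈ ℤ³` of `ξ`
with heights `M_v` and values `L_v`, there is a set `𝒴` of positive `(n−2)`-dimensional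
Lebesgue measure inside the Euclidean unit ball of `ℝ^{n−2}` such that for all
`γ ∈ 𝒴`, for infinitely many `v`, with `T_v = M_{v+1} − 1/2`, every integer vector
`(x,y)` with `0 < max_j |x_j| ≤ T_v` satisfies `|x·ζ − y| ≥ L_v`, and the best
approximation function of `ζ = (ξ,γ)` at `T_v` equals `ψ_ξ(T_v) = L_v`. -/
theorem best_approx_stability (n : ℕ) (hn : 4 ≤ n)
    (c : ℝ) (hc0 : 0 < c)
    (hcn : c < ((n : ℝ) - 3) / (8 * ((n : ℝ) - 2) ^ ((3 : ℝ) / 2)) * Real.sqrt Real.pi *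
      (Real.Gamma ((n : ℝ) - 1 / 2) / Real.Gamma (n : ℝ))) :
    ∃ ε0 : ℝ, 0 < ε0 ∧
      ∀ ξ1 ξ2 : ℝ, 0 < ξ1 → ξ1 < ε0 → 0 < ξ2 → ξ2 < ε0 →
        LinearIndependent ℚ ![(1 : ℝ), ξ1, ξ2] →
        limsup (fun t : ℝ => t ^ n * psiTwo ξ1 ξ2 t) atTop = c →
        liminf (fun t : ℝ => t ^ n * psiTwo ξ1 ξ2 t) atTop = 0 →
        ∀ (b1 b2 b3 : ℕ → ℤ) (M : ℕ → ℤ) (L : ℕ → ℝ),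
          (∀ v, M v = max |b1 v| |b2 v|) →
          (∀ v, L v = |(b1 v : ℝ) * ξ1 + (b2 v : ℝ) * ξ2 + (b3 v : ℝ)|) →
          StrictMono M → StrictAnti L → (∀ v, 1 ≤ M v) →
          (∀ (v : ℕ) (t : ℝ), (M v : ℝ) ≤ t → t < (M (v + 1) : ℝ) →
            psiTwo ξ1 ξ2 t = L v) →
          ∃ 𝒴 : Set (Fin (n - 2) → ℝ),
            𝒴 ⊆ {γ | ∑ i, (γ i) ^ 2 ≤ 1} ∧
            0 < volume 𝒴 ∧
            ∀ γ ∈ 𝒴,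
              {v : ℕ |
                (∀ (x : Fin n → ℤ) (y : ℤ), (∃ j, x j ≠ 0) →
                  (∀ j, |(x j : ℝ)| ≤ (M (v + 1) : ℝ) - 1 / 2) →
                  L v ≤ |(∑ i, (x i : ℝ) * extendVec n ξ1 ξ2 γ i) - (y : ℝ)|) ∧
                psiDual n (extendVec n ξ1 ξ2 γ) ((M (v + 1) : ℝ) - 1 / 2) = L v ∧
                psiTwo ξ1 ξ2 ((M (v + 1) : ℝ) - 1 / 2) = L v}.Infinite := by
  refine ⟨1, one_pos, fun ξ1 ξ2 _ _ _ _ _ hlim _ b1 b2 b3 M L hM hL hMm hLa hM1 hψ => ?_⟩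
  obtain ⟨δ₀, hδ₀, H₀, hH₀⟩ := exists_uniform_sets (d := n - 2) (by omega)
  have hev := pow_mul_le_of_eventually (eventually_lt_of_limsup_eq hc0
    (hcn.trans_le (gamma_ratio_bound hn)) hlim) hMm hψ
  have hev' := ((tendsto_add_atTop_iff_nat 1).2
    (tendsto_atTop_of_strictMono_int hMm)).eventually_ge_atTop (H₀ : ℤ)
  obtain ⟨v₀, hv₀⟩ := eventually_atTop.1 (hev.and hev')
  have hlt : ∀ v, M v < M (v + 1) := fun v => hMm v.lt_add_one
  have hltr : ∀ v, (M v : ℝ) + 1 ≤ M (v + 1) := fun v => by exact_mod_cast hlt v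
  have hψ' : ∀ v, psiTwo ξ1 ξ2 ((M (v + 1) : ℝ) - 1 / 2) = L v := fun v =>
    hψ v _ (by linarith [hltr v]) (by linarith)
  have hLL : ∀ v, L (v + 1) < L v := fun v => hLa v.lt_add_one
  have hcross : ∀ v ≥ v₀, b1 v * b2 (v + 1) - b2 v * b1 (v + 1) ≠ 0 := by
    intro v hv
    refine cross_ne_zero (hL v) (hL (v + 1)) (hLL v) (hM v) (hM (v + 1)) (hM1 v) (hlt v) ?_
    have h1 : (1 : ℝ) ≤ M (v + 1) := by exact_mod_cast hM1 (v + 1)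
    have h2 : (M (v + 1) : ℝ) ≤ (M (v + 1) : ℝ) ^ n := le_self_pow₀ h1 (by omega)
    have h3 : 0 ≤ L v := hL v ▸ abs_nonneg _
    linarith [mul_le_mul_of_nonneg_right h2 h3, (hv₀ v hv).1]
  have hsets : ∀ v, ∃ G : Set (Fin (n - 2) → ℝ), v₀ ≤ v → MeasurableSet G ∧
      G ⊆ {γ | ∑ i, (γ i) ^ 2 ≤ 1} ∧ ENNReal.ofReal δ₀ ≤ volume G ∧
      ∀ γ ∈ G, ∀ z : Fin (n - 2) → ℤ, z ≠ 0 → (∀ j, |(z j : ℝ)| < M (v + 1)) → ∀ w : ℤ,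
        3 / 4 * ((M (v + 1) : ℝ) ^ (n - 2))⁻¹ ≤
          |((b1 v * b2 (v + 1) - b2 v * b1 (v + 1)).natAbs : ℝ) * ∑ j, (z j : ℝ) * γ j - w| := by
    intro v
    by_cases hv : v₀ ≤ v
    · have hnat : ((M (v + 1)).toNat : ℤ) = M (v + 1) := Int.toNat_of_nonneg (by
        linarith [hM1 (v + 1)])
      have hnat' : ((M (v + 1)).toNat : ℝ) = M (v + 1) := by exact_mod_cast hnat
      obtain ⟨G, hG⟩ := hH₀ (M (v + 1)).toNat (by have := (hv₀ v hv).2; omega) _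
        (Int.natAbs_pos.2 (hcross v hv))
      rw [hnat'] at hG
      exact ⟨G, fun _ => hG⟩
    · exact ⟨∅, fun h => absurd h hv⟩
  choose G hG using hsets
  obtain ⟨Y, hYS, hY0, hY⟩ := exists_limsup_set (volume_unitBall_ne_top (n - 2))
    (ENNReal.ofReal_pos.2 hδ₀) (fun v hv => (hG v hv).1) (fun v hv => (hG v hv).2.1)
    (fun v hv => (hG v hv).2.2.1)
  refine ⟨Y, hYS, hY0, fun γ hγ => (hY γ hγ).mono ?_⟩
  rintro v ⟨hv, hγv⟩
  have hmain : ∀ (x : Fin n → ℤ) (y : ℤ), (∃ j, x j ≠ 0) →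
      (∀ j, |(x j : ℝ)| ≤ (M (v + 1) : ℝ) - 1 / 2) →
      L v ≤ |(∑ i, (x i : ℝ) * extendVec n ξ1 ξ2 γ i) - (y : ℝ)| := fun x y hx hxH =>
    le_abs_sum_extendVec_sub (by omega) (hL v) (hL (v + 1)) (hLL v) (hM v) (hM (v + 1)) (hM1 v)
      (hlt v) (hcross v hv) (hv₀ v hv).1 (hψ' v) ((hG v hv).2.2.2 γ hγv) hx hxH y
  have hb1 : |(b1 v : ℝ)| ≤ M v := by exact_mod_cast hM v ▸ le_max_left |b1 v| |b2 v|
  have hb2 : |(b2 v : ℝ)| ≤ M v := by exact_mod_cast hM v ▸ le_max_right |b1 v| |b2 v|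
  have hb : b1 v ≠ 0 ∨ b2 v ≠ 0 := by
    by_contra! h
    have := hM1 v
    rw [hM v, h.1, h.2] at this
    simp at this
  refine ⟨hmain, ?_, hψ' v⟩
  exact psiDual_extendVec_eq (by omega) (hL v) hb (hb1.trans (by linarith [hltr v]))
    (hb2.trans (by linarith [hltr v])) hmain
end
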